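/- There exist a set A of natural numbers, a constant C > 0, and a threshold N₀ such that A(x) ≤ C·log x for all x ≥ 2, and every integer n ≥ N₀ (even or odd) can be written as n = a₁ + a₂ + p with a₁, a₂ ∈ A and p prime. (This follows from the existence of a set 𝒜 ⊆ 𝒫 with 𝒜(x) = O(log x) handling all large odd n, by taking A = 𝒜 ∪ (𝒜 + 1).) -/

import Mathlib

open Real

/-- The counting function of a set `A ⊆ ℕ`: `A(x) = |A ∩ [1, x]|`. -/
noncomputable def countFn (A : Set ℕ) (x : ℝ) : ℕ :=
  Set.ncard {a : ℕ | a ∈ A ∧ 1 ≤ a ∧ (a : ℝ) ≤ x}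

namespace AddCompl

open Finset
open scoped ArithmeticFunction.vonMangoldt

/-! ### The first theorem of Mertens -/

lemma sum_log_eq_sum_vonMangoldt_mul_div (N : ℕ) :
    ∑ n ∈ Ioc 0 N, Real.log n = ∑ n ∈ Ioc 0 N, Λ n * ((N / n : ℕ) : ℝ) := by
  rw [← ArithmeticFunction.sum_Ioc_mul_zeta_eq_sum, ArithmeticFunction.vonMangoldt_mul_zeta]
  rfl

lemma sum_log_eq_log_factorial (N : ℕ) :
    ∑ n ∈ Ioc 0 N, Real.log n = Real.log (N.factorial) := by
  induction N with
  | zero => simp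
  | succ k ih =>
    rw [Finset.sum_Ioc_succ_top (by omega), ih, Nat.factorial_succ, Nat.cast_mul,
      Real.log_mul (by positivity) (by positivity), add_comm]

lemma mertens_Ioc (N : ℕ) (hN : 1 ≤ N) :
    |∑ n ∈ Ioc 0 N, Λ n / n - Real.log N| ≤ 6 := by
  have hN0 : (0 : ℝ) < N := by exact_mod_cast hN
  have h1 : ∑ n ∈ Ioc 0 N, Λ n * ((N / n : ℕ) : ℝ) = Real.log (N.factorial) := by
    rw [← sum_log_eq_sum_vonMangoldt_mul_div, sum_log_eq_log_factorial]
  have hf : (0 : ℝ) < N.factorial := by positivity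
  have hup : Real.log (N.factorial) ≤ N * Real.log N := by
    rw [← Real.log_pow]
    apply Real.log_le_log hf
    exact_mod_cast Nat.factorial_le_pow N
  have hlo : N * Real.log N - N ≤ Real.log (N.factorial) := by
    have h2 := Real.pow_div_factorial_le_exp (N : ℝ) hN0.le N
    have h3 := Real.log_le_log (by positivity) h2
    rw [Real.log_exp, Real.log_div (by positivity) (by positivity), Real.log_pow] at h3
    linarith
  have hpsi : ∑ n ∈ Ioc 0 N, Λ n ≤ (Real.log 4 + 4) * N := by
    have := Chebyshev.psi_le_const_mul_self (x := N) hN0.le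
    rwa [Chebyshev.psi, Nat.floor_natCast] at this
  have hlog4 : Real.log 4 ≤ 2 := by
    have : Real.log 4 = 2 * Real.log 2 := by
      rw [show (4 : ℝ) = 2 ^ 2 by norm_num, Real.log_pow]; norm_num
    have := Real.log_two_lt_d9
    linarith
  have hle : ∑ n ∈ Ioc 0 N, Λ n * ((N / n : ℕ) : ℝ) ≤ N * ∑ n ∈ Ioc 0 N, Λ n / n := by
    rw [mul_sum]
    apply sum_le_sum
    intro n hn
    have := Nat.cast_div_le (α := ℝ) (m := N) (n := n)
    calc Λ n * ((N / n : ℕ) : ℝ) ≤ Λ n * (N / n) := by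
          gcongr
      _ = N * (Λ n / n) := by ring
  have hge : N * ∑ n ∈ Ioc 0 N, Λ n / n - ∑ n ∈ Ioc 0 N, Λ n
      ≤ ∑ n ∈ Ioc 0 N, Λ n * ((N / n : ℕ) : ℝ) := by
    rw [mul_sum, ← sum_sub_distrib]
    apply sum_le_sum
    intro n hn
    have hn0 : 0 < n := (mem_Ioc.1 hn).1
    have h5 : (N : ℝ) / n < ((N / n : ℕ) : ℝ) + 1 := by
      rw [div_lt_iff₀ (by positivity)]
      exact_mod_cast Nat.lt_mul_of_div_lt (by omega) hn0
    have hv : 0 ≤ Λ n := ArithmeticFunction.vonMangoldt_nonneg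
    calc N * (Λ n / n) - Λ n = Λ n * (N / n - 1) := by ring
      _ ≤ _ := by gcongr; linarith
  rw [abs_le]
  constructor
  · have : N * (Real.log N - 1) ≤ N * ∑ n ∈ Ioc 0 N, Λ n / n := by linarith
    have := le_of_mul_le_mul_left this hN0
    linarith
  · have : N * ∑ n ∈ Ioc 0 N, Λ n / n ≤ N * (Real.log N + 6) := by nlinarith
    have := le_of_mul_le_mul_left this hN0
    linarith

lemma mertens_range (N : ℕ) (hN : 1 ≤ N) :
    |∑ n ∈ range N, Λ n / n - Real.log N| ≤ 8 := by
  have h0 : ∑ n ∈ range (N + 1), Λ n / (n : ℝ) = ∑ n ∈ Ioc 0 N, Λ n / n := by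
    rw [Finset.range_eq_Ico, Finset.sum_eq_sum_Ico_succ_bot (by omega)]
    simp only [Nat.cast_zero, div_zero, zero_add]
    apply Finset.sum_congr _ (fun _ _ => rfl)
    ext i; simp; omega
  have h1 := mertens_Ioc N hN
  rw [← h0, Finset.sum_range_succ] at h1
  have hN0 : (0 : ℝ) < N := by exact_mod_cast hN
  have h2 : Λ N / (N : ℝ) ≤ 1 := by
    rw [div_le_one hN0]
    exact (ArithmeticFunction.vonMangoldt_le_log).trans (Real.log_le_self hN0.le)
  have h3 : 0 ≤ Λ N / (N : ℝ) := div_nonneg ArithmeticFunction.vonMangoldt_nonneg hN0.le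
  rw [abs_le] at h1 ⊢
  constructor <;> linarith [h1.1, h1.2]

/-- Sum of `log p / p` over primes `z ≤ p < w`. -/
lemma sum_log_prime_div_le {z w : ℕ} (hz : 1 ≤ z) (hzw : z ≤ w) :
    ∑ p ∈ (Ico z w).filter Nat.Prime, Real.log p / p ≤ Real.log w - Real.log z + 16 := by
  have h1 := abs_le.1 (mertens_range z hz)
  have h2 := abs_le.1 (mertens_range w (hz.trans hzw))
  have h3 := Finset.sum_range_add_sum_Ico (fun n : ℕ => Λ n / (n : ℝ)) hzw
  have h4 : ∑ p ∈ (Ico z w).filter Nat.Prime, Real.log p / p ≤ ∑ n ∈ Ico z w, Λ n / (n : ℝ) := by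
    rw [Finset.sum_filter]
    apply sum_le_sum
    intro n hn
    split_ifs with h
    · rw [ArithmeticFunction.vonMangoldt_apply_prime h]
    · exact div_nonneg ArithmeticFunction.vonMangoldt_nonneg (by positivity)
  linarith [h1.1, h1.2, h2.1, h2.2]

/-! ### Rough numbers and the sieve product -/

/-- All prime factors of `n` are at least `y`. -/
def rough (y n : ℕ) : Prop := ∀ p, p.Prime → p ∣ n → y ≤ p

noncomputable instance (y : ℕ) : DecidablePred (rough y) := fun _ => Classical.propDecidable _

lemma rough_mul {y a b : ℕ} : rough y (a * b) ↔ rough y a ∧ rough y b := by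
  constructor
  · intro h
    exact ⟨fun p hp hd => h p hp (hd.mul_right _), fun p hp hd => h p hp (hd.mul_left _)⟩
  · rintro ⟨h1, h2⟩ p hp hd
    rcases hp.dvd_mul.1 hd with h | h
    · exact h1 p hp h
    · exact h2 p hp h

lemma rough_one (y : ℕ) : rough y 1 := by
  intro p hp hd
  exact absurd (Nat.dvd_one.1 hd) hp.one_lt.ne'

lemma rough_mono {y z n : ℕ} (h : y ≤ z) (hn : rough z n) : rough y n :=
  fun p hp hd => h.trans (hn p hp hd)

lemma rough_prime {y p : ℕ} (hp : p.Prime) : rough y p ↔ y ≤ p := by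
  constructor
  · intro h; exact h p hp dvd_rfl
  · intro h q hq hd
    rwa [(Nat.prime_dvd_prime_iff_eq hq hp).1 hd]

lemma rough_two (n : ℕ) : rough 2 n := fun _ hp _ => hp.two_le

lemma rough_of_dvd {y m n : ℕ} (h : m ∣ n) (hn : rough y n) : rough y m :=
  fun p hp hd => hn p hp (hd.trans h)

lemma rough_succ_iff_of_not_prime {y n : ℕ} (hy : ¬ y.Prime) : rough (y + 1) n ↔ rough y n := by
  constructor
  · exact rough_mono (by omega)
  · intro h p hp hd
    have h1 := h p hp hd
    rcases h1.lt_or_eq with h2 | h2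
    · omega
    · subst h2; exact absurd hp hy

lemma rough_succ_iff_of_prime {p n : ℕ} (hp : p.Prime) :
    rough (p + 1) n ↔ rough p n ∧ ¬ p ∣ n := by
  constructor
  · intro h
    refine ⟨rough_mono (by omega) h, fun hd => ?_⟩
    have := h p hp hd
    omega
  · rintro ⟨h1, h2⟩ q hq hd
    have h3 := h1 q hq hd
    rcases h3.lt_or_eq with h4 | h4
    · omega
    · subst h4; exact absurd hd h2

lemma rough_eq_one {y n : ℕ} (h : rough y n) (hn : 1 ≤ n) (hny : n < y) : n = 1 := by
  by_contra hne
  have h1 := h n.minFac (Nat.minFac_prime hne) (Nat.minFac_dvd n)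
  have h2 := Nat.minFac_le (n := n) hn
  omega

/-- The sieve product `∏_{p < w} (1 - 1/p)`. -/
noncomputable def V (w : ℕ) : ℝ := ∏ p ∈ Nat.primesBelow w, (1 - 1 / (p : ℝ))

lemma one_sub_inv_prime_pos {p : ℕ} (hp : p.Prime) : 0 < 1 - 1 / (p : ℝ) := by
  have h : (1 : ℝ) < p := by exact_mod_cast hp.one_lt
  rw [sub_pos, div_lt_one (by linarith)]
  exact h

lemma V_pos (w : ℕ) : 0 < V w :=
  Finset.prod_pos fun _ hp => one_sub_inv_prime_pos (Nat.mem_primesBelow.1 hp).2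

lemma V_succ_of_prime {p : ℕ} (hp : p.Prime) : V (p + 1) = V p * (1 - 1 / (p : ℝ)) := by
  rw [V, Nat.primesBelow_succ, if_pos hp, prod_insert (by simp [Nat.mem_primesBelow]), mul_comm, V]

lemma V_succ_of_not_prime {p : ℕ} (hp : ¬ p.Prime) : V (p + 1) = V p := by
  rw [V, Nat.primesBelow_succ, if_neg hp, V]

lemma V_two : V 2 = 1 := by
  have : Nat.primesBelow 2 = ∅ := by decide
  simp [V, this]

lemma V_eq_mul_prod {z w : ℕ} (h : z ≤ w) :
    V w = V z * ∏ p ∈ (Ico z w).filter Nat.Prime, (1 - 1 / (p : ℝ)) := by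
  rw [V, V, ← Finset.prod_union]
  · apply Finset.prod_congr _ (fun _ _ => rfl)
    ext p
    simp only [Nat.mem_primesBelow, mem_union, mem_filter, mem_Ico]
    constructor
    · rintro ⟨h1, h2⟩
      by_cases h3 : p < z
      · exact Or.inl ⟨h3, h2⟩
      · exact Or.inr ⟨⟨by omega, h1⟩, h2⟩
    · rintro (⟨h1, h2⟩ | ⟨⟨h0, h1⟩, h2⟩)
      · exact ⟨by omega, h2⟩
      · exact ⟨h1, h2⟩
  · rw [Finset.disjoint_left]
    intro p hp hq
    simp only [Nat.mem_primesBelow, mem_filter, mem_Ico] at hp hq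
    omega

/-- Dimension constant for the ratio bound of the sieve product. -/
def C0 : ℕ := 73

lemma V_le_of_le_sq {z w : ℕ} (hz : 2 ≤ z) (hzw : z ≤ w) (hw : w ≤ z ^ 2) :
    V z ≤ 2 ^ C0 * V w := by
  have hlz : Real.log 2 ≤ Real.log z := Real.log_le_log (by norm_num) (by exact_mod_cast hz)
  have hl2 : (0.69 : ℝ) < Real.log 2 := by linarith [Real.log_two_gt_d9]
  have h1 := sum_log_prime_div_le (by omega : 1 ≤ z) hzw
  have hw' : Real.log w ≤ 2 * Real.log z := by
    have : Real.log w ≤ Real.log ((z : ℝ) ^ 2) :=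
      Real.log_le_log (by exact_mod_cast (by omega : 0 < w)) (by exact_mod_cast hw)
    rwa [Real.log_pow, Nat.cast_ofNat] at this
  have hsum : ∑ p ∈ (Ico z w).filter Nat.Prime, 1 / (p : ℝ) ≤ 25 := by
    have h2 : Real.log z * ∑ p ∈ (Ico z w).filter Nat.Prime, 1 / (p : ℝ)
        ≤ ∑ p ∈ (Ico z w).filter Nat.Prime, Real.log p / p := by
      rw [mul_sum]
      apply sum_le_sum
      intro p hp
      rw [mem_filter, mem_Ico] at hp
      rw [mul_one_div]
      gcongr
      exact hp.1.1
    have hz0 : 0 < Real.log z := by linarith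
    have h3 : Real.log z * ∑ p ∈ (Ico z w).filter Nat.Prime, 1 / (p : ℝ) ≤ Real.log z * 25 := by
      linarith
    exact le_of_mul_le_mul_left h3 hz0
  have hprod : Real.exp (-50) ≤ ∏ p ∈ (Ico z w).filter Nat.Prime, (1 - 1 / (p : ℝ)) := by
    have : ∀ p ∈ (Ico z w).filter Nat.Prime, Real.exp (-(2 * (1 / (p : ℝ)))) ≤ 1 - 1 / (p : ℝ) := by
      intro p hp
      rw [mem_filter] at hp
      have hp2 : (2 : ℝ) ≤ p := by exact_mod_cast hp.2.two_le
      set t := 1 / (p : ℝ) with ht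
      have ht0 : 0 ≤ t := by positivity
      have ht1 : t ≤ 1 / 2 := by
        rw [ht]; exact one_div_le_one_div_of_le (by norm_num) hp2
      rw [Real.exp_neg, inv_le_comm₀ (Real.exp_pos _) (by linarith)]
      calc (1 - t)⁻¹ ≤ 2 * t + 1 := by
            rw [inv_le_comm₀ (by linarith) (by linarith), inv_le_comm₀ (by linarith) (by linarith)]
            rw [inv_eq_one_div, div_le_iff₀ (by linarith)]
            nlinarith
        _ ≤ _ := Real.add_one_le_exp _
    calc Real.exp (-50) ≤ Real.exp (∑ p ∈ (Ico z w).filter Nat.Prime, -(2 * (1 / (p : ℝ)))) := by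
          apply Real.exp_le_exp.2
          rw [Finset.sum_neg_distrib, ← mul_sum]
          linarith
      _ = ∏ p ∈ (Ico z w).filter Nat.Prime, Real.exp (-(2 * (1 / (p : ℝ)))) := Real.exp_sum _ _
      _ ≤ _ := Finset.prod_le_prod (fun _ _ => (Real.exp_pos _).le) this
  have hexp : (1 : ℝ) ≤ 2 ^ C0 * Real.exp (-50) := by
    have : (2 : ℝ) ^ C0 = Real.exp (73 * Real.log 2) := by
      rw [show (73 : ℝ) * Real.log 2 = Real.log 2 * ((73 : ℕ) : ℝ) by push_cast; ring, Real.exp_mul,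
        Real.exp_log (by norm_num), Real.rpow_natCast]; rfl
    rw [this, ← Real.exp_add, Real.one_le_exp_iff]
    linarith
  rw [V_eq_mul_prod hzw]
  have hV := V_pos z
  calc V z = V z * 1 := by ring
    _ ≤ V z * (2 ^ C0 * Real.exp (-50)) := by gcongr
    _ ≤ V z * (2 ^ C0 * ∏ p ∈ (Ico z w).filter Nat.Prime, (1 - 1 / (p : ℝ))) := by gcongr
    _ = _ := by ring

lemma V_ratio {z w : ℕ} (hz : 2 ≤ z) (hzw : z ≤ w) :
    V z ≤ 2 ^ C0 * (Real.log w / Real.log z) ^ C0 * V w := by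
  induction hk : w - z using Nat.strong_induction_on generalizing z with
  | _ k ih =>
    have hl2 : (0 : ℝ) < Real.log z := Real.log_pos (by exact_mod_cast (by omega : 1 < z))
    by_cases h : w ≤ z ^ 2
    · have h1 := V_le_of_le_sq hz hzw h
      have h2 : Real.log z ≤ Real.log w :=
        Real.log_le_log (by exact_mod_cast (by omega : 0 < z)) (by exact_mod_cast hzw)
      have h3 : 1 ≤ (Real.log w / Real.log z) ^ C0 :=
        one_le_pow₀ (by rwa [one_le_div hl2])
      have hV := V_pos w
      calc V z ≤ 2 ^ C0 * 1 * V w := by linarith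
        _ ≤ _ := by gcongr
    · push Not at h
      have hzz : z < z ^ 2 := by nlinarith
      have h1 := V_le_of_le_sq hz hzz.le le_rfl
      have h2 := ih (w - z ^ 2) (by omega) (by omega : 2 ≤ z ^ 2) h.le rfl
      have h3 : (2 : ℝ) ^ C0 * (Real.log w / Real.log ((z ^ 2 : ℕ) : ℝ)) ^ C0
          = (Real.log w / Real.log z) ^ C0 := by
        rw [← mul_pow]; congr 1
        rw [Nat.cast_pow, Real.log_pow]
        push_cast
        field_simp
      rw [h3] at h2
      calc V z ≤ 2 ^ C0 * V (z ^ 2) := h1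
        _ ≤ 2 ^ C0 * ((Real.log w / Real.log z) ^ C0 * V w) := by gcongr
        _ = _ := by ring

lemma sum_filter_dvd_eq {a : ℕ → ℝ} {N p : ℕ} (hp : 1 ≤ p) (ha : ∀ n, N ≤ n → a n = 0) :
    ∑ n ∈ (range N).filter (p ∣ ·), a n = ∑ m ∈ range N, a (p * m) := by
  symm
  apply Finset.sum_bij_ne_zero (fun m _ _ => p * m)
  · intro m hm hne
    rw [mem_filter, mem_range]
    refine ⟨?_, dvd_mul_right _ _⟩
    by_contra h
    exact hne (ha _ (by omega))
  · intro m _ _ m' _ _ h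
    exact Nat.eq_of_mul_eq_mul_left hp h
  · intro n hn hne
    rw [mem_filter, mem_range] at hn
    obtain ⟨m, rfl⟩ := hn.2
    refine ⟨m, ?_, hne, rfl⟩
    rw [mem_range]
    nlinarith [hn.1]
  · intros; rfl

lemma sum_rough_inv_le {y X : ℕ} (hX : 2 ≤ X) (hy : y ≤ X) :
    ∑ d ∈ (Ico 1 X).filter (rough y), 1 / (d : ℝ) ≤ V y / V X := by
  induction hy using Nat.decreasingInduction with
  | self =>
    rw [div_self (V_pos X).ne']
    have : (Ico 1 X).filter (rough X) = {1} := by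
      ext d
      simp only [mem_filter, mem_Ico, mem_singleton]
      constructor
      · rintro ⟨⟨h1, h2⟩, h3⟩; exact rough_eq_one h3 h1 h2
      · rintro rfl; exact ⟨⟨le_rfl, by omega⟩, rough_one _⟩
    rw [this]; simp
  | of_succ p hpX ih =>
    by_cases hp : p.Prime
    · rw [V_succ_of_prime hp] at ih
      have hsplit : ∑ d ∈ (Ico 1 X).filter (rough p), 1 / (d : ℝ)
          = ∑ d ∈ (Ico 1 X).filter (rough (p + 1)), 1 / (d : ℝ)
            + ∑ d ∈ ((Ico 1 X).filter (rough p)).filter (p ∣ ·), 1 / (d : ℝ) := by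
        rw [← Finset.sum_filter_add_sum_filter_not ((Ico 1 X).filter (rough p)) (p ∣ ·), add_comm]
        congr 1
        apply Finset.sum_congr _ (fun _ _ => rfl)
        ext d
        simp only [mem_filter, rough_succ_iff_of_prime hp]
        tauto
      have hle : ∑ d ∈ ((Ico 1 X).filter (rough p)).filter (p ∣ ·), 1 / (d : ℝ)
          ≤ 1 / (p : ℝ) * ∑ d ∈ (Ico 1 X).filter (rough p), 1 / (d : ℝ) := by
        set a : ℕ → ℝ := fun d => if d ∈ (Ico 1 X).filter (rough p) then 1 / (d : ℝ) else 0 with ha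
        have e1 : ∑ d ∈ ((Ico 1 X).filter (rough p)).filter (p ∣ ·), 1 / (d : ℝ)
            = ∑ n ∈ (range X).filter (p ∣ ·), a n := by
          rw [ha, ← Finset.sum_filter]
          apply Finset.sum_congr _ (fun _ _ => rfl)
          ext d
          simp only [mem_filter, mem_Ico, mem_range]
          constructor
          · rintro ⟨⟨⟨h1, h2⟩, h3⟩, h4⟩; exact ⟨⟨h2, h4⟩, ⟨h1, h2⟩, h3⟩
          · rintro ⟨⟨h2, h4⟩, ⟨h1, _⟩, h3⟩; exact ⟨⟨⟨h1, h2⟩, h3⟩, h4⟩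
        rw [e1, sum_filter_dvd_eq hp.one_le, mul_sum]
        · have e2 : ∑ d ∈ (Ico 1 X).filter (rough p), 1 / (p : ℝ) * (1 / (d : ℝ))
              = ∑ m ∈ range X, if m ∈ (Ico 1 X).filter (rough p) then
                1 / (p : ℝ) * (1 / (m : ℝ)) else 0 := by
            rw [← Finset.sum_filter]
            apply Finset.sum_congr _ (fun _ _ => rfl)
            ext d
            simp only [mem_filter, mem_Ico, mem_range]
            tauto
          rw [e2]
          apply Finset.sum_le_sum
          intro m hm
          simp only [ha]
          by_cases h1 : p * m ∈ (Ico 1 X).filter (rough p)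
          · have h2 : m ∈ (Ico 1 X).filter (rough p) := by
              simp only [mem_filter, mem_Ico] at h1 ⊢
              refine ⟨⟨Nat.pos_of_mul_pos_left (a := p) (by omega), mem_range.1 hm⟩,
                (rough_mul.1 h1.2).2⟩
            rw [if_pos h1, if_pos h2]
            push_cast
            rw [one_div_mul_one_div]
          · rw [if_neg h1]
            split_ifs
            · positivity
            · exact le_rfl
        · intro n hn
          simp only [ha]
          rw [if_neg]
          simp only [mem_filter, mem_Ico]
          omega
      have hpp := one_sub_inv_prime_pos hp
      have h5 : (1 - 1 / (p : ℝ)) * ∑ d ∈ (Ico 1 X).filter (rough p), 1 / (d : ℝ)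
          ≤ (1 - 1 / (p : ℝ)) * (V p / V X) := by
        calc _ ≤ ∑ d ∈ (Ico 1 X).filter (rough (p + 1)), 1 / (d : ℝ) := by linarith
          _ ≤ _ := ih
          _ = _ := by ring
      exact le_of_mul_le_mul_left h5 hpp
    · rw [V_succ_of_not_prime hp] at ih
      simpa only [rough_succ_iff_of_not_prime hp] using ih

lemma log_le_sum_inv (X : ℕ) : Real.log X ≤ ∑ d ∈ Ico 1 X, 1 / (d : ℝ) := by
  rcases Nat.eq_zero_or_pos X with rfl | hX
  · simp
  obtain ⟨k, rfl⟩ : ∃ k, X = k + 1 := ⟨X - 1, by omega⟩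
  have h := log_add_one_le_harmonic k
  rw [harmonic_eq_sum_Icc] at h
  push_cast at h ⊢
  refine h.trans (le_of_eq ?_)
  apply Finset.sum_congr
  · ext i; simp
  · intro i _; rw [one_div]

lemma V_mul_log_le {X : ℕ} (hX : 2 ≤ X) : V X * Real.log X ≤ 1 := by
  have h1 := sum_rough_inv_le hX hX
  rw [V_two, Finset.filter_true_of_mem (fun d _ => rough_two d)] at h1
  have h2 := (log_le_sum_inv X).trans h1
  rw [le_div_iff₀ (V_pos X)] at h2
  linarith

lemma sum_rough_inv_le_log {y X : ℕ} (hy : 2 ≤ y) (hyX : y ≤ X) :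
    ∑ d ∈ (Ico 1 X).filter (rough y), 1 / (d : ℝ)
      ≤ 2 ^ C0 * (Real.log X / Real.log y) ^ C0 := by
  refine (sum_rough_inv_le (hy.trans hyX) hyX).trans ?_
  rw [div_le_iff₀ (V_pos X)]
  exact V_ratio hy hyX

lemma sum_primesBelow_log_div_le {w : ℕ} (hw : 2 ≤ w) :
    ∑ p ∈ Nat.primesBelow w, Real.log p / p ≤ Real.log w + 16 := by
  have h := sum_log_prime_div_le le_rfl (by omega : 1 ≤ w)
  have e : Nat.primesBelow w = (Ico 1 w).filter Nat.Prime := by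
    ext p
    simp only [Nat.mem_primesBelow, mem_filter, mem_Ico]
    exact ⟨fun h => ⟨⟨h.2.one_le, h.1⟩, h.2⟩, fun h => ⟨h.1.2, h.2⟩⟩
  rw [e]
  simpa using h

/-- If every prime in `s ⊆ [1, w)` satisfies `log p ≤ (1 - η) log w`, the weighted power sum
over `s` is exponentially small in the exponent. -/
lemma sum_pow_log_le_of_le {w m : ℕ} (hw : 2 ≤ w) {η : ℝ} (hη1 : η ≤ 1) {s : Finset ℕ}
    (hs : s ⊆ Nat.primesBelow w)
    (h : ∀ p ∈ s, Real.log p ≤ (1 - η) * Real.log w) :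
    ∑ p ∈ s, 1 / (p : ℝ) * (Real.log p / Real.log w) ^ (m + 1) ≤ (1 - η) ^ m * 25 := by
  have hl : 0 < Real.log w := Real.log_pos (by exact_mod_cast (by omega : 1 < w))
  have hl2 : (0.69 : ℝ) < Real.log w := by
    have := Real.log_le_log (by norm_num : (0 : ℝ) < 2) (by exact_mod_cast hw : (2 : ℝ) ≤ w)
    linarith [Real.log_two_gt_d9]
  calc ∑ p ∈ s, 1 / (p : ℝ) * (Real.log p / Real.log w) ^ (m + 1)
      ≤ ∑ p ∈ s, (1 - η) ^ m * (1 / Real.log w) * (Real.log p / p) := by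
        apply Finset.sum_le_sum
        intro p hp
        have hp0 : 0 ≤ Real.log p := Real.log_natCast_nonneg p
        have h1 : Real.log p / Real.log w ≤ 1 - η := by
          rw [div_le_iff₀ hl]; exact h p hp
        calc 1 / (p : ℝ) * (Real.log p / Real.log w) ^ (m + 1)
            = 1 / (p : ℝ) * ((Real.log p / Real.log w) ^ m * (Real.log p / Real.log w)) := by
              rw [pow_succ]
          _ ≤ 1 / (p : ℝ) * ((1 - η) ^ m * (Real.log p / Real.log w)) := by gcongr
          _ = _ := by ring
    _ = (1 - η) ^ m * (1 / Real.log w) * ∑ p ∈ s, Real.log p / p := by rw [mul_sum]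
    _ ≤ (1 - η) ^ m * (1 / Real.log w) * (25 * Real.log w) := by
        have : 0 ≤ 1 - η := by linarith
        gcongr
        calc ∑ p ∈ s, Real.log p / (p : ℝ) ≤ ∑ p ∈ Nat.primesBelow w, Real.log p / p :=
              Finset.sum_le_sum_of_subset_of_nonneg hs
                (fun p _ _ => div_nonneg (Real.log_natCast_nonneg p) (by positivity))
          _ ≤ Real.log w + 16 := sum_primesBelow_log_div_le hw
          _ ≤ _ := by linarith
    _ = _ := by field_simp

lemma exists_sum_pow_log_le {σ : ℝ} (hσ : 0 < σ) :
    ∃ m0 : ℕ, ∀ m, m0 ≤ m → ∀ w : ℕ, 2 ≤ w →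
      ∑ p ∈ Nat.primesBelow w, 1 / (p : ℝ) * (Real.log p / Real.log w) ^ m ≤ σ := by
  -- threshold between bounded and large `w`
  obtain ⟨W, hW⟩ := exists_nat_gt (Real.exp (64 / σ))
  set W0 : ℕ := max W 2 with hW0
  have hW02 : 2 ≤ W0 := le_max_right _ _
  set η : ℝ := min (min (σ / 4) (1 / 2)) (1 / (W0 * Real.log W0)) with hη
  have hlW0 : 0 < Real.log W0 := Real.log_pos (by exact_mod_cast (by omega : 1 < W0))
  have hη0 : 0 < η := by
    rw [hη]
    have : (0 : ℝ) < W0 := by exact_mod_cast (by omega : 0 < W0)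
    refine lt_min (lt_min (by linarith) (by norm_num)) (by positivity)
  have hη1 : η ≤ 1 / 2 := (min_le_left _ _).trans (min_le_right _ _)
  have hησ : η ≤ σ / 4 := (min_le_left _ _).trans (min_le_left _ _)
  have hηW : η ≤ 1 / (W0 * Real.log W0) := min_le_right _ _
  obtain ⟨m1, hm1⟩ := exists_pow_lt_of_lt_one (by positivity : 0 < σ / 50)
    (by linarith : 1 - η < 1)
  have key : ∀ m, m1 ≤ m → (1 - η) ^ m * 25 ≤ σ / 2 := by
    intro m hm
    have : (1 - η) ^ m ≤ (1 - η) ^ m1 := pow_le_pow_of_le_one (by linarith) (by linarith) hm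
    linarith
  refine ⟨m1 + 1, ?_⟩
  intro m' hm' w hw
  obtain ⟨m, rfl⟩ : ∃ m, m' = m + 1 := ⟨m' - 1, by omega⟩
  have hm : m1 ≤ m := by omega
  have hl : 0 < Real.log w := Real.log_pos (by exact_mod_cast (by omega : 1 < w))
  have hw0 : (0 : ℝ) < w := by exact_mod_cast (by omega : 0 < w)
  rcases le_or_gt w W0 with hwW | hwW
  · refine (sum_pow_log_le_of_le hw (by linarith : η ≤ 1) (Finset.Subset.refl _) ?_).trans
      ((key m hm).trans (by linarith))
    intro p hp
    rw [Nat.mem_primesBelow] at hp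
    have hp0 : (0 : ℝ) < p := by exact_mod_cast hp.2.pos
    have h1 : (p : ℝ) ≤ w - 1 := by
      have : p + 1 ≤ w := hp.1
      have : (p : ℝ) + 1 ≤ w := by exact_mod_cast this
      linarith
    have h2 : Real.log (p / w) ≤ p / w - 1 := Real.log_le_sub_one_of_pos (by positivity)
    rw [Real.log_div hp0.ne' hw0.ne'] at h2
    have h3 : (p : ℝ) / w - 1 ≤ - (1 / w) := by
      rw [div_sub_one hw0.ne', ← neg_div, div_le_div_iff_of_pos_right hw0]; linarith
    have h4 : η * Real.log w ≤ 1 / w := by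
      have hww : (w : ℝ) ≤ W0 := by exact_mod_cast hwW
      have hlw : Real.log w ≤ Real.log W0 := Real.log_le_log hw0 hww
      calc η * Real.log w ≤ 1 / (W0 * Real.log W0) * Real.log W0 := by gcongr
        _ = 1 / W0 := by field_simp
        _ ≤ 1 / w := one_div_le_one_div_of_le hw0 hww
    linarith
  · have hlw : 64 / σ ≤ Real.log w := by
      rw [Real.le_log_iff_exp_le hw0]
      refine hW.le.trans ?_
      have : W ≤ w := (le_max_left W 2).trans hwW.le
      exact_mod_cast this
    rw [← Finset.sum_filter_add_sum_filter_not (Nat.primesBelow w)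
      (fun p : ℕ => Real.log p ≤ (1 - η) * Real.log w)]
    have hA := sum_pow_log_le_of_le (m := m) hw (by linarith : η ≤ 1)
      (Finset.filter_subset (fun p : ℕ => Real.log p ≤ (1 - η) * Real.log w) (Nat.primesBelow w))
      (fun p hp => (mem_filter.1 hp).2)
    have hB : ∑ p ∈ (Nat.primesBelow w).filter (fun p : ℕ => ¬ Real.log p ≤ (1 - η) * Real.log w),
        1 / (p : ℝ) * (Real.log p / Real.log w) ^ (m + 1) ≤ σ / 2 := by
      set z : ℕ := ⌈Real.exp ((1 - η) * Real.log w)⌉₊ with hz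
      have hz1 : 1 ≤ z := Nat.one_le_iff_ne_zero.2 (Nat.ceil_pos.2 (Real.exp_pos _)).ne'
      have hzw : z ≤ w := by
        rw [hz, Nat.ceil_le]
        calc Real.exp ((1 - η) * Real.log w) ≤ Real.exp (Real.log w) := by
              apply Real.exp_le_exp.2; nlinarith
          _ = w := Real.exp_log hw0
      have hzlog : (1 - η) * Real.log w ≤ Real.log z := by
        rw [Real.le_log_iff_exp_le (by exact_mod_cast hz1)]
        exact Nat.le_ceil _
      have h1 := sum_log_prime_div_le hz1 hzw
      calc _ ≤ ∑ p ∈ (Nat.primesBelow w).filter (fun p : ℕ => ¬ Real.log p ≤ (1 - η) * Real.log w),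
            1 / Real.log w * (Real.log p / p) := by
            apply Finset.sum_le_sum
            intro p hp
            rw [mem_filter, Nat.mem_primesBelow] at hp
            have hp0 : 0 ≤ Real.log p := Real.log_natCast_nonneg p
            have hle : Real.log p / Real.log w ≤ 1 := by
              rw [div_le_one hl]
              apply Real.log_le_log (by exact_mod_cast hp.1.2.pos) (by exact_mod_cast hp.1.1.le)
            have h2 : (Real.log p / Real.log w) ^ (m + 1) ≤ Real.log p / Real.log w :=
              pow_le_of_le_one (by positivity) hle (by omega)
            calc _ ≤ 1 / (p : ℝ) * (Real.log p / Real.log w) := by gcongr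
              _ = _ := by ring
        _ = 1 / Real.log w * ∑ p ∈ (Nat.primesBelow w).filter
              (fun p : ℕ => ¬ Real.log p ≤ (1 - η) * Real.log w), Real.log p / (p : ℝ) := by
            rw [mul_sum]
        _ ≤ 1 / Real.log w * ∑ p ∈ (Ico z w).filter Nat.Prime, Real.log p / (p : ℝ) := by
            gcongr
            intro p hp
            simp only [mem_filter, Nat.mem_primesBelow, mem_Ico] at hp ⊢
            refine ⟨⟨?_, hp.1.1⟩, hp.1.2⟩
            rw [hz, Nat.ceil_le, ← Real.le_log_iff_exp_le (by exact_mod_cast hp.1.2.pos)]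
            exact (not_le.1 hp.2).le
        _ ≤ 1 / Real.log w * (σ / 2 * Real.log w) := by
            gcongr
            have : 64 ≤ Real.log w * σ := by rwa [div_le_iff₀ hσ] at hlw
            nlinarith
        _ = σ / 2 := by field_simp
    linarith [key m hm]

/-! ### The fundamental lemma of the sieve -/

/-- A finitely supported nonnegative sequence with level-of-distribution data: the mass on
multiples of `e` is `X / e` up to an error `r`. -/
structure SieveData (a : ℕ → ℝ) (N : ℕ) (X r : ℝ) : Prop where
  nonneg : ∀ n, 0 ≤ a n
  vanish : ∀ n, N ≤ n → a n = 0
  X_nonneg : 0 ≤ X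
  r_nonneg : 0 ≤ r
  bound : ∀ e, 1 ≤ e → |∑ n ∈ (range N).filter (e ∣ ·), a n - X / e| ≤ r

/-- The sifted sum over `w`-rough integers. -/
noncomputable def sift (a : ℕ → ℝ) (N w : ℕ) : ℝ := ∑ n ∈ (range N).filter (rough w), a n

lemma SieveData.mul_left {a : ℕ → ℝ} {N : ℕ} {X r : ℝ} (h : SieveData a N X r) {p : ℕ}
    (hp : 1 ≤ p) : SieveData (fun n => a (p * n)) N (X / p) r where
  nonneg n := h.nonneg _
  vanish n hn := h.vanish _ (by nlinarith)
  X_nonneg := div_nonneg h.X_nonneg (by positivity)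
  r_nonneg := h.r_nonneg
  bound e he := by
    have h1 := h.bound (p * e) (Nat.mul_pos hp he)
    rw [sum_filter_dvd_eq (Nat.mul_pos hp he) h.vanish] at h1
    rw [sum_filter_dvd_eq he (a := fun n => a (p * n)) (fun n hn => h.vanish _ (by nlinarith))]
    simpa [mul_assoc, div_div] using h1

lemma SieveData.abs_sum_sub_le {a : ℕ → ℝ} {N : ℕ} {X r : ℝ} (h : SieveData a N X r) :
    |∑ n ∈ range N, a n - X| ≤ r := by
  simpa using h.bound 1 le_rfl

lemma sift_nonneg {a : ℕ → ℝ} (h : ∀ n, 0 ≤ a n) (N w : ℕ) : 0 ≤ sift a N w :=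
  Finset.sum_nonneg fun n _ => h n

lemma sift_antitone {a : ℕ → ℝ} (h : ∀ n, 0 ≤ a n) (N : ℕ) {z w : ℕ} (hzw : z ≤ w) :
    sift a N w ≤ sift a N z := by
  apply Finset.sum_le_sum_of_subset_of_nonneg
  · intro n hn
    rw [mem_filter] at hn ⊢
    exact ⟨hn.1, rough_mono hzw hn.2⟩
  · intro n _ _; exact h n

lemma sift_two (a : ℕ → ℝ) (N : ℕ) : sift a N 2 = ∑ n ∈ range N, a n := by
  rw [sift, Finset.filter_true_of_mem (fun n _ => rough_two n)]

lemma buchstab {a : ℕ → ℝ} {N : ℕ} (ha : ∀ n, N ≤ n → a n = 0) (w : ℕ) :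
    sift a N w = ∑ n ∈ range N, a n
      - ∑ p ∈ Nat.primesBelow w, sift (fun n => a (p * n)) N p := by
  induction w with
  | zero =>
    rw [sift, Finset.filter_true_of_mem (fun n _ p _ _ => Nat.zero_le p)]
    simp [Nat.primesBelow]
  | succ w ih =>
    by_cases hw : w.Prime
    · have h1 : sift a N (w + 1) = sift a N w - sift (fun n => a (w * n)) N w := by
        have h2 : sift a N w = sift a N (w + 1)
            + ∑ n ∈ ((range N).filter (rough w)).filter (w ∣ ·), a n := by
          rw [sift, ← Finset.sum_filter_add_sum_filter_not _ (w ∣ ·), add_comm, sift]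
          congr 1
          apply Finset.sum_congr _ (fun _ _ => rfl)
          ext d
          simp only [mem_filter, rough_succ_iff_of_prime hw]
          tauto
        have h3 : ∑ n ∈ ((range N).filter (rough w)).filter (w ∣ ·), a n
            = sift (fun n => a (w * n)) N w := by
          rw [Finset.filter_comm, Finset.sum_filter,
            sum_filter_dvd_eq hw.one_le (a := fun n => if rough w n then a n else 0), sift,
            Finset.sum_filter]
          · apply Finset.sum_congr rfl
            intro m _
            simp only [rough_mul, rough_prime hw, le_refl, true_and]
          · intro n hn
            simp [ha n hn]
        linarith
      rw [h1, ih, Nat.primesBelow_succ, if_pos hw, sum_insert (by simp [Nat.mem_primesBelow])]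
      ring
    · have : sift a N (w + 1) = sift a N w := by
        simp only [sift, rough_succ_iff_of_not_prime hw]
      rw [this, ih, Nat.primesBelow_succ, if_neg hw]

lemma V_eq_one_sub_sum (w : ℕ) : V w = 1 - ∑ p ∈ Nat.primesBelow w, V p / p := by
  induction w with
  | zero => simp [V, Nat.primesBelow]
  | succ w ih =>
    by_cases hw : w.Prime
    · rw [V_succ_of_prime hw, Nat.primesBelow_succ, if_pos hw,
        sum_insert (by simp [Nat.mem_primesBelow])]
      linear_combination ih
    · rw [V_succ_of_not_prime hw, Nat.primesBelow_succ, if_neg hw, ih]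

lemma sum_primesBelow_inv_sq_le (w : ℕ) :
    ∑ p ∈ Nat.primesBelow w, 1 / (p : ℝ) ^ 2 ≤ 3 / 4 := by
  have h (k : ℕ) : ∑ n ∈ Ico 2 (k + 3), 1 / (n : ℝ) ^ 2 ≤ 3 / 4 - 1 / ((k : ℝ) + 2) := by
    induction k with
    | zero => norm_num
    | succ k ih =>
      rw [Finset.sum_Ico_succ_top (by omega)]
      have : 1 / ((k + 3 : ℕ) : ℝ) ^ 2 ≤ 1 / ((k : ℝ) + 2) - 1 / (k + 3) := by
        rw [div_sub_div _ _ (by positivity) (by positivity)]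
        push_cast
        rw [div_le_div_iff₀ (by positivity) (by positivity)]
        have : (0 : ℝ) ≤ k := by positivity
        nlinarith
      push_cast at this ih ⊢
      rw [show (k : ℝ) + 1 + 2 = k + 3 by ring]
      linarith
  calc ∑ p ∈ Nat.primesBelow w, 1 / (p : ℝ) ^ 2 ≤ ∑ n ∈ Ico 2 (w + 3), 1 / (n : ℝ) ^ 2 := by
        apply Finset.sum_le_sum_of_subset_of_nonneg
        · intro p hp
          rw [Nat.mem_primesBelow] at hp
          rw [mem_Ico]
          exact ⟨hp.2.two_le, by omega⟩
        · intros; positivity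
    _ ≤ 3 / 4 - 1 / ((w : ℝ) + 2) := h w
    _ ≤ 3 / 4 := by
        have : (0 : ℝ) ≤ 1 / ((w : ℝ) + 2) := by positivity
        linarith

lemma fundamental_lemma_base {a : ℕ → ℝ} {N : ℕ} {X r D : ℝ} (h : SieveData a N X r)
    (hD : 1 < D) : |sift a N 2 - X * V 2| ≤ r * D ^ 2 := by
  rw [sift_two, V_two, mul_one]
  have := h.r_nonneg
  exact h.abs_sum_sub_le.trans (le_mul_of_one_le_right this (one_le_pow₀ hD.le))

lemma fundamental_lemma_large {a : ℕ → ℝ} {N : ℕ} {X r D s1 : ℝ} {w m : ℕ}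
    (h : SieveData a N X r) (hw : 2 ≤ w) (hD : 1 < D) (hs1 : 0 < s1)
    (hm : ∑ p ∈ Nat.primesBelow w, 1 / (p : ℝ) * (Real.log p / Real.log w) ^ m
      ≤ 1 / (2 * 2 ^ C0))
    (hC : 1 ≤ C0 + m)
    (hs : 2 * ((C0 + m : ℕ) : ℝ) * Real.log w ≤ Real.log D)
    (ih : ∀ p, p < w → 2 ≤ p → ∀ (a : ℕ → ℝ) (X D : ℝ), SieveData a N X r → 1 < D →
      |sift a N p - X * V p| ≤ X * V p * (s1 * Real.log p / Real.log D) ^ (C0 + m) + r * D ^ 2) :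
    |sift a N w - X * V w| ≤ X * V w * (s1 * Real.log w / Real.log D) ^ (C0 + m) + r * D ^ 2 := by
  set B := C0 + m with hB
  have hB1 : (1 : ℝ) ≤ (B : ℝ) := by exact_mod_cast hC
  have hw1 : (1 : ℝ) < w := by exact_mod_cast (by omega : 1 < w)
  have hlw : 0 < Real.log w := Real.log_pos hw1
  have hlD : 0 < Real.log D := Real.log_pos hD
  have hr := h.r_nonneg
  have hX := h.X_nonneg
  have hDw : (w : ℝ) ^ 2 ≤ D := by
    rw [← Real.log_le_log_iff (by positivity) (by linarith), Real.log_pow]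
    push_cast; nlinarith
  have hD4 : 4 ≤ D := by
    have : (2 : ℝ) ≤ w := by exact_mod_cast hw
    nlinarith
  have hVw := V_pos w
  set Q := s1 * Real.log w / Real.log D with hQ
  have hQ0 : 0 ≤ Q := by positivity
  have hterm : ∀ p ∈ Nat.primesBelow w,
      |sift (fun n => a (p * n)) N p - X / p * V p|
        ≤ 2 * 2 ^ C0 * (X * V w * Q ^ B) * (1 / (p : ℝ) * (Real.log p / Real.log w) ^ m)
          + r * D ^ 2 * (1 / (p : ℝ) ^ 2) := by
    intro p hp
    rw [Nat.mem_primesBelow] at hp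
    have hp1 : (1 : ℝ) < p := by exact_mod_cast hp.2.one_lt
    have hp0 : (0 : ℝ) < p := by linarith
    have hpw : (p : ℝ) < w := by exact_mod_cast hp.1
    have hlp : 0 < Real.log p := Real.log_pos hp1
    have hlpw : Real.log p ≤ Real.log w := Real.log_le_log hp0 hpw.le
    have hDp : 1 < D / p := by rw [lt_div_iff₀ hp0]; nlinarith
    have h1 := ih p hp.1 hp.2.two_le _ _ (D / p) (h.mul_left hp.2.one_le) hDp
    refine h1.trans (add_le_add ?_ (le_of_eq (by field_simp)))
    have hlDp : (1 - 1 / (2 * B)) * Real.log D ≤ Real.log (D / p) := by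
      rw [Real.log_div (by linarith) hp0.ne']
      have : Real.log w ≤ 1 / (2 * B) * Real.log D := by
        rw [one_div_mul_eq_div, le_div_iff₀ (by positivity)]; linarith
      linarith
    set t := Real.log p / Real.log w with ht
    have ht0 : 0 < t := by positivity
    have hhalf : (1 : ℝ) / 2 ≤ (1 - 1 / (2 * B)) ^ B := by
      have h2 : 1 / (2 * (B : ℝ)) ≤ 1 / 2 := by
        apply one_div_le_one_div_of_le (by norm_num); linarith
      have := one_add_mul_le_pow (a := - (1 / (2 * (B : ℝ)))) (by linarith) B
      rw [← sub_eq_add_neg] at this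
      refine le_trans (le_of_eq ?_) this
      field_simp; ring
    have hbase : 0 < 1 - 1 / (2 * (B : ℝ)) := by
      have h2 : 1 / (2 * (B : ℝ)) ≤ 1 / 2 := by
        apply one_div_le_one_div_of_le (by norm_num); linarith
      linarith
    have hpow : (s1 * Real.log p / Real.log (D / p)) ^ B ≤ 2 * (Q ^ B * t ^ B) := by
      have h3 : s1 * Real.log p / Real.log (D / p) ≤ (Q * t) * (1 - 1 / (2 * (B : ℝ)))⁻¹ := by
        have : Q * t * (1 - 1 / (2 * (B : ℝ)))⁻¹
            = s1 * Real.log p / ((1 - 1 / (2 * B)) * Real.log D) := by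
          rw [hQ, ht]; field_simp
        rw [this]
        gcongr
      calc (s1 * Real.log p / Real.log (D / p)) ^ B
          ≤ ((Q * t) * (1 - 1 / (2 * (B : ℝ)))⁻¹) ^ B := by
            gcongr
            exact div_nonneg (by positivity) (le_trans (by positivity) hlDp)
        _ = Q ^ B * t ^ B * ((1 - 1 / (2 * (B : ℝ))) ^ B)⁻¹ := by rw [mul_pow, mul_pow, inv_pow]
        _ ≤ Q ^ B * t ^ B * 2 := by
            gcongr
            rw [inv_le_comm₀ (by positivity) (by norm_num)]
            linarith
        _ = _ := by ring
    have hV : V p ≤ 2 ^ C0 * (1 / t) ^ C0 * V w := by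
      have := V_ratio hp.2.two_le hp.1.le
      rwa [ht, one_div_div]
    have hVp := V_pos p
    calc X / p * V p * (s1 * Real.log p / Real.log (D / p)) ^ B
        ≤ X / p * (2 ^ C0 * (1 / t) ^ C0 * V w) * (2 * (Q ^ B * t ^ B)) := by
          gcongr
          exact pow_nonneg (div_nonneg (by positivity) (le_trans (by positivity) hlDp)) _
      _ = 2 * 2 ^ C0 * (X * V w * Q ^ B) * (1 / (p : ℝ) * t ^ m) := by
          have : t ^ B = t ^ C0 * t ^ m := by rw [hB, pow_add]
          rw [this, one_div_pow]
          field_simp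
  have e : sift a N w - X * V w = (∑ n ∈ range N, a n - X)
      - ∑ p ∈ Nat.primesBelow w, (sift (fun n => a (p * n)) N p - X / p * V p) := by
    rw [buchstab h.vanish w, V_eq_one_sub_sum w, Finset.sum_sub_distrib, mul_sub, mul_sum]
    have : ∑ p ∈ Nat.primesBelow w, X * (V p / p) = ∑ p ∈ Nat.primesBelow w, X / p * V p :=
      Finset.sum_congr rfl (fun p _ => by ring)
    rw [this]; ring
  rw [e]
  calc |(∑ n ∈ range N, a n - X)
      - ∑ p ∈ Nat.primesBelow w, (sift (fun n => a (p * n)) N p - X / p * V p)|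
      ≤ |∑ n ∈ range N, a n - X|
        + |∑ p ∈ Nat.primesBelow w, (sift (fun n => a (p * n)) N p - X / p * V p)| := abs_sub _ _
    _ ≤ r + ∑ p ∈ Nat.primesBelow w,
        (2 * 2 ^ C0 * (X * V w * Q ^ B) * (1 / (p : ℝ) * (Real.log p / Real.log w) ^ m)
          + r * D ^ 2 * (1 / (p : ℝ) ^ 2)) :=
        add_le_add h.abs_sum_sub_le
          ((Finset.abs_sum_le_sum_abs _ _).trans (Finset.sum_le_sum hterm))
    _ = r + (2 * 2 ^ C0 * (X * V w * Q ^ B) *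
          ∑ p ∈ Nat.primesBelow w, (1 / (p : ℝ) * (Real.log p / Real.log w) ^ m)
          + r * D ^ 2 * ∑ p ∈ Nat.primesBelow w, 1 / (p : ℝ) ^ 2) := by
        rw [Finset.sum_add_distrib, mul_sum, mul_sum]
    _ ≤ r + (2 * 2 ^ C0 * (X * V w * Q ^ B) * (1 / (2 * 2 ^ C0)) + r * D ^ 2 * (3 / 4)) := by
        gcongr
        exact sum_primesBelow_inv_sq_le w
    _ = X * V w * Q ^ B + (r + r * D ^ 2 * (3 / 4)) := by field_simp; ring
    _ ≤ _ := by
        gcongr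
        have : r * 16 ≤ r * D ^ 2 := by gcongr; nlinarith
        linarith

lemma fundamental_lemma_small {a : ℕ → ℝ} {N : ℕ} {X r D s0 s1 : ℝ} {w m : ℕ}
    (h : SieveData a N X r) (hw : 2 < w) (hD : 1 < D) (hs0 : 1 ≤ s0)
    (hs1 : s1 = s0 * (2 * 4 ^ C0)) (hm : 1 ≤ m)
    (hs : Real.log D < s0 * Real.log w)
    (ih : ∀ p, p < w → 2 ≤ p → ∀ (a : ℕ → ℝ) (X D : ℝ), SieveData a N X r → 1 < D →
      |sift a N p - X * V p| ≤ X * V p * (s1 * Real.log p / Real.log D) ^ (C0 + m) + r * D ^ 2) :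
    |sift a N w - X * V w| ≤ X * V w * (s1 * Real.log w / Real.log D) ^ (C0 + m) + r * D ^ 2 := by
  have hw1 : (1 : ℝ) < w := by exact_mod_cast (by omega : 1 < w)
  have hlw : 0 < Real.log w := Real.log_pos hw1
  have hlD : 0 < Real.log D := Real.log_pos hD
  have hr := h.r_nonneg
  have hX := h.X_nonneg
  have hVw := V_pos w
  have hS := sift_nonneg h.nonneg N w
  have h4 : (1 : ℝ) ≤ 4 ^ C0 := one_le_pow₀ (by norm_num)
  have hs1s0 : s0 ≤ s1 := by rw [hs1]; nlinarith
  have hs1p : 0 < s1 := by linarith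
  set Q := s1 * Real.log w / Real.log D with hQ
  have hQbig : 2 * 4 ^ C0 ≤ Q := by
    rw [hQ, le_div_iff₀ hlD, hs1]; nlinarith
  have hQ1 : 1 ≤ Q := by linarith
  have hrD : 0 ≤ r * D ^ 2 := by positivity
  rw [abs_le]
  constructor
  · have h1 : 1 ≤ Q ^ (C0 + m) := one_le_pow₀ hQ1
    have : X * V w ≤ X * V w * Q ^ (C0 + m) := le_mul_of_one_le_right (by positivity) h1
    linarith
  · set x := Real.exp (Real.log D / s1) with hx
    set z := max 2 ⌊x⌋₊ with hz
    have hz2 : 2 ≤ z := le_max_left _ _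
    have hxw : x < w := by
      rw [hx, ← Real.lt_log_iff_exp_lt (by linarith), div_lt_iff₀ hs1p]
      nlinarith
    have hzw : z < w := by
      rw [hz, max_lt_iff]
      exact ⟨hw, (Nat.floor_lt (Real.exp_pos _).le).2 hxw⟩
    have hz1 : (1 : ℝ) < z := by exact_mod_cast (by omega : 1 < z)
    have hlz : 0 < Real.log z := Real.log_pos hz1
    have hlogz : Real.log D / s1 ≤ 2 * Real.log z := by
      have h1 : x ≤ (z : ℝ) ^ 2 := by
        have h2 : x < ⌊x⌋₊ + 1 := Nat.lt_floor_add_one x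
        have h3 : (⌊x⌋₊ : ℝ) ≤ z := by exact_mod_cast le_max_right _ _
        have h5 : (2 : ℝ) ≤ z := by exact_mod_cast hz2
        nlinarith
      have := Real.log_le_log (Real.exp_pos _) h1
      rw [Real.log_exp, Real.log_pow] at this
      exact_mod_cast this
    have hVz : V z ≤ 2 ^ C0 * (2 * Q) ^ C0 * V w := by
      refine (V_ratio hz2 hzw.le).trans ?_
      gcongr
      rw [hQ, div_le_iff₀ hlz]
      rw [div_le_iff₀ hs1p] at hlogz
      have : 2 * (s1 * Real.log w / Real.log D) * Real.log z
          = Real.log w * ((2 * Real.log z * s1) / Real.log D) := by ring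
      rw [this]
      apply le_mul_of_one_le_right hlw.le
      rwa [one_le_div hlD]
    have hSz : sift a N z ≤ 2 * X * V z + r * D ^ 2 := by
      have hVz0 := V_pos z
      rcases le_or_gt 2 ⌊x⌋₊ with h2 | h2
      · have h1 := (abs_le.1 (ih z hzw hz2 a X D h hD)).2
        have hle : (s1 * Real.log z / Real.log D) ^ (C0 + m) ≤ 1 := by
          apply pow_le_one₀ (by positivity)
          rw [div_le_one hlD]
          have hzx : (z : ℝ) ≤ x := by
            rw [hz, max_eq_right h2]; exact Nat.floor_le (Real.exp_pos _).le
          have := Real.log_le_log (by linarith) hzx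
          rw [hx, Real.log_exp, le_div_iff₀ hs1p] at this
          linarith
        have : X * V z * (s1 * Real.log z / Real.log D) ^ (C0 + m) ≤ X * V z :=
          mul_le_of_le_one_right (by positivity) hle
        linarith
      · have : z = 2 := max_eq_left h2.le
        rw [this]
        have h1 := (abs_le.1 (fundamental_lemma_base h hD)).2
        have : 0 ≤ X * V 2 := mul_nonneg hX (V_pos 2).le
        linarith
    have hfin : 2 * X * V z ≤ X * V w * Q ^ (C0 + m) := by
      calc 2 * X * V z ≤ 2 * X * (2 ^ C0 * (2 * Q) ^ C0 * V w) := by gcongr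
        _ = X * V w * Q ^ C0 * (2 * 4 ^ C0) := by
            rw [show (4 : ℝ) = 2 * 2 by norm_num, mul_pow, mul_pow]; ring
        _ ≤ X * V w * Q ^ C0 * Q ^ m := by
            gcongr
            exact hQbig.trans (le_self_pow₀ hQ1 (by omega))
        _ = _ := by rw [pow_add]; ring
    have hle := sift_antitone h.nonneg N hzw.le
    have : 0 ≤ X * V w := by positivity
    linarith

lemma fundamental_lemma : ∃ m0 : ℕ, ∀ m, m0 ≤ m → ∃ s1 : ℝ, 1 ≤ s1 ∧
    ∀ (w : ℕ), 2 ≤ w → ∀ (a : ℕ → ℝ) (N : ℕ) (X r D : ℝ), SieveData a N X r → 1 < D →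
      |sift a N w - X * V w|
        ≤ X * V w * (s1 * Real.log w / Real.log D) ^ (C0 + m) + r * D ^ 2 := by
  obtain ⟨m0, hm0⟩ := exists_sum_pow_log_le (by positivity : (0 : ℝ) < 1 / (2 * 2 ^ C0))
  refine ⟨max m0 1, fun m hm => ?_⟩
  have hm1 : 1 ≤ m := (le_max_right _ _).trans hm
  have hC : 1 ≤ C0 + m := by omega
  have hC' : (1 : ℝ) ≤ ((C0 + m : ℕ) : ℝ) := by exact_mod_cast hC
  set s0 : ℝ := 2 * ((C0 + m : ℕ) : ℝ) with hs0
  have h4 : (1 : ℝ) ≤ 4 ^ C0 := one_le_pow₀ (by norm_num)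
  have hs1 : 1 ≤ s0 * (2 * 4 ^ C0) := by nlinarith
  refine ⟨s0 * (2 * 4 ^ C0), hs1, fun w hw a N X r => ?_⟩
  induction w using Nat.strong_induction_on generalizing a X with
  | _ w ih =>
    intro D h hD
    have ih' : ∀ p, p < w → 2 ≤ p → ∀ (a : ℕ → ℝ) (X D : ℝ), SieveData a N X r → 1 < D →
      |sift a N p - X * V p| ≤ X * V p *
        (s0 * (2 * 4 ^ C0) * Real.log p / Real.log D) ^ (C0 + m) + r * D ^ 2 :=
      fun p hp hp2 a X D => ih p hp hp2 a X D
    rcases le_or_gt (s0 * Real.log w) (Real.log D) with hs | hs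
    · exact fundamental_lemma_large h hw hD (by linarith)
        (hm0 m ((le_max_left _ _).trans hm) w hw) hC hs ih'
    · rcases hw.lt_or_eq with hw2 | hw2
      · exact fundamental_lemma_small h hw2 hD (by linarith) rfl hm1 hs ih'
      · subst hw2
        refine (fundamental_lemma_base h hD).trans ?_
        have : 0 ≤ X * V 2 * (s0 * (2 * 4 ^ C0) * Real.log (2 : ℕ) / Real.log D) ^ (C0 + m) := by
          have := h.X_nonneg
          have := V_pos 2
          have := Real.log_pos hD
          have := Real.log_pos (by norm_num : (1 : ℝ) < (2 : ℕ))
          positivity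
        linarith

/-! ### Logarithmic windows -/

lemma sum_Ico_inv_bounds {a b : ℕ} (ha : 1 ≤ a) (hab : a ≤ b) :
    Real.log b - Real.log a ≤ ∑ n ∈ Ico a b, 1 / (n : ℝ) ∧
    ∑ n ∈ Ico a b, 1 / (n : ℝ) ≤ Real.log b - Real.log a + (1 / a - 1 / b) := by
  induction b, hab using Nat.le_induction with
  | base => simp
  | succ n hn ih =>
    rw [Finset.sum_Ico_succ_top hn]
    have hn0 : (0 : ℝ) < n := by exact_mod_cast (by omega : 0 < n)
    have h1 : Real.log ((n + 1 : ℕ) : ℝ) - Real.log n ≤ 1 / n := by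
      rw [← Real.log_div (by positivity) (by positivity)]
      refine (Real.log_le_sub_one_of_pos (by positivity)).trans (le_of_eq ?_)
      push_cast; field_simp; ring
    have h2 : 1 / ((n + 1 : ℕ) : ℝ) ≤ Real.log ((n + 1 : ℕ) : ℝ) - Real.log n := by
      have := Real.log_le_sub_one_of_pos (x := (n : ℝ) / ((n + 1 : ℕ) : ℝ)) (by positivity)
      rw [Real.log_div (by positivity) (by positivity)] at this
      have e : (n : ℝ) / ((n + 1 : ℕ) : ℝ) - 1 = - (1 / ((n + 1 : ℕ) : ℝ)) := by
        push_cast; field_simp; ring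
      linarith
    constructor <;> linarith [ih.1, ih.2]

lemma abs_sum_inv_sub_log_le {α β : ℝ} (hα : 0 < α) (hαβ : α ≤ β) :
    |∑ n ∈ Ico ⌈α⌉₊ ⌈β⌉₊, 1 / (n : ℝ) - (Real.log β - Real.log α)| ≤ 2 / α := by
  have key : ∀ x : ℝ, α ≤ x → Real.log x ≤ Real.log ⌈x⌉₊ ∧
      Real.log ⌈x⌉₊ ≤ Real.log x + 1 / α := by
    intro x hx
    have hx0 : 0 < x := by linarith
    have hc := Nat.le_ceil x
    refine ⟨Real.log_le_log hx0 hc, ?_⟩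
    have h1 := Real.log_le_sub_one_of_pos (x := (⌈x⌉₊ : ℝ) / x)
      (div_pos (by linarith) hx0)
    rw [Real.log_div (by linarith) hx0.ne'] at h1
    have h2 : (⌈x⌉₊ : ℝ) / x - 1 ≤ 1 / x := by
      rw [div_sub_one hx0.ne', div_le_div_iff_of_pos_right hx0]
      linarith [Nat.ceil_lt_add_one hx0.le]
    have h3 : 1 / x ≤ 1 / α := one_div_le_one_div_of_le hα hx
    linarith
  have ha := key α le_rfl
  have hb := key β hαβ
  have hca : 1 ≤ ⌈α⌉₊ := Nat.one_le_iff_ne_zero.2 (Nat.ceil_pos.2 hα).ne'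
  have h := sum_Ico_inv_bounds hca (Nat.ceil_le_ceil hαβ)
  have h1 : 1 / (⌈α⌉₊ : ℝ) ≤ 1 / α := one_div_le_one_div_of_le hα (Nat.le_ceil α)
  have h2 : (0 : ℝ) ≤ 1 / (⌈β⌉₊ : ℝ) := by positivity
  have h3 : 2 / α = 1 / α + 1 / α := by ring
  rw [abs_le, h3]
  constructor <;> linarith [h.1, h.2, ha.1, ha.2, hb.1, hb.2]

/-- Integers `n` with `s ≤ log n < t`. -/
noncomputable def win (s t : ℝ) : Finset ℕ := Ico ⌈Real.exp s⌉₊ ⌈Real.exp t⌉₊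

lemma mem_win {s t : ℝ} {n : ℕ} : n ∈ win s t ↔ 1 ≤ n ∧ s ≤ Real.log n ∧ Real.log n < t := by
  rw [win, mem_Ico, Nat.ceil_le, Nat.lt_ceil]
  constructor
  · rintro ⟨h1, h2⟩
    have hn : (0 : ℝ) < n := (Real.exp_pos s).trans_le h1
    exact ⟨by exact_mod_cast hn, (Real.le_log_iff_exp_le hn).2 h1, (Real.log_lt_iff_lt_exp hn).2 h2⟩
  · rintro ⟨h0, h1, h2⟩
    have hn : (0 : ℝ) < n := by exact_mod_cast h0
    exact ⟨(Real.le_log_iff_exp_le hn).1 h1, (Real.log_lt_iff_lt_exp hn).1 h2⟩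

/-- The sequence `1 / n` restricted to a window. -/
noncomputable def winSeq (s t : ℝ) (n : ℕ) : ℝ := if n ∈ win s t then 1 / (n : ℝ) else 0

lemma winSeq_nonneg (s t : ℝ) (n : ℕ) : 0 ≤ winSeq s t n := by
  unfold winSeq; split_ifs <;> positivity

lemma sum_winSeq (s t : ℝ) (f : ℕ → ℝ) :
    ∑ n ∈ range ⌈Real.exp t⌉₊, winSeq s t n * f n = ∑ n ∈ win s t, 1 / (n : ℝ) * f n := by
  simp only [winSeq, ite_mul, zero_mul]
  rw [← Finset.sum_filter]
  apply Finset.sum_congr _ (fun _ _ => rfl)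
  ext n
  simp only [mem_filter, mem_range, win, mem_Ico]
  tauto

lemma winSeq_zero (s t : ℝ) : winSeq s t 0 = 0 := by
  simp [winSeq]

lemma sieveData_winSeq {s t : ℝ} (hst : s ≤ t) :
    SieveData (winSeq s t) ⌈Real.exp t⌉₊ (t - s) (2 / Real.exp s) where
  nonneg := winSeq_nonneg s t
  vanish n hn := by
    rw [winSeq, if_neg]
    rw [win, mem_Ico]; omega
  X_nonneg := by linarith
  r_nonneg := by positivity
  bound e he := by
    have he0 : (0 : ℝ) < e := by exact_mod_cast he
    rw [sum_filter_dvd_eq he]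
    · have h1 := abs_sum_inv_sub_log_le (α := Real.exp s / e) (β := Real.exp t / e) (by positivity)
        (by gcongr)
      rw [Real.log_div (Real.exp_pos _).ne' he0.ne', Real.log_div (Real.exp_pos _).ne' he0.ne',
        Real.log_exp, Real.log_exp, sub_sub_sub_cancel_right] at h1
      have h2 : ∑ m ∈ range ⌈Real.exp t⌉₊, winSeq s t (e * m)
          = 1 / e * ∑ n ∈ Ico ⌈Real.exp s / e⌉₊ ⌈Real.exp t / e⌉₊, 1 / (n : ℝ) := by
        rw [mul_sum]
        have : ∀ m, winSeq s t (e * m) = if m ∈ Ico ⌈Real.exp s / e⌉₊ ⌈Real.exp t / e⌉₊ then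
            1 / (e : ℝ) * (1 / (m : ℝ)) else 0 := by
          intro m
          have : e * m ∈ win s t ↔ m ∈ Ico ⌈Real.exp s / e⌉₊ ⌈Real.exp t / e⌉₊ := by
            rw [win, mem_Ico, mem_Ico, Nat.ceil_le, Nat.lt_ceil, Nat.ceil_le, Nat.lt_ceil,
              div_le_iff₀ he0, lt_div_iff₀ he0]
            push_cast
            rw [mul_comm (e : ℝ)]
          simp only [winSeq, this]
          split_ifs
          · push_cast; rw [one_div_mul_one_div]
          · rfl
        simp only [this]
        rw [← Finset.sum_filter]
        apply Finset.sum_congr _ (fun _ _ => rfl)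
        ext m
        simp only [mem_filter, mem_range, mem_Ico, Nat.lt_ceil, Nat.ceil_le]
        constructor
        · exact fun h => h.2
        · intro h
          refine ⟨h.2.trans_le ?_, h⟩
          exact div_le_self (Real.exp_pos _).le (by exact_mod_cast he)
      rw [h2, show (1 : ℝ) / e * ∑ n ∈ Ico ⌈Real.exp s / e⌉₊ ⌈Real.exp t / e⌉₊, 1 / (n : ℝ)
        - (t - s) / e = 1 / e * (∑ n ∈ Ico ⌈Real.exp s / e⌉₊ ⌈Real.exp t / e⌉₊, 1 / (n : ℝ)
          - (t - s)) by ring, abs_mul, abs_of_pos (by positivity : 0 < 1 / (e : ℝ))]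
      calc _ ≤ 1 / (e : ℝ) * (2 / (Real.exp s / e)) := by gcongr
        _ = _ := by field_simp
    · intro n hn
      rw [winSeq, if_neg]
      rw [win, mem_Ico]; omega

/-! ### Selberg's identity -/

lemma sum_divisors_vonMangoldt_log (n : ℕ) :
    ∑ d ∈ n.divisors, (Λ d * Real.log d + ∑ q ∈ d.divisorsAntidiagonal, Λ q.1 * Λ q.2)
      = Real.log n ^ 2 := by
  rw [Finset.sum_add_distrib]
  have h1 : ∑ d ∈ n.divisors, ∑ q ∈ d.divisorsAntidiagonal, Λ q.1 * Λ q.2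
      = ∑ q ∈ n.divisorsAntidiagonal, Λ q.1 * Real.log q.2 := by
    have e : (ArithmeticFunction.vonMangoldt * ArithmeticFunction.vonMangoldt)
        * (ArithmeticFunction.zeta : ArithmeticFunction ℝ)
        = ArithmeticFunction.vonMangoldt * ArithmeticFunction.log := by
      rw [mul_assoc, ArithmeticFunction.vonMangoldt_mul_zeta]
    have e2 := congrArg (fun f => f n) e
    simp only [ArithmeticFunction.coe_mul_zeta_apply] at e2
    simpa [ArithmeticFunction.mul_apply] using e2
  have h2 : ∑ d ∈ n.divisors, Λ d * Real.log d
      = ∑ q ∈ n.divisorsAntidiagonal, Λ q.1 * Real.log q.1 :=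
    (Nat.sum_divisorsAntidiagonal (fun d _ => Λ d * Real.log d)).symm
  have h3 : ∑ q ∈ n.divisorsAntidiagonal, Λ q.1 = Real.log n := by
    rw [Nat.sum_divisorsAntidiagonal (fun d _ => Λ d), ArithmeticFunction.vonMangoldt_sum]
  rw [h1, h2, ← Finset.sum_add_distrib]
  calc _ = ∑ q ∈ n.divisorsAntidiagonal, Λ q.1 * Real.log n := by
        apply Finset.sum_congr rfl
        rintro ⟨a, b⟩ hq
        rw [Nat.mem_divisorsAntidiagonal] at hq
        obtain ⟨rfl, hne⟩ := hq
        have ha : (a : ℝ) ≠ 0 := by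
          rintro h; simp_all
        have hb : (b : ℝ) ≠ 0 := by
          rintro h; simp_all
        push_cast
        rw [Real.log_mul ha hb]; ring
    _ = _ := by rw [← Finset.sum_mul, h3]; ring

lemma selberg_identity {n : ℕ} (hn : 2 ≤ n) (u : ℝ) :
    ∑ d ∈ n.divisors, (ArithmeticFunction.moebius d : ℝ) * (u - Real.log d) ^ 2
      = Λ n * Real.log n + ∑ q ∈ n.divisorsAntidiagonal, Λ q.1 * Λ q.2
        + 2 * (u - Real.log n) * Λ n := by
  have h0 : ∑ d ∈ n.divisors, (ArithmeticFunction.moebius d : ℝ) = 0 := by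
    have e2 := congrArg (fun f => f n)
      (ArithmeticFunction.coe_moebius_mul_coe_zeta (R := ℝ))
    simp only [ArithmeticFunction.coe_mul_zeta_apply] at e2
    rw [ArithmeticFunction.one_apply_ne (by omega)] at e2
    simpa using e2
  have h1 : ∑ d ∈ n.divisors, (ArithmeticFunction.moebius d : ℝ) * Real.log d = - Λ n := by
    exact ArithmeticFunction.sum_moebius_mul_log_eq
  have h2 : ∑ d ∈ n.divisors, (ArithmeticFunction.moebius d : ℝ) * (Real.log n - Real.log d) ^ 2
      = Λ n * Real.log n + ∑ q ∈ n.divisorsAntidiagonal, Λ q.1 * Λ q.2 := by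
    have := (ArithmeticFunction.sum_eq_iff_sum_mul_moebius_eq (R := ℝ)
      (f := fun n => Λ n * Real.log n + ∑ q ∈ n.divisorsAntidiagonal, Λ q.1 * Λ q.2)
      (g := fun n => Real.log n ^ 2)).1 (fun n _ => sum_divisors_vonMangoldt_log n) n (by omega)
    rw [← this, ← Nat.sum_divisorsAntidiagonal (fun d _ =>
      (ArithmeticFunction.moebius d : ℝ) * (Real.log n - Real.log d) ^ 2)]
    apply Finset.sum_congr rfl
    rintro ⟨a, b⟩ hq
    rw [Nat.mem_divisorsAntidiagonal] at hq
    obtain ⟨rfl, hne⟩ := hq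
    have ha : (a : ℝ) ≠ 0 := by
      rintro h; simp_all
    have hb : (b : ℝ) ≠ 0 := by
      rintro h; simp_all
    push_cast
    rw [Real.log_mul ha hb]; ring
  rw [← h2]
  have : ∀ d ∈ n.divisors, (ArithmeticFunction.moebius d : ℝ) * (u - Real.log d) ^ 2
      = (ArithmeticFunction.moebius d : ℝ) * (Real.log n - Real.log d) ^ 2
        + ((u ^ 2 - Real.log n ^ 2) * (ArithmeticFunction.moebius d : ℝ)
          - 2 * (u - Real.log n) * ((ArithmeticFunction.moebius d : ℝ) * Real.log d)) := by
    intro d _; ring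
  rw [Finset.sum_congr rfl this, Finset.sum_add_distrib, Finset.sum_sub_distrib, ← mul_sum,
    ← mul_sum, h0, h1]
  ring

/-! ### The sieved Selberg sum over a window -/

/-- The von Mangoldt function restricted to `y`-rough integers. -/
noncomputable def lamr (y n : ℕ) : ℝ := if rough y n then Λ n else 0

lemma lamr_nonneg (y n : ℕ) : 0 ≤ lamr y n := by
  unfold lamr; split_ifs
  · exact ArithmeticFunction.vonMangoldt_nonneg
  · exact le_rfl

lemma lamr_le (y n : ℕ) : lamr y n ≤ Λ n := by
  unfold lamr; split_ifs
  · exact le_rfl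
  · exact ArithmeticFunction.vonMangoldt_nonneg

/-- Selberg's weight `Λ log + Λ * Λ` for the rough von Mangoldt function. -/
noncomputable def selw (y n : ℕ) : ℝ :=
  lamr y n * Real.log n + ∑ q ∈ n.divisorsAntidiagonal, lamr y q.1 * lamr y q.2

/-- Selberg's sum over a logarithmic window. -/
noncomputable def selSum (y : ℕ) (s t : ℝ) : ℝ := ∑ n ∈ win s t, 1 / (n : ℝ) * selw y n

/-- The weighted prime sum over a logarithmic window. -/
noncomputable def primeSum (y : ℕ) (s t : ℝ) : ℝ := ∑ n ∈ win s t, 1 / (n : ℝ) * lamr y n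

/-- The sum over rough `n` in a window of the truncated Möbius convolution. -/
noncomputable def hatSum (y : ℕ) (s u : ℝ) : ℝ :=
  ∑ n ∈ (range ⌈Real.exp u⌉₊).filter (rough y), winSeq s u n *
    ∑ d ∈ n.divisors, (ArithmeticFunction.moebius d : ℝ) * (u - Real.log d) ^ 2

lemma primeSum_nonneg (y : ℕ) (s t : ℝ) : 0 ≤ primeSum y s t :=
  Finset.sum_nonneg fun n _ => mul_nonneg (by positivity) (lamr_nonneg y n)

lemma selw_of_rough {y n : ℕ} (h : rough y n) :
    selw y n = Λ n * Real.log n + ∑ q ∈ n.divisorsAntidiagonal, Λ q.1 * Λ q.2 := by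
  rw [selw, lamr, if_pos h]
  congr 1
  apply Finset.sum_congr rfl
  rintro ⟨a, b⟩ hq
  rw [Nat.mem_divisorsAntidiagonal] at hq
  have := rough_mul.1 (hq.1 ▸ h)
  simp only [lamr, if_pos this.1, if_pos this.2]

lemma selw_of_not_rough {y n : ℕ} (h : ¬ rough y n) : selw y n = 0 := by
  rw [selw, lamr, if_neg h, zero_mul, zero_add]
  apply Finset.sum_eq_zero
  rintro ⟨a, b⟩ hq
  rw [Nat.mem_divisorsAntidiagonal] at hq
  rw [← hq.1, rough_mul] at h
  simp only [lamr]
  by_cases ha : rough y a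
  · have hb : ¬ rough y b := fun hb => h ⟨ha, hb⟩
    rw [if_neg hb, mul_zero]
  · rw [if_neg ha, zero_mul]

lemma hatSum_eq {y : ℕ} {s u : ℝ} (hs : 0 < s) :
    hatSum y s u = selSum y s u
      + ∑ n ∈ win s u, 1 / (n : ℝ) * (2 * (u - Real.log n) * lamr y n) := by
  rw [hatSum, Finset.sum_filter]
  have h1 : ∀ n ∈ range ⌈Real.exp u⌉₊, (if rough y n then winSeq s u n *
      ∑ d ∈ n.divisors, (ArithmeticFunction.moebius d : ℝ) * (u - Real.log d) ^ 2 else 0)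
      = winSeq s u n * (selw y n + 2 * (u - Real.log n) * lamr y n) := by
    intro n _
    by_cases hn : n ∈ win s u
    · have hn2 : 2 ≤ n := by
        rw [mem_win] at hn
        by_contra h
        have : n = 1 := by omega
        rw [this, Nat.cast_one, Real.log_one] at hn
        linarith [hn.2.1]
      by_cases hr : rough y n
      · rw [if_pos hr, selberg_identity hn2, selw_of_rough hr, lamr, if_pos hr]
      · rw [if_neg hr, selw_of_not_rough hr, lamr, if_neg hr]; ring
    · simp [winSeq, hn]
  rw [Finset.sum_congr rfl h1, sum_winSeq, selSum, ← Finset.sum_add_distrib]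
  apply Finset.sum_congr rfl
  intro n _; ring

lemma sum_rough_mul_sum_divisors {a : ℕ → ℝ} {N : ℕ} (y : ℕ) (h0 : a 0 = 0)
    (ha : ∀ n, N ≤ n → a n = 0) (g : ℕ → ℝ) :
    ∑ n ∈ (range N).filter (rough y), a n * ∑ d ∈ n.divisors, g d
      = ∑ d ∈ (Ico 1 N).filter (rough y), g d * sift (fun n => a (d * n)) N y := by
  have h1 : ∀ n ∈ (range N).filter (rough y), a n * ∑ d ∈ n.divisors, g d
      = ∑ d ∈ Ico 1 N, if d ∣ n then a n * g d else 0 := by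
    intro n hn
    rw [mem_filter, mem_range] at hn
    rcases Nat.eq_zero_or_pos n with rfl | hn0
    · simp [h0]
    · rw [← Finset.sum_filter, mul_sum]
      apply Finset.sum_congr _ (fun _ _ => rfl)
      ext d
      simp only [Nat.mem_divisors, mem_filter, mem_Ico]
      constructor
      · rintro ⟨h, _⟩
        exact ⟨⟨Nat.pos_of_dvd_of_pos h hn0, (Nat.le_of_dvd hn0 h).trans_lt hn.1⟩, h⟩
      · rintro ⟨_, h⟩; exact ⟨h, by omega⟩
  rw [Finset.sum_congr rfl h1, Finset.sum_comm, Finset.sum_filter]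
  apply Finset.sum_congr rfl
  intro d hd
  rw [mem_Ico] at hd
  rw [← Finset.sum_filter]
  split_ifs with hr
  · have : sift (fun n => a (d * n)) N y
        = ∑ n ∈ (range N).filter (d ∣ ·), if rough y n then a n else 0 := by
      rw [sum_filter_dvd_eq hd.1 (a := fun n => if rough y n then a n else 0), sift,
        Finset.sum_filter]
      · apply Finset.sum_congr rfl
        intro m _
        simp only [rough_mul, hr, true_and]
      · intro n hn
        simp [ha n hn]
    rw [this, mul_sum, Finset.filter_filter]
    rw [Finset.sum_filter, Finset.sum_filter]
    apply Finset.sum_congr rfl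
    intro n _
    by_cases h1 : rough y n <;> by_cases h2 : d ∣ n <;> simp [h1, h2, mul_comm]
  · apply Finset.sum_eq_zero
    intro n hn
    rw [mem_filter, mem_filter] at hn
    exact absurd (rough_of_dvd hn.2 hn.1.2) hr

/-- Reciprocal sum over rough integers below `X`. -/
noncomputable def roughSum (y X : ℕ) : ℝ := ∑ d ∈ (Ico 1 X).filter (rough y), 1 / (d : ℝ)

/-- The main term of the sieved Selberg sum. -/
noncomputable def selMain (y Dn : ℕ) (u : ℝ) : ℝ :=
  ∑ d ∈ (Ico 1 Dn).filter (rough y),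
    (ArithmeticFunction.moebius d : ℝ) * (u - Real.log d) ^ 2 * (1 / (d : ℝ))

lemma abs_moebius_mul_le (d : ℕ) {x y : ℝ} (h : |x| ≤ y) :
    |(ArithmeticFunction.moebius d : ℝ) * x| ≤ y := by
  rw [abs_mul]
  have : |(ArithmeticFunction.moebius d : ℝ)| ≤ 1 := by
    exact_mod_cast ArithmeticFunction.abs_moebius_le_one
  calc _ ≤ 1 * |x| := by gcongr
    _ ≤ y := by linarith

lemma hatSum_approx {y Dn Mn : ℕ} {s u E ρ : ℝ} (hsu : s ≤ u) (hu : 0 ≤ u) (hDn : 1 ≤ Dn)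
    (hDM : Real.exp u ≤ Dn * Mn) (hDu : Real.log Dn ≤ u) (hE1 : E ≤ 1)
    (hρ : 0 ≤ ρ)
    (hS : ∀ d, 1 ≤ d → |sift (fun n => winSeq s u (d * n)) ⌈Real.exp u⌉₊ y - (u - s) / d * V y|
      ≤ (u - s) / d * V y * E + ρ) :
    |hatSum y s u - (u - s) * V y * selMain y Dn u|
      ≤ u ^ 2 * ((u - s) * V y * E * roughSum y Dn + ρ * Dn)
        + (u - Real.log Dn) ^ 2 * (2 * (u - s) * V y * roughSum y Mn + ρ * Mn) := by
  set N := ⌈Real.exp u⌉₊ with hN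
  have hV := V_pos y
  have hsd := sieveData_winSeq hsu
  have hDn0 : (0 : ℝ) < Dn := by exact_mod_cast hDn
  have hDN : Dn ≤ N := by
    have h1 : (Dn : ℝ) ≤ Real.exp u := (Real.log_le_iff_le_exp hDn0).1 hDu
    exact_mod_cast h1.trans (Nat.le_ceil _)
  set S : ℕ → ℝ := fun d => sift (fun n => winSeq s u (d * n)) N y with hSdef
  set g : ℕ → ℝ := fun d => (ArithmeticFunction.moebius d : ℝ) * (u - Real.log d) ^ 2 with hg
  have e1 : hatSum y s u = ∑ d ∈ (Ico 1 N).filter (rough y), g d * S d := by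
    rw [hatSum, sum_rough_mul_sum_divisors y (winSeq_zero s u) hsd.vanish]
  have e2 : ∑ d ∈ (Ico 1 N).filter (rough y), g d * S d
      = ∑ d ∈ (Ico 1 Dn).filter (rough y), g d * S d
        + ∑ d ∈ (Ico Dn N).filter (rough y), g d * S d := by
    rw [Finset.sum_filter, Finset.sum_filter, Finset.sum_filter,
      Finset.sum_Ico_consecutive _ hDn hDN]
  have hlogd : ∀ d : ℕ, d < N → Real.log d ≤ u := by
    intro d hd
    rcases Nat.eq_zero_or_pos d with rfl | hd0
    · simpa using hu
    rw [hN, Nat.lt_ceil] at hd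
    exact ((Real.log_lt_iff_lt_exp (by exact_mod_cast hd0)).2 hd).le
  have hS0 : ∀ d, 0 ≤ S d := fun d => sift_nonneg (fun n => winSeq_nonneg _ _ _) _ _
  have b1 : |∑ d ∈ (Ico 1 Dn).filter (rough y), g d * S d - (u - s) * V y * selMain y Dn u|
      ≤ u ^ 2 * ((u - s) * V y * E * roughSum y Dn + ρ * Dn) := by
    have : ∑ d ∈ (Ico 1 Dn).filter (rough y), g d * S d - (u - s) * V y * selMain y Dn u
        = ∑ d ∈ (Ico 1 Dn).filter (rough y), g d * (S d - (u - s) / d * V y) := by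
      rw [selMain, mul_sum, ← Finset.sum_sub_distrib]
      apply Finset.sum_congr rfl
      intro d _
      simp only [hg]; ring
    rw [this]
    calc _ ≤ ∑ d ∈ (Ico 1 Dn).filter (rough y), |g d * (S d - (u - s) / d * V y)| :=
          Finset.abs_sum_le_sum_abs _ _
      _ ≤ ∑ d ∈ (Ico 1 Dn).filter (rough y),
            u ^ 2 * ((u - s) * V y * E * (1 / (d : ℝ)) + ρ) := by
          apply Finset.sum_le_sum
          intro d hd
          rw [mem_filter, mem_Ico] at hd
          have h1 := hlogd d (by omega)
          have h2 : 0 ≤ Real.log d := Real.log_natCast_nonneg d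
          simp only [hg, mul_assoc]
          apply abs_moebius_mul_le
          rw [abs_mul, abs_of_nonneg (by positivity : 0 ≤ (u - Real.log d) ^ 2)]
          have h3 : (u - Real.log d) ^ 2 ≤ u ^ 2 := by
            apply pow_le_pow_left₀ <;> linarith
          have h4 := hS d hd.1.1
          calc _ ≤ u ^ 2 * ((u - s) / d * V y * E + ρ) := by gcongr
            _ = _ := by ring
      _ = u ^ 2 * ((u - s) * V y * E * roughSum y Dn
            + ρ * ((Ico 1 Dn).filter (rough y)).card) := by
          rw [← mul_sum, Finset.sum_add_distrib, ← mul_sum, roughSum, Finset.sum_const,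
            nsmul_eq_mul]
          ring
      _ ≤ _ := by
          gcongr
          refine (Finset.card_filter_le _ _).trans ?_
          rw [Nat.card_Ico]; omega
  have hlD : 0 ≤ u - Real.log Dn := by linarith
  have b2 : |∑ d ∈ (Ico Dn N).filter (rough y), g d * S d|
      ≤ (u - Real.log Dn) ^ 2 * (2 * (u - s) * V y * roughSum y Mn + ρ * Mn) := by
    calc _ ≤ ∑ d ∈ (Ico Dn N).filter (rough y), |g d * S d| :=
          Finset.abs_sum_le_sum_abs _ _
      _ ≤ ∑ d ∈ (Ico Dn N).filter (rough y), (u - Real.log Dn) ^ 2 * S d := by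
          apply Finset.sum_le_sum
          intro d hd
          rw [mem_filter, mem_Ico] at hd
          have h1 := hlogd d (by omega)
          have h2 : Real.log Dn ≤ Real.log d :=
            Real.log_le_log hDn0 (by exact_mod_cast hd.1.1)
          simp only [hg, mul_assoc]
          apply abs_moebius_mul_le
          rw [abs_of_nonneg (mul_nonneg (by positivity) (hS0 d))]
          have h3 : (u - Real.log d) ^ 2 ≤ (u - Real.log Dn) ^ 2 := by
            apply pow_le_pow_left₀ <;> linarith
          exact mul_le_mul_of_nonneg_right h3 (hS0 d)
      _ = (u - Real.log Dn) ^ 2 * ∑ d ∈ (Ico Dn N).filter (rough y), S d := by rw [mul_sum]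
      _ ≤ (u - Real.log Dn) ^ 2 * ∑ m ∈ (Ico 1 Mn).filter (rough y), S m := by
          refine mul_le_mul_of_nonneg_left ?_ (by positivity)
          simp only [hSdef, sift]
          rw [Finset.sum_comm]
          have hzero : ∀ m d : ℕ, d ∈ (Ico Dn N).filter (rough y) → (m = 0 ∨ Mn ≤ m) →
              winSeq s u (d * m) = 0 := by
            rintro m d hd (rfl | hm)
            · rw [mul_zero, winSeq_zero]
            · rw [mem_filter, mem_Ico] at hd
              apply hsd.vanish
              rw [Nat.ceil_le]
              refine hDM.trans ?_
              exact_mod_cast Nat.mul_le_mul hd.1.1 hm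
          have hsub : ∑ m ∈ (range N).filter (rough y), ∑ d ∈ (Ico Dn N).filter (rough y),
              winSeq s u (d * m)
              ≤ ∑ m ∈ (Ico 1 Mn).filter (rough y), ∑ d ∈ (Ico Dn N).filter (rough y),
                winSeq s u (d * m) := by
            rw [Finset.sum_filter, Finset.sum_filter]
            calc _ ≤ ∑ m ∈ range N, if m ∈ Ico 1 Mn then (if rough y m then
                    ∑ d ∈ (Ico Dn N).filter (rough y), winSeq s u (d * m) else 0) else 0 := by
                  apply Finset.sum_le_sum
                  intro m _
                  by_cases hm : m ∈ Ico 1 Mn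
                  · rw [if_pos hm]
                  · rw [if_neg hm]
                    split_ifs
                    · apply le_of_eq
                      apply Finset.sum_eq_zero
                      intro d hd
                      apply hzero m d hd
                      rw [mem_Ico] at hm; omega
                    · exact le_rfl
              _ ≤ _ := by
                  rw [← Finset.sum_filter]
                  apply Finset.sum_le_sum_of_subset_of_nonneg
                  · intro m hm
                    exact (mem_filter.1 hm).2
                  · intro m _ _
                    split_ifs
                    · exact Finset.sum_nonneg fun _ _ => winSeq_nonneg _ _ _
                    · exact le_rfl
          refine hsub.trans ?_
          apply Finset.sum_le_sum
          intro m _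
          simp only [mul_comm _ m]
          apply Finset.sum_le_sum_of_subset_of_nonneg
          · intro d hd
            rw [mem_filter, mem_Ico] at hd
            rw [mem_filter, mem_range]
            exact ⟨hd.1.2, hd.2⟩
          · intro _ _ _; exact winSeq_nonneg _ _ _
      _ ≤ (u - Real.log Dn) ^ 2 * ∑ m ∈ (Ico 1 Mn).filter (rough y),
            (2 * (u - s) * V y * (1 / (m : ℝ)) + ρ) := by
          gcongr with m hm
          rw [mem_filter, mem_Ico] at hm
          have h1 := (abs_le.1 (hS m hm.1.1)).2
          have h2 : (u - s) / m * V y * E ≤ (u - s) / m * V y := by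
            apply mul_le_of_le_one_right _ hE1
            have : 0 ≤ u - s := by linarith
            positivity
          have h3 : 2 * (u - s) * V y * (1 / (m : ℝ)) = 2 * ((u - s) / m * V y) := by ring
          rw [h3]
          simp only [hSdef]
          linarith
      _ = (u - Real.log Dn) ^ 2 * (2 * (u - s) * V y * roughSum y Mn
            + ρ * ((Ico 1 Mn).filter (rough y)).card) := by
          rw [Finset.sum_add_distrib, ← mul_sum, roughSum, Finset.sum_const, nsmul_eq_mul]
          ring
      _ ≤ _ := by
          gcongr
          refine (Finset.card_filter_le _ _).trans ?_
          rw [Nat.card_Ico]; omega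
  rw [e1, e2]
  have : ∑ d ∈ (Ico 1 Dn).filter (rough y), g d * S d
        + ∑ d ∈ (Ico Dn N).filter (rough y), g d * S d - (u - s) * V y * selMain y Dn u
      = (∑ d ∈ (Ico 1 Dn).filter (rough y), g d * S d - (u - s) * V y * selMain y Dn u)
        + ∑ d ∈ (Ico Dn N).filter (rough y), g d * S d := by ring
  rw [this]
  exact (abs_add_le _ _).trans (add_le_add b1 b2)

/-! ### Mertens' estimate for rough integers and the long-window Selberg sum -/

lemma sum_inv_pow_le {p : ℕ} (hp : 2 ≤ p) (N : ℕ) :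
    ∑ k ∈ Ico 1 N, 1 / (p : ℝ) ^ k ≤ 2 / p := by
  have hp2 : (2 : ℝ) ≤ p := by exact_mod_cast hp
  have h : ∀ N : ℕ, ∑ k ∈ Ico 1 (N + 1), 1 / (p : ℝ) ^ k + 2 / p * (1 / (p : ℝ) ^ N) ≤ 2 / p := by
    intro N
    induction N with
    | zero => simp
    | succ N ih =>
      rw [Finset.sum_Ico_succ_top (by omega)]
      have h1 : 1 / (p : ℝ) ^ N = p * (1 / (p : ℝ) ^ (N + 1)) := by
        field_simp
        ring
      have h2 : 2 / (p : ℝ) * (1 / (p : ℝ) ^ N) = 2 * (1 / (p : ℝ) ^ (N + 1)) := by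
        rw [h1]; field_simp
      have h3 : (0 : ℝ) ≤ 1 / (p : ℝ) ^ (N + 1) := by positivity
      have h4 : 2 / (p : ℝ) ≤ 1 := by rw [div_le_one (by linarith)]; exact hp2
      nlinarith
  rcases N with _ | N
  · simp; positivity
  · refine le_trans ?_ (h N)
    have : (0 : ℝ) ≤ 2 / p * (1 / (p : ℝ) ^ N) := by positivity
    linarith

lemma sum_not_rough_le {y : ℕ} (hy : 2 ≤ y) (N : ℕ) :
    ∑ n ∈ (range N).filter (fun n => ¬ rough y n), Λ n / n ≤ 2 * (Real.log y + 16) := by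
  have h1 : ∀ n ∈ (range N).filter (fun n => ¬ rough y n), Λ n / n
      ≤ ∑ p ∈ Nat.primesBelow y, ∑ k ∈ Ico 1 N, if p ^ k = n then Real.log p / (p : ℝ) ^ k
        else 0 := by
    intro n hn
    rw [mem_filter, mem_range] at hn
    have hnn : ∀ p k : ℕ, (0 : ℝ) ≤ if p ^ k = n then Real.log p / (p : ℝ) ^ k else 0 := by
      intro p k
      split_ifs
      · exact div_nonneg (Real.log_natCast_nonneg p) (by positivity)
      · exact le_rfl
    by_cases hpp : IsPrimePow n
    · obtain ⟨p, k, hp, hk, rfl⟩ := (isPrimePow_nat_iff n).1 hpp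
      have hpy : p < y := by
        by_contra h
        apply hn.2
        intro q hq hd
        rw [(Nat.prime_dvd_prime_iff_eq hq hp).1 (hq.dvd_of_dvd_pow hd)]
        omega
      have hkN : k < N := (Nat.lt_pow_self hp.one_lt).trans hn.1
      rw [ArithmeticFunction.vonMangoldt_apply_pow hk.ne',
        ArithmeticFunction.vonMangoldt_apply_prime hp]
      have s1 := Finset.single_le_sum (f := fun j => if p ^ j = p ^ k then
        Real.log p / (p : ℝ) ^ j else 0) (s := Ico 1 N) (fun j _ => hnn p j)
        (mem_Ico.2 ⟨hk, hkN⟩)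
      have s2 := Finset.single_le_sum (f := fun q => ∑ j ∈ Ico 1 N, if q ^ j = p ^ k then
        Real.log q / (q : ℝ) ^ j else 0) (s := Nat.primesBelow y)
        (fun q _ => Finset.sum_nonneg fun j _ => hnn q j)
        (Nat.mem_primesBelow.2 ⟨hpy, hp⟩)
      refine le_trans ?_ (s1.trans s2)
      simp
    · have : Λ n = 0 := ArithmeticFunction.vonMangoldt_eq_zero_iff.2 hpp
      rw [this, zero_div]
      exact Finset.sum_nonneg fun p _ => Finset.sum_nonneg fun k _ => hnn p k
  refine (Finset.sum_le_sum h1).trans ?_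
  rw [Finset.sum_comm]
  calc _ ≤ ∑ p ∈ Nat.primesBelow y, Real.log p * (2 / p) := by
        apply Finset.sum_le_sum
        intro p hp
        rw [Nat.mem_primesBelow] at hp
        have hlp : 0 ≤ Real.log p := Real.log_natCast_nonneg p
        rw [Finset.sum_comm]
        calc _ ≤ ∑ k ∈ Ico 1 N, Real.log p * (1 / (p : ℝ) ^ k) := by
              apply Finset.sum_le_sum
              intro k _
              rw [Finset.sum_ite_eq]
              split_ifs
              · apply le_of_eq; ring
              · positivity
          _ ≤ _ := by
              rw [← mul_sum]
              gcongr
              exact sum_inv_pow_le hp.2.two_le N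
    _ = 2 * ∑ p ∈ Nat.primesBelow y, Real.log p / p := by
        rw [mul_sum]
        apply Finset.sum_congr rfl
        intro p _; ring
    _ ≤ _ := by
        gcongr
        exact sum_primesBelow_log_div_le hy

lemma mertens_rough {y : ℕ} (hy : 2 ≤ y) {v : ℝ} (hv : 0 ≤ v) :
    |primeSum y 0 v - v| ≤ 43 + 2 * Real.log y := by
  set N := ⌈Real.exp v⌉₊ with hN
  have hev : 1 ≤ Real.exp v := Real.one_le_exp hv
  have hN1 : 1 ≤ N := Nat.one_le_iff_ne_zero.2 (Nat.ceil_pos.2 (by linarith)).ne'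
  have h1 : primeSum y 0 v = ∑ n ∈ (range N).filter (rough y), Λ n / n := by
    rw [primeSum, Finset.sum_filter, Finset.range_eq_Ico, Finset.sum_eq_sum_Ico_succ_bot (by omega)]
    have : win 0 v = Ico 1 N := by simp [win, hN]
    rw [this]
    simp only [Nat.cast_zero, div_zero, ite_self, zero_add]
    apply Finset.sum_congr rfl
    intro n _
    rw [lamr]
    split_ifs
    · ring
    · ring
  have h2 := Finset.sum_filter_add_sum_filter_not (range N) (rough y) (fun n => Λ n / (n : ℝ))
  have h3 := sum_not_rough_le hy N
  have h4 : 0 ≤ ∑ n ∈ (range N).filter (fun n => ¬ rough y n), Λ n / (n : ℝ) :=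
    Finset.sum_nonneg fun n _ => div_nonneg ArithmeticFunction.vonMangoldt_nonneg (by positivity)
  have h5 := abs_le.1 (mertens_range N hN1)
  have h6 : v ≤ Real.log N := by
    rw [Real.le_log_iff_exp_le (by exact_mod_cast hN1)]; exact Nat.le_ceil _
  have h7 : Real.log N ≤ v + 1 := by
    rw [Real.log_le_iff_le_exp (by exact_mod_cast hN1), Real.exp_add]
    have := Nat.ceil_lt_add_one (by linarith : 0 ≤ Real.exp v)
    have := Real.add_one_le_exp 1
    nlinarith
  have h8 : 0 ≤ Real.log y := Real.log_natCast_nonneg y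
  rw [abs_le, h1]
  constructor <;> linarith [h5.1, h5.2]

lemma win_union {r s t : ℝ} (hrs : r ≤ s) (hst : s ≤ t) (f : ℕ → ℝ) :
    ∑ n ∈ win r t, f n = ∑ n ∈ win r s, f n + ∑ n ∈ win s t, f n := by
  rw [win, win, win, Finset.sum_Ico_consecutive]
  · exact Nat.ceil_le_ceil (Real.exp_le_exp.2 hrs)
  · exact Nat.ceil_le_ceil (Real.exp_le_exp.2 hst)

/-- The logarithmically weighted rough von Mangoldt function. -/
noncomputable def cw (y n : ℕ) : ℝ := 1 / (n : ℝ) * lamr y n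

lemma cw_nonneg (y n : ℕ) : 0 ≤ cw y n := mul_nonneg (by positivity) (lamr_nonneg y n)

/-- The sum of `cw a * cw b` over pairs with product in a window. -/
noncomputable def pairSum (y : ℕ) (s t : ℝ) : ℝ :=
  ∑ q ∈ (win 0 t ×ˢ win 0 t).filter (fun q : ℕ × ℕ =>
    s ≤ Real.log q.1 + Real.log q.2 ∧ Real.log q.1 + Real.log q.2 < t), cw y q.1 * cw y q.2

lemma sum_win_antidiagonal (y : ℕ) (s t : ℝ) :
    ∑ n ∈ win s t, 1 / (n : ℝ) * ∑ q ∈ n.divisorsAntidiagonal, lamr y q.1 * lamr y q.2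
      = pairSum y s t := by
  simp only [mul_sum]
  rw [Finset.sum_sigma', pairSum]
  apply Finset.sum_bij' (fun (x : (_ : ℕ) × (ℕ × ℕ)) _ => x.2)
    (fun (q : ℕ × ℕ) _ => (⟨q.1 * q.2, q⟩ : (_ : ℕ) × (ℕ × ℕ)))
  · rintro ⟨n, a, b⟩ h
    simp only [mem_sigma, Nat.mem_divisorsAntidiagonal, mem_win] at h
    obtain ⟨⟨h1, h2, h3⟩, rfl, h5⟩ := h
    have ha : 1 ≤ a := Nat.pos_of_ne_zero fun h => by simp [h] at h5
    have hb : 1 ≤ b := Nat.pos_of_ne_zero fun h => by simp [h] at h5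
    have ha' : (a : ℝ) ≠ 0 := by positivity
    have hb' : (b : ℝ) ≠ 0 := by positivity
    rw [Nat.cast_mul, Real.log_mul ha' hb'] at h2 h3
    have la := Real.log_natCast_nonneg a
    have lb := Real.log_natCast_nonneg b
    simp only [mem_filter, mem_product, mem_win]
    refine ⟨⟨⟨ha, la, by linarith⟩, hb, lb, by linarith⟩, h2, h3⟩
  · rintro ⟨a, b⟩ h
    simp only [mem_filter, mem_product, mem_win] at h
    obtain ⟨⟨⟨ha, _, _⟩, hb, _, _⟩, h2, h3⟩ := h
    have ha' : (a : ℝ) ≠ 0 := by positivity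
    have hb' : (b : ℝ) ≠ 0 := by positivity
    simp only [mem_sigma, Nat.mem_divisorsAntidiagonal, mem_win]
    rw [Nat.cast_mul, Real.log_mul ha' hb']
    exact ⟨⟨Nat.mul_pos ha hb, h2, h3⟩, trivial, (Nat.mul_pos ha hb).ne'⟩
  · rintro ⟨n, a, b⟩ h
    simp only [mem_sigma, Nat.mem_divisorsAntidiagonal, mem_win] at h
    obtain ⟨_, rfl, _⟩ := h
    rfl
  · rintro ⟨a, b⟩ _; rfl
  · rintro ⟨n, a, b⟩ h
    simp only [mem_sigma, Nat.mem_divisorsAntidiagonal, mem_win] at h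
    obtain ⟨_, rfl, _⟩ := h
    simp only [cw]
    push_cast
    rw [← one_div_mul_one_div]
    ring

lemma selSum_eq (y : ℕ) (s t : ℝ) :
    selSum y s t = ∑ n ∈ win s t, cw y n * Real.log n + pairSum y s t := by
  rw [selSum, ← sum_win_antidiagonal, ← Finset.sum_add_distrib]
  apply Finset.sum_congr rfl
  intro n _
  rw [selw, cw]; ring

lemma pairSum_zero_eq (y : ℕ) (u : ℝ) :
    pairSum y 0 u = ∑ a ∈ win 0 u, cw y a * primeSum y 0 (u - Real.log a) := by
  rw [pairSum, Finset.sum_filter, Finset.sum_product]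
  apply Finset.sum_congr rfl
  intro a ha
  rw [mem_win] at ha
  rw [← Finset.sum_filter, primeSum, mul_sum]
  apply Finset.sum_congr _ (fun _ _ => rfl)
  ext b
  simp only [mem_filter, mem_win]
  have := Real.log_natCast_nonneg b
  constructor
  · rintro ⟨⟨h1, h2, h3⟩, h4, h5⟩
    exact ⟨h1, h2, by linarith⟩
  · rintro ⟨h1, h2, h3⟩
    exact ⟨⟨h1, h2, by linarith⟩, by linarith, by linarith⟩

lemma selSum_zero_approx {y : ℕ} {u Δ : ℝ} (hu : 0 ≤ u)
    (h : ∀ v, 0 ≤ v → |primeSum y 0 v - v| ≤ Δ) :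
    |selSum y 0 u - u ^ 2| ≤ 2 * u * Δ + Δ ^ 2 := by
  have hΔ : 0 ≤ Δ := (abs_nonneg _).trans (h 0 le_rfl)
  have hP := abs_le.1 (h u hu)
  have h1 : |selSum y 0 u - u * primeSum y 0 u| ≤ Δ * primeSum y 0 u := by
    rw [selSum_eq, pairSum_zero_eq, ← Finset.sum_add_distrib, primeSum, mul_sum, mul_sum,
      ← Finset.sum_sub_distrib]
    refine (Finset.abs_sum_le_sum_abs _ _).trans (Finset.sum_le_sum ?_)
    intro a ha
    rw [mem_win] at ha
    have e : cw y a * Real.log a + cw y a * primeSum y 0 (u - Real.log a)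
        - u * (1 / (a : ℝ) * lamr y a)
        = cw y a * (primeSum y 0 (u - Real.log a) - (u - Real.log a)) := by
      rw [cw]; ring
    rw [e, abs_mul, abs_of_nonneg (cw_nonneg y a), mul_comm Δ]
    exact mul_le_mul_of_nonneg_left (h _ (by linarith)) (cw_nonneg y a)
  have h1' := abs_le.1 h1
  rw [abs_le]
  constructor <;> nlinarith [h1'.1, h1'.2, hP.1, hP.2]

lemma selSum_long_approx {y : ℕ} {s u Δ : ℝ} (hs : 0 ≤ s) (hsu : s ≤ u)
    (h : ∀ v, 0 ≤ v → |primeSum y 0 v - v| ≤ Δ) :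
    |selSum y s u - 2 * u * (u - s)| ≤ (u - s) ^ 2 + 4 * u * Δ + 2 * Δ ^ 2 := by
  have hΔ : 0 ≤ Δ := (abs_nonneg _).trans (h 0 le_rfl)
  have h1 := abs_le.1 (selSum_zero_approx (hs.trans hsu) h)
  have h2 := abs_le.1 (selSum_zero_approx hs h)
  have h3 : selSum y 0 u = selSum y 0 s + selSum y s u := win_union hs hsu _
  have h4 : s * Δ ≤ u * Δ := by gcongr
  rw [abs_le]
  constructor <;> nlinarith [h1.1, h1.2, h2.1, h2.2]

lemma primeSum_long_le {y : ℕ} {s u Δ : ℝ} (hs : 0 ≤ s) (hsu : s ≤ u)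
    (h : ∀ v, 0 ≤ v → |primeSum y 0 v - v| ≤ Δ) :
    primeSum y s u ≤ (u - s) + 2 * Δ := by
  have h1 := abs_le.1 (h u (hs.trans hsu))
  have h2 := abs_le.1 (h s hs)
  have h3 : primeSum y 0 u = primeSum y 0 s + primeSum y s u := win_union hs hsu _
  linarith [h1.2, h2.1]

attribute [irreducible] C0

/-! ### Selberg's formula in short windows -/

lemma roughSum_le {y X : ℕ} {a : ℝ} (hy : 2 ≤ y) (hya : Real.log y ≤ a)
    (hX : (X : ℝ) ≤ Real.exp a) :
    roughSum y X ≤ 2 ^ C0 * (a / Real.log y) ^ C0 := by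
  have hy0 : (0 : ℝ) < y := by positivity
  have hly : 0 < Real.log y := Real.log_pos (by exact_mod_cast hy)
  have hya' : (y : ℝ) ≤ Real.exp a := (Real.log_le_iff_le_exp hy0).1 hya
  have h1 : X ≤ ⌊Real.exp a⌋₊ := Nat.le_floor hX
  have h2 : y ≤ ⌊Real.exp a⌋₊ := Nat.le_floor hya'
  have h3 : roughSum y X ≤ roughSum y ⌊Real.exp a⌋₊ := by
    apply Finset.sum_le_sum_of_subset_of_nonneg
    · exact Finset.filter_subset_filter _ (Finset.Ico_subset_Ico le_rfl h1)
    · intro _ _ _; positivity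
  refine h3.trans ((sum_rough_inv_le_log hy h2).trans ?_)
  have h4 : Real.log (⌊Real.exp a⌋₊ : ℕ) ≤ a := by
    rw [Real.log_le_iff_le_exp (by exact_mod_cast (by omega : 0 < ⌊Real.exp a⌋₊))]
    exact Nat.floor_le (Real.exp_pos a).le
  have h5 : 0 ≤ Real.log (⌊Real.exp a⌋₊ : ℕ) := Real.log_natCast_nonneg _
  gcongr

set_option maxHeartbeats 800000 in
lemma hatSum_short {B : ℕ} {s1 k τ U u κ : ℝ} {y : ℕ} (hB : (C0 + 3) * (C0 + 1) + 1 ≤ B)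
    (hs1 : 1 ≤ s1)
    (hFL : ∀ w : ℕ, 2 ≤ w → ∀ (a : ℕ → ℝ) (N : ℕ) (X r D : ℝ), SieveData a N X r → 1 < D →
      |sift a N w - X * V w| ≤ X * V w * (s1 * Real.log w / Real.log D) ^ B + r * D ^ 2)
    (hk : 2 ≤ k) (hks : 16 * s1 ≤ k) (hτ : 0 < τ) (hτk : τ * k ^ (C0 + 3) = 1) (hy : 2 ≤ y)
    (hℓ1 : τ * U ≤ Real.log y) (hℓ2 : Real.log y ≤ 2 * τ * U) (hU : 1 ≤ U)
    (hkτ : 2 ≤ k * τ * U) (hu1 : 2 * (k * τ) * U ≤ u) (hu2 : u ≤ U)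
    (hκ1 : Real.exp (-(k * τ / 8 * U)) ≤ κ) (hκ2 : κ ≤ k * τ / 8 * U)
    (hbig : 8 * k * U * Real.exp (-(k * τ / 8 * U) * 4) ≤ 1) :
    |hatSum y (u - κ) u - κ * V y * selMain y ⌊Real.exp (u - k * τ * U)⌋₊ u|
      ≤ ((16 * s1) ^ B * 2 ^ C0 + 8 * 4 ^ C0 + 1) / k * U * κ := by
  have hRS := @roughSum_le
  obtain ⟨c, hc⟩ : ∃ c, C0 = c := ⟨_, rfl⟩
  simp only [hc] at *
  have hκ : 0 < κ := (Real.exp_pos _).trans_le hκ1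
  have hk0 : 0 < k := by linarith
  have hU0 : 0 < U := by linarith
  have hτU : 0 < τ * U := by positivity
  have hℓ : 0 < Real.log y := hτU.trans_le hℓ1
  have hkτ1 : k * τ ≤ 1 / 2 := by
    have : 2 * (k * τ) * U ≤ 1 * U := by linarith
    have := le_of_mul_le_mul_right this hU0
    linarith
  have hu0 : 0 ≤ u := by linarith
  have h2τ : 2 * τ ≤ k * τ := by gcongr
  set δ := k * τ / 8 with hδ
  have hδ0 : 0 < δ := by positivity
  set Z := Real.exp (-(δ * U)) with hZ
  set e1 := Real.exp (u - k * τ * U) with he1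
  set Dn := ⌊e1⌋₊ with hDn
  have he1' : 1 ≤ e1 := Real.one_le_exp (by linarith)
  have hDn1 : 1 ≤ Dn := Nat.le_floor (by exact_mod_cast he1')
  have hDn0 : (0 : ℝ) < Dn := by exact_mod_cast hDn1
  have hDnle : (Dn : ℝ) ≤ e1 := Nat.floor_le (by linarith)
  have hDnge : e1 ≤ 2 * Dn := by
    have := Nat.lt_floor_add_one e1
    have h1 : (1 : ℝ) ≤ Dn := by exact_mod_cast hDn1
    linarith
  set Mn := ⌈Real.exp u / Dn⌉₊ with hMn
  have hDM : Real.exp u ≤ Dn * Mn := by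
    have := Nat.le_ceil (Real.exp u / Dn)
    rwa [div_le_iff₀ hDn0, mul_comm] at this
  have heu : Real.exp u = e1 * Real.exp (k * τ * U) := by
    rw [he1, ← Real.exp_add]; congr 1; ring
  have hE1 : 1 ≤ Real.exp (k * τ * U) := Real.one_le_exp (by linarith)
  have hMnle : (Mn : ℝ) ≤ 3 * Real.exp (k * τ * U) := by
    have h1 := Nat.ceil_lt_add_one (by positivity : 0 ≤ Real.exp u / Dn)
    have h2 : Real.exp u / Dn ≤ 2 * Real.exp (k * τ * U) := by
      rw [div_le_iff₀ hDn0, heu]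
      calc e1 * Real.exp (k * τ * U) ≤ (2 * Dn) * Real.exp (k * τ * U) := by gcongr
        _ = _ := by ring
    linarith
  have hMn2 : (Mn : ℝ) ≤ Real.exp (2 * (k * τ) * U) := by
    refine hMnle.trans ?_
    have h1 : (3 : ℝ) ≤ Real.exp (k * τ * U) := by
      have := Real.add_one_le_exp (k * τ * U); linarith
    rw [show 2 * (k * τ) * U = k * τ * U + k * τ * U by ring, Real.exp_add]
    gcongr
  have hlD : u - Real.log Dn ≤ 2 * (k * τ) * U := by
    have h1 : Real.log e1 ≤ Real.log (2 * Dn) := Real.log_le_log (by linarith) hDnge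
    rw [Real.log_mul (by norm_num) hDn0.ne', he1, Real.log_exp] at h1
    have := Real.log_two_lt_d9
    linarith
  have hlDu : Real.log Dn ≤ u := by
    have h1 : Real.log Dn ≤ Real.log e1 := Real.log_le_log hDn0 hDnle
    rw [he1, Real.log_exp] at h1
    linarith
  set D := Real.exp (δ * U) with hD
  have hD1 : 1 < D := Real.one_lt_exp_iff.2 (by positivity)
  have hlogD : Real.log D = δ * U := Real.log_exp _
  set E := (s1 * Real.log y / Real.log D) ^ B with hE
  have hq0 : 0 ≤ s1 * Real.log y / Real.log D := by
    rw [hlogD]; positivity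
  have hq : s1 * Real.log y / Real.log D ≤ 16 * s1 / k := by
    rw [hlogD, div_le_div_iff₀ (by positivity) hk0, hδ]
    have : s1 * Real.log y * k ≤ s1 * (2 * τ * U) * k := by gcongr
    linarith
  have hEle : E ≤ (16 * s1 / k) ^ B := pow_le_pow_left₀ hq0 hq B
  have hE0 : 0 ≤ E := pow_nonneg hq0 B
  have hEone : E ≤ 1 := hEle.trans (pow_le_one₀ (by positivity) ((div_le_one hk0).2 hks))
  set ρ := 2 / Real.exp (u - κ) * D ^ 2 with hρ
  have hρ0 : 0 ≤ ρ := by positivity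
  have hmain := hatSum_approx (y := y) (Dn := Dn) (Mn := Mn) (s := u - κ) (u := u) (E := E) (ρ := ρ)
    (by linarith) hu0 hDn1 hDM hlDu hEone hρ0 (by
      intro d hd
      exact hFL y hy _ _ _ _ D ((sieveData_winSeq (by linarith)).mul_left hd) hD1)
  have hsub : u - (u - κ) = κ := by ring
  rw [hsub] at hmain
  refine hmain.trans ?_
  have hV0 := V_pos y
  have hV : V y ≤ 1 / (τ * U) := by
    have h1 := V_mul_log_le hy
    rw [le_div_iff₀ hτU]
    exact (mul_le_mul_of_nonneg_left hℓ1 hV0.le).trans h1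
  have hR1 : roughSum y Dn ≤ 2 ^ c * (1 / τ) ^ c := by
    have h1 : Real.log y ≤ U := by
      have : 2 * τ * U ≤ 1 * U := by
        gcongr
        linarith
      linarith
    refine (hRS hy h1 (hDnle.trans (Real.exp_le_exp.2 (by linarith)))).trans ?_
    have h2 : U / Real.log y ≤ 1 / τ := by
      rw [div_le_div_iff₀ hℓ hτ]; linarith
    gcongr
  have hR2 : roughSum y Mn ≤ 4 ^ c * k ^ c := by
    have h1 : Real.log y ≤ 2 * (k * τ) * U := by
      have : 2 * τ * U ≤ 2 * (k * τ) * U := by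
        gcongr
        linarith
      linarith
    refine (hRS hy h1 hMn2).trans ?_
    have h2 : 2 * (k * τ) * U / Real.log y ≤ 2 * k := by
      rw [div_le_iff₀ hℓ]
      calc 2 * (k * τ) * U = 2 * k * (τ * U) := by ring
        _ ≤ _ := by gcongr
    calc _ ≤ (2 : ℝ) ^ c * (2 * k) ^ c := by gcongr
      _ = _ := by rw [← mul_pow, ← mul_pow, ← mul_assoc, show (2 : ℝ) * 2 = 4 by norm_num]
  have hR10 : 0 ≤ roughSum y Dn := Finset.sum_nonneg fun _ _ => by positivity
  have hR20 : 0 ≤ roughSum y Mn := Finset.sum_nonneg fun _ _ => by positivity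
  have T1 : u ^ 2 * (κ * V y * E * roughSum y Dn) ≤ (16 * s1) ^ B * 2 ^ c / k * U * κ := by
    calc _ ≤ U ^ 2 * (κ * (1 / (τ * U)) * (16 * s1 / k) ^ B * (2 ^ c * (1 / τ) ^ c)) := by
          gcongr
      _ = (16 * s1) ^ B * 2 ^ c * U * κ * ((1 / τ) ^ (c + 1) / k ^ B) := by
          rw [div_pow, pow_succ (1 / τ) c]
          generalize (1 / τ) ^ c = R
          field_simp
      _ ≤ (16 * s1) ^ B * 2 ^ c * U * κ * (1 / k) := by
          refine mul_le_mul_of_nonneg_left ?_ (by positivity)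
          have h1 : 1 / τ = k ^ (c + 3) := by rw [div_eq_iff hτ.ne', mul_comm]; exact hτk.symm
          rw [h1, ← pow_mul, div_le_div_iff₀ (by positivity) hk0, one_mul, ← pow_succ]
          exact pow_le_pow_right₀ (by linarith) hB
      _ = _ := by ring
  have T3 : (u - Real.log Dn) ^ 2 * (2 * κ * V y * roughSum y Mn) ≤ 8 * 4 ^ c / k * U * κ := by
    have hl0 : 0 ≤ u - Real.log Dn := by linarith
    calc _ ≤ (2 * (k * τ) * U) ^ 2 * (2 * κ * (1 / (τ * U)) * (4 ^ c * k ^ c)) := by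
          gcongr
      _ = 8 * 4 ^ c * U * κ * (τ * k ^ (c + 2)) := by
          rw [pow_add]; field_simp; ring
      _ = 8 * 4 ^ c * U * κ * (1 / k) := by
          have : τ * k ^ (c + 2) = 1 / k := by
            rw [eq_div_iff hk0.ne', mul_assoc, ← pow_succ]; exact hτk
          rw [this]
      _ = _ := by ring
  have hρZ : ∀ t : ℝ, t ≤ u - k * τ * U → ρ * Real.exp t ≤ 2 * Z ^ 5 := by
    intro t ht
    have : ρ * Real.exp t = 2 * Real.exp (κ - u + 2 * (δ * U) + t) := by
      rw [hρ, hD, Real.exp_add, Real.exp_add, Real.exp_sub, Real.exp_sub, ← Real.exp_nat_mul]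
      push_cast
      field_simp
    rw [this, hZ, ← Real.exp_nat_mul]
    gcongr
    push_cast
    have : k * τ * U = 8 * (δ * U) := by rw [hδ]; ring
    linarith
  have hZ0 : 0 < Z := Real.exp_pos _
  have hbig' : 8 * k * U * Z ^ 4 ≤ 1 := by
    rw [hZ, ← Real.exp_nat_mul]
    convert hbig using 3
    push_cast; ring
  have T2 : u ^ 2 * (ρ * Dn) ≤ U ^ 2 * (2 * Z ^ 5) := by
    have := hρZ _ le_rfl
    have h2 : ρ * Dn ≤ ρ * e1 := by gcongr
    exact mul_le_mul (pow_le_pow_left₀ hu0 hu2 2) (h2.trans this) (by positivity) (by positivity)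
  have T4 : (u - Real.log Dn) ^ 2 * (ρ * Mn) ≤ U ^ 2 * (6 * Z ^ 5) := by
    have hl0 : 0 ≤ u - Real.log Dn := by linarith
    have h1 := hρZ (k * τ * U) (by linarith)
    have h2 : ρ * Mn ≤ ρ * (3 * Real.exp (k * τ * U)) := by gcongr
    have h3 : u - Real.log Dn ≤ U := by linarith
    exact mul_le_mul (pow_le_pow_left₀ hl0 h3 2) (by linarith) (by positivity) (by positivity)
  have T5 : U ^ 2 * (8 * Z ^ 5) ≤ 1 / k * U * κ := by
    calc U ^ 2 * (8 * Z ^ 5) = (8 * k * U * Z ^ 4) * (1 / k * U * Z) := by field_simp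
      _ ≤ 1 * (1 / k * U * Z) := by gcongr
      _ ≤ 1 / k * U * κ := by rw [one_mul]; gcongr
  have : ((16 * s1) ^ B * 2 ^ c + 8 * 4 ^ c + 1) / k * U * κ
      = (16 * s1) ^ B * 2 ^ c / k * U * κ + 8 * 4 ^ c / k * U * κ + 1 / k * U * κ := by ring
  rw [this]
  linarith

lemma hatSum_sub_selSum {y : ℕ} {s t u : ℝ} (hs : 0 < s) (hst : s ≤ t) (htu : t ≤ u) :
    0 ≤ hatSum y t u - selSum y t u ∧
      hatSum y t u - selSum y t u ≤ 2 * (u - t) * primeSum y s u := by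
  rw [hatSum_eq (hs.trans_le hst), add_sub_cancel_left]
  constructor
  · apply Finset.sum_nonneg
    intro n hn
    rw [mem_win] at hn
    have h1 := lamr_nonneg y n
    have h2 : 0 ≤ u - Real.log n := by linarith
    positivity
  · have h1 : primeSum y t u ≤ primeSum y s u := by
      rw [primeSum, primeSum, win_union hst htu]
      have : 0 ≤ ∑ n ∈ win s t, 1 / (n : ℝ) * lamr y n := primeSum_nonneg y s t
      linarith
    have h2 : ∑ n ∈ win t u, 1 / (n : ℝ) * (2 * (u - Real.log n) * lamr y n)
        ≤ 2 * (u - t) * primeSum y t u := by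
      rw [primeSum, mul_sum]
      apply Finset.sum_le_sum
      intro n hn
      rw [mem_win] at hn
      have h1 := lamr_nonneg y n
      have h2 : u - Real.log n ≤ u - t := by linarith
      calc _ ≤ 1 / (n : ℝ) * (2 * (u - t) * lamr y n) := by gcongr
        _ = _ := by ring
    have h3 : 0 ≤ 2 * (u - t) := by linarith
    exact h2.trans (mul_le_mul_of_nonneg_left h1 h3)

lemma selSum_short_of_hatSum {y : ℕ} {u κ L Δ H G θ : ℝ} (hκ : 0 < κ) (hκL : κ ≤ L) (hLu : L < u)
    (hP : ∀ v, 0 ≤ v → |primeSum y 0 v - v| ≤ Δ)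
    (hS : |hatSum y (u - κ) u - κ * G| ≤ H * κ) (hL : |hatSum y (u - L) u - L * G| ≤ H * L)
    (hθ : 4 * u * Δ + 2 * Δ ^ 2 ≤ L * θ) :
    |selSum y (u - κ) u - 2 * u * κ| ≤ (2 * H + 5 * L + 8 * Δ + θ) * κ := by
  have hL0 : 0 < L := hκ.trans_le hκL
  have hPL := primeSum_long_le (y := y) (s := u - L) (u := u) (by linarith) (by linarith) hP
  have h1 := hatSum_sub_selSum (y := y) (s := u - L) (t := u - κ) (u := u) (by linarith)
    (by linarith) (by linarith)
  have h2 := hatSum_sub_selSum (y := y) (s := u - L) (t := u - L) (u := u) (by linarith)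
    le_rfl (by linarith)
  have h3 := selSum_long_approx (y := y) (s := u - L) (u := u) (by linarith) (by linarith) hP
  rw [sub_sub_cancel] at hPL h1 h2 h3
  have h1' : 2 * κ * primeSum y (u - L) u ≤ 2 * κ * (L + 2 * Δ) := by gcongr
  have h2' : 2 * L * primeSum y (u - L) u ≤ 2 * L * (L + 2 * Δ) := by gcongr
  rw [abs_le] at hS hL h3
  have hG1 : G - 2 * u ≤ H + 3 * L + 4 * Δ + θ := by
    refine le_of_mul_le_mul_left ?_ hL0
    nlinarith [hS, hL, h3]
  have hG2 : -(H + 3 * L + 4 * Δ + θ) ≤ G - 2 * u := by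
    refine le_of_mul_le_mul_left ?_ hL0
    nlinarith [hS, hL, h3]
  have hG1' := mul_le_mul_of_nonneg_left hG1 hκ.le
  have hG2' := mul_le_mul_of_nonneg_left hG2 hκ.le
  rw [abs_le]
  constructor <;> nlinarith [hS]

set_option maxHeartbeats 800000 in
/-- Selberg's formula in short logarithmic windows, for primes exceeding a small power. -/
theorem selberg_short {σ ε : ℝ} (hσ : 0 < σ) (hε : 0 < ε) :
    ∃ δ τ U₀ : ℝ, 0 < δ ∧ δ ≤ σ ∧ 0 < τ ∧ ∀ U, U₀ ≤ U → ∃ y : ℕ, 2 ≤ y ∧ τ * U ≤ Real.log y ∧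
      (∀ v, 0 ≤ v → |primeSum y 0 v - v| ≤ σ * U) ∧
      ∀ u κ, ε * U ≤ u → u ≤ U → Real.exp (-(δ * U)) ≤ κ → κ ≤ 1 →
        |selSum y (u - κ) u - 2 * u * κ| ≤ σ * U * κ := by
  obtain ⟨m0, hm0⟩ := fundamental_lemma
  obtain ⟨s1, hs1, hFL⟩ := hm0 (m0 + ((C0 + 3) * (C0 + 1) + 1)) (by omega)
  set B := C0 + (m0 + ((C0 + 3) * (C0 + 1) + 1)) with hB
  have hBge : (C0 + 3) * (C0 + 1) + 1 ≤ B := by omega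
  clear_value B
  set H0 : ℝ := (16 * s1) ^ B * 2 ^ C0 + 8 * 4 ^ C0 + 1 with hH0
  have hH0p : 0 < H0 := by positivity
  set k : ℝ := 2 + 16 * s1 + (2 * H0 + 601) / σ + 2 / ε with hk
  have hk1 : 0 < (2 * H0 + 601) / σ := by positivity
  have hk2 : 0 < 2 / ε := by positivity
  have hk3 : 2 ≤ k := by linarith
  have hk4 : 16 * s1 ≤ k := by linarith
  have hk0 : 0 < k := by linarith
  have hk5 : (2 * H0 + 601) / k ≤ σ := by
    rw [div_le_iff₀ hk0, mul_comm σ, ← div_le_iff₀ hσ]; linarith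
  have hk6 : 2 / k ≤ ε := by
    rw [div_le_iff₀ hk0, mul_comm ε, ← div_le_iff₀ hε]; linarith
  clear_value k
  set τ : ℝ := 1 / k ^ (C0 + 3) with hτ
  have hτ0 : 0 < τ := by positivity
  have hτk : τ * k ^ (C0 + 3) = 1 := by rw [hτ]; field_simp
  have hkτ : k * τ ≤ 1 / k := by
    rw [le_div_iff₀ hk0]
    have h1 : k ^ 2 ≤ k ^ (C0 + 3) := pow_le_pow_right₀ (by linarith) (by omega)
    calc k * τ * k = τ * k ^ 2 := by ring
      _ ≤ τ * k ^ (C0 + 3) := by gcongr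
      _ = 1 := hτk
  have h2τ : 2 * τ ≤ k * τ := by gcongr
  clear_value τ
  have hkσ : 601 * (1 / k) ≤ σ := by
    refine le_trans ?_ hk5
    rw [mul_one_div]
    gcongr
    linarith
  have hkp : 0 < 1 / k := by positivity
  have hkp1 : 1 / k ≤ 1 := by
    rw [div_le_one hk0]
    linarith
  set δ := k * τ / 8 with hδ
  have hδ0 : 0 < δ := by positivity
  have hlim : ∀ᶠ U in Filter.atTop, 8 * k * U * Real.exp (-(δ * U) * 4) ≤ 1 := by
    have h1 := (Real.tendsto_pow_mul_exp_neg_atTop_nhds_zero 1)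
    have h2 : Filter.Tendsto (fun U : ℝ => (4 * δ) * U) Filter.atTop Filter.atTop :=
      Filter.tendsto_id.const_mul_atTop (by positivity)
    have h3 := (h1.comp h2).const_mul (8 * k / (4 * δ))
    rw [mul_zero] at h3
    filter_upwards [h3.eventually (ge_mem_nhds one_pos)] with U hU
    refine le_trans (le_of_eq ?_) hU
    simp only [Function.comp, pow_one]
    rw [show -(δ * U) * 4 = -(4 * δ * U) by ring]
    field_simp
  obtain ⟨U₁, hU₁⟩ := Filter.eventually_atTop.1 hlim
  refine ⟨δ, τ, max U₁ (1 + 43 / τ + 1 / δ), hδ0, by linarith, hτ0, fun U hU => ?_⟩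
  have hUbig := hU₁ U ((le_max_left _ _).trans hU)
  have hU2 := (le_max_right _ _).trans hU
  have hp1 : 0 < 43 / τ := by positivity
  have hp2 : 0 < 1 / δ := by positivity
  have hU1 : 1 ≤ U := by linarith
  have hU0 : 0 < U := by linarith
  have hτU : 43 ≤ τ * U := by
    rw [mul_comm, ← div_le_iff₀ hτ0]; linarith
  have hδU : 1 ≤ δ * U := by
    rw [mul_comm, ← div_le_iff₀ hδ0]; linarith
  set y := ⌈Real.exp (τ * U)⌉₊ with hy
  have hexp : 2 ≤ Real.exp (τ * U) := by
    have := Real.add_one_le_exp (τ * U); linarith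
  have hyge : Real.exp (τ * U) ≤ y := Nat.le_ceil _
  have hy2 : 2 ≤ y := by exact_mod_cast hexp.trans hyge
  have hy0 : (0 : ℝ) < y := by positivity
  have hℓ1 : τ * U ≤ Real.log y := (Real.le_log_iff_exp_le hy0).2 hyge
  have hℓ2 : Real.log y ≤ 2 * τ * U := by
    rw [Real.log_le_iff_le_exp hy0, show 2 * τ * U = τ * U + τ * U by ring, Real.exp_add]
    have := Nat.ceil_lt_add_one (Real.exp_pos (τ * U)).le
    nlinarith
  have hP : ∀ v, 0 ≤ v → |primeSum y 0 v - v| ≤ 5 * (τ * U) := fun v hv =>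
    (mertens_rough hy2 hv).trans (by linarith)
  have hkτU : k * τ * U ≤ 1 / k * U := by gcongr
  have h2τU : 2 * (τ * U) ≤ k * τ * U := by
    rw [← mul_assoc]
    gcongr
  have hkU : 601 * (1 / k * U) ≤ σ * U := by
    rw [← mul_assoc]
    gcongr
  have hkU0 : 0 < 1 / k * U := by positivity
  refine ⟨y, hy2, hℓ1, fun v hv => (hP v hv).trans (by linarith), fun u κ hu1 hu2 hκ1 hκ2 => ?_⟩
  have hu3 : 2 * (k * τ) * U ≤ u := by
    refine le_trans ?_ hu1
    gcongr
    refine le_trans ?_ hk6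
    rw [← mul_one_div]
    gcongr
  have hκ0 : 0 < κ := (Real.exp_pos _).trans_le hκ1
  have hL8 : 8 * (δ * U) = k * τ * U := by rw [hδ]; ring
  have hS := hatSum_short hBge hs1 hFL hk3 hk4 hτ0 hτk hy2 hℓ1 hℓ2 hU1 (by linarith) hu3 hu2
    hκ1 (hκ2.trans hδU) hUbig
  have hL := hatSum_short hBge hs1 hFL hk3 hk4 hτ0 hτk hy2 hℓ1 hℓ2 hU1 (by linarith) hu3 hu2
    (hκ1.trans (hκ2.trans hδU)) le_rfl hUbig
  rw [← hH0, ← hδ] at *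
  rw [mul_assoc κ] at hS
  rw [mul_assoc (δ * U)] at hL
  refine (selSum_short_of_hatSum (θ := 560 * (1 / k * U)) hκ0 (hκ2.trans hδU) (by linarith) hP hS hL
    ?_).trans ?_
  · have h1 : 4 * u * (5 * (τ * U)) ≤ 4 * U * (5 * (τ * U)) := by gcongr
    have h2 : 50 * (τ * U) * (τ * U) ≤ 50 * U * (τ * U) := by
      have : τ * U ≤ 1 * U := by
        gcongr
        linarith
      gcongr
      linarith
    have h3 : δ * U * (560 * (1 / k * U)) = 70 * U * (τ * U) := by
      have : δ * 8 = k * τ := by rw [hδ]; ring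
      rw [show δ * U * (560 * (1 / k * U)) = δ * 8 * 70 * U * U * (1 / k) by ring, this]
      field_simp
    linarith
  · refine mul_le_mul_of_nonneg_right ?_ hκ0.le
    have h4 : 2 * (H0 / k * U) + 601 * (1 / k * U) = (2 * H0 + 601) / k * U := by ring
    have h5 : (2 * H0 + 601) / k * U ≤ σ * U := by gcongr
    linarith

/-! ### A rigidity lemma for sequences satisfying Selberg's formula -/

/-- The self-convolution of a sequence. -/
noncomputable def cnv (f : ℕ → ℝ) (k : ℕ) : ℝ := ∑ p ∈ antidiagonal k, f p.1 * f p.2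

lemma cnv_eq_range (f : ℕ → ℝ) (k : ℕ) : cnv f k = ∑ i ∈ range (k + 1), f i * f (k - i) :=
  Finset.Nat.sum_antidiagonal_eq_sum_range_succ (fun i j => f i * f j) k

lemma sum_sq_sub_reflect (f : ℕ → ℝ) (k : ℕ) :
    ∑ i ∈ range (k + 1), (f i - f (k - i)) ^ 2
      = 2 * ∑ i ∈ range (k + 1), f i ^ 2 - 2 * cnv f k := by
  have h1 : ∑ i ∈ range (k + 1), f (k - i) ^ 2 = ∑ i ∈ range (k + 1), f i ^ 2 := by
    have := Finset.sum_range_reflect (fun i => f i ^ 2) (k + 1)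
    simpa using this
  rw [cnv_eq_range, two_mul]
  nth_rw 2 [← h1]
  rw [mul_sum, ← Finset.sum_add_distrib, ← Finset.sum_sub_distrib]
  apply Finset.sum_congr rfl
  intro i _; ring

section Rigidity

variable {f : ℕ → ℝ} {σ : ℝ} {N K : ℕ}

lemma sum_sq_le_of_bounded (hf : ∀ k, |f k| ≤ 1 + σ) (m : ℕ) :
    ∑ i ∈ range m, f i ^ 2 ≤ m * (1 + σ) ^ 2 := by
  calc _ ≤ ∑ _i ∈ range m, (1 + σ) ^ 2 :=
        Finset.sum_le_sum fun i _ => by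
          rw [← sq_abs]
          exact pow_le_pow_left₀ (abs_nonneg _) (hf i) 2
    _ = _ := by simp

lemma sum_reflect_le (hσ0 : 0 ≤ σ) (hσ : σ ≤ 1 / 1000) (hN : 1 ≤ σ * N)
    (hf : ∀ k, |f k| ≤ 1 + σ) {k : ℕ} (hk : k ≤ N) (hc : N * (1 - 3 * σ) ≤ cnv f k) :
    ∑ i ∈ range (k + 1), (f i - f (k - i)) ^ 2 ≤ 14 * σ * N := by
  rw [sum_sq_sub_reflect]
  have h1 := sum_sq_le_of_bounded hf (k + 1)
  have hk' : (k : ℝ) ≤ N := by exact_mod_cast hk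
  have hM : (0 : ℝ) ≤ N := by positivity
  have h2 : ((k + 1 : ℕ) : ℝ) * (1 + σ) ^ 2 ≤ (N * (1 + σ)) * (1 + σ) ^ 2 := by
    gcongr
    push_cast; linarith
  have h3 : (N : ℝ) * (1 + σ) * (1 + σ) ^ 2 ≤ N * (1 + 4 * σ) := by
    rw [mul_assoc]
    gcongr
    have s2 : σ ^ 2 ≤ σ * (1 / 1000) := by rw [sq]; gcongr
    have s3 : σ ^ 3 ≤ σ * (1 / 1000) := by
      calc σ ^ 3 = σ ^ 2 * σ := by ring
        _ ≤ (σ * (1 / 1000)) * 1 := by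
            gcongr
            linarith
        _ = _ := by ring
    nlinarith
  nlinarith

lemma sum_shift_le (hσ0 : 0 ≤ σ) (hσ : σ ≤ 1 / 1000) (hN : 1 ≤ σ * N)
    (hf : ∀ k, |f k| ≤ 1 + σ) {b : ℕ} (hb : b ≤ N) (hc0 : N * (1 - 3 * σ) ≤ cnv f N)
    (hc : N * (1 - 3 * σ) ≤ cnv f (N - b)) :
    ∑ i ∈ Ico b (N + 1), (f i - f (i - b)) ^ 2 ≤ 56 * σ * N := by
  have h1 := sum_reflect_le hσ0 hσ hN hf le_rfl hc0
  have h2 := sum_reflect_le hσ0 hσ hN hf (Nat.sub_le N b) hc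
  have h3 : ∑ i ∈ Ico b (N + 1), (f i - f (N - i)) ^ 2
      ≤ ∑ i ∈ range (N + 1), (f i - f (N - i)) ^ 2 := by
    apply Finset.sum_le_sum_of_subset_of_nonneg
    · intro i hi
      rw [mem_Ico] at hi; rw [mem_range]; exact hi.2
    · intro _ _ _; positivity
  have h4 : ∑ i ∈ Ico b (N + 1), (f (N - i) - f (i - b)) ^ 2
      = ∑ i ∈ range (N - b + 1), (f i - f (N - b - i)) ^ 2 := by
    apply Finset.sum_bij' (fun i _ => N - i) (fun j _ => N - j)
    · intro i hi; rw [mem_Ico] at hi; rw [mem_range]; omega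
    · intro i hi; rw [mem_range] at hi; rw [mem_Ico]; omega
    · intro i hi; rw [mem_Ico] at hi; omega
    · intro i hi; rw [mem_range] at hi; omega
    · intro i hi
      rw [mem_Ico] at hi
      rw [show N - b - (N - i) = i - b by omega]
  calc _ ≤ ∑ i ∈ Ico b (N + 1), (2 * (f i - f (N - i)) ^ 2 + 2 * (f (N - i) - f (i - b)) ^ 2) := by
        apply Finset.sum_le_sum
        intro i _
        nlinarith [sq_nonneg (f i - f (N - i) - (f (N - i) - f (i - b)))]
    _ ≤ _ := by
        rw [Finset.sum_add_distrib, ← mul_sum, ← mul_sum, h4]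
        linarith

lemma sum_defect_le (hσ0 : 0 ≤ σ) (hσ : σ ≤ 1 / 1000) (hN : 1 ≤ σ * N)
    (hf : ∀ k, |f k| ≤ 1 + σ) (hc0 : N * (1 - 3 * σ) ≤ cnv f N) {s : Finset ℕ}
    (hs : s ⊆ range (N + 1)) :
    ∑ i ∈ s, (1 + 3 * σ - f i ^ 2) ≤ 8 * σ * N := by
  have h0 : ∀ i, 0 ≤ 1 + 3 * σ - f i ^ 2 := by
    intro i
    have : f i ^ 2 ≤ (1 + σ) ^ 2 := by
      rw [← sq_abs]; exact pow_le_pow_left₀ (abs_nonneg _) (hf i) 2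
    nlinarith
  refine (Finset.sum_le_sum_of_subset_of_nonneg hs fun i _ _ => h0 i).trans ?_
  have h1 := sum_sq_sub_reflect f N
  have h2 : 0 ≤ ∑ i ∈ range (N + 1), (f i - f (N - i)) ^ 2 :=
    Finset.sum_nonneg fun _ _ => sq_nonneg _
  rw [Finset.sum_sub_distrib, Finset.sum_const, card_range, nsmul_eq_mul]
  push_cast
  nlinarith

lemma abs_cnv_le (hσ0 : 0 ≤ σ) (hf : ∀ k, |f k| ≤ 1 + σ) (k : ℕ) :
    |cnv f k| ≤ (k + 1) * (1 + σ) ^ 2 := by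
  rw [cnv_eq_range]
  calc _ ≤ ∑ i ∈ range (k + 1), |f i * f (k - i)| := Finset.abs_sum_le_sum_abs _ _
    _ ≤ ∑ _i ∈ range (k + 1), (1 + σ) ^ 2 := by
        apply Finset.sum_le_sum
        intro i _
        rw [abs_mul, sq]
        exact mul_le_mul (hf _) (hf _) (abs_nonneg _) (by linarith)
    _ = _ := by simp

lemma sum_mul_shift_ge (hσ0 : 0 ≤ σ) (hσ : σ ≤ 1 / 1000) (hN : 1 ≤ σ * N)
    (hf : ∀ k, |f k| ≤ 1 + σ) {b : ℕ} (hbK : b ≤ K) (hK : K ≤ σ * N)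
    (hc0 : N * (1 - 3 * σ) ≤ cnv f N) (hc : N * (1 - 3 * σ) ≤ cnv f (N - b)) :
    (N : ℝ) ^ 2 / 2 - 37 * σ * N ^ 2 ≤ ∑ k ∈ Ico K (N + 1), k * (f k * f (k - b)) := by
  have hM : (0 : ℝ) ≤ N := by positivity
  have hKN : K ≤ N := by
    have : (K : ℝ) ≤ N := by nlinarith
    exact_mod_cast this
  have h1 := sum_shift_le hσ0 hσ hN hf (hbK.trans hKN) hc0 hc
  have h1' : ∑ i ∈ Ico K (N + 1), (f i - f (i - b)) ^ 2 ≤ 56 * σ * N := by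
    refine le_trans (Finset.sum_le_sum_of_subset_of_nonneg ?_ fun _ _ _ => sq_nonneg _) h1
    exact Finset.Ico_subset_Ico hbK le_rfl
  have h2 := sum_defect_le hσ0 hσ hN hf hc0 (s := Ico K (N + 1)) (by
    intro i hi; rw [mem_Ico] at hi; rw [mem_range]; exact hi.2)
  have h3 : ∑ i ∈ Ico K (N + 1), (1 + 3 * σ - f (i - b) ^ 2) ≤ 8 * σ * N := by
    have := sum_defect_le hσ0 hσ hN hf hc0 (s := (Ico K (N + 1)).image (fun i => i - b)) (by
      intro i hi
      rw [mem_image] at hi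
      obtain ⟨j, hj, rfl⟩ := hi
      rw [mem_Ico] at hj; rw [mem_range]; omega)
    rwa [Finset.sum_image] at this
    intro i hi j hj hij
    simp only [coe_Ico, Set.mem_Ico] at hi hj
    simp only at hij
    omega
  have h0 : ∀ i, 0 ≤ 1 + 3 * σ - f i ^ 2 := by
    intro i
    have : f i ^ 2 ≤ (1 + σ) ^ 2 := by
      rw [← sq_abs]; exact pow_le_pow_left₀ (abs_nonneg _) (hf i) 2
    nlinarith
  have h4 : (N : ℝ) ^ 2 / 2 - σ * N ^ 2 ≤ ∑ k ∈ Ico K (N + 1), (k : ℝ) := by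
    have e1 : ∑ k ∈ range (N + 1), (k : ℝ) = N * (N + 1) / 2 := by
      have := Finset.sum_range_id_mul_two (N + 1)
      have h : ((∑ k ∈ range (N + 1), k : ℕ) : ℝ) * 2 = (N + 1) * N := by
        exact_mod_cast this
      push_cast at h
      linarith
    have e2 : ∑ k ∈ range K, (k : ℝ) ≤ K * K := by
      calc _ ≤ ∑ _k ∈ range K, (K : ℝ) := by
            apply Finset.sum_le_sum
            intro k hk; rw [mem_range] at hk; exact_mod_cast hk.le
        _ = _ := by simp
    rw [Finset.sum_Ico_eq_sub _ (by omega : K ≤ N + 1), e1]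
    have e3 : (K : ℝ) * K ≤ (σ * N) * N := by
      apply mul_le_mul hK (by exact_mod_cast hKN) (by positivity) (by positivity)
    nlinarith
  have h5 : ∀ k ∈ Ico K (N + 1), (k : ℝ) - N / 2 * (1 + 3 * σ - f k ^ 2)
      - N / 2 * (1 + 3 * σ - f (k - b) ^ 2) - N / 2 * (f k - f (k - b)) ^ 2
      ≤ k * (f k * f (k - b)) := by
    intro k hk
    rw [mem_Ico] at hk
    have hkN : (k : ℝ) ≤ N := by exact_mod_cast (by omega : k ≤ N)
    have hk0 : (0 : ℝ) ≤ k := by positivity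
    have p1 := mul_le_mul_of_nonneg_right hkN (h0 k)
    have p2 := mul_le_mul_of_nonneg_right hkN (h0 (k - b))
    have p3 := mul_le_mul_of_nonneg_right hkN (sq_nonneg (f k - f (k - b)))
    have p4 := mul_nonneg hσ0 hk0
    nlinarith
  refine le_trans ?_ (Finset.sum_le_sum h5)
  rw [Finset.sum_sub_distrib, Finset.sum_sub_distrib, Finset.sum_sub_distrib, ← mul_sum, ← mul_sum,
    ← mul_sum]
  have q1 := mul_le_mul_of_nonneg_left h1' (by positivity : (0 : ℝ) ≤ N / 2)
  have q2 := mul_le_mul_of_nonneg_left h2 (by positivity : (0 : ℝ) ≤ N / 2)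
  have q3 := mul_le_mul_of_nonneg_left h3 (by positivity : (0 : ℝ) ≤ N / 2)
  nlinarith

lemma sum_mul_cnv_le (hσ0 : 0 ≤ σ) (hσ : σ ≤ 1 / 1000) (hN : 1 ≤ σ * N)
    (hf : ∀ k, |f k| ≤ 1 + σ) (hK0 : 1 ≤ K) (hK : K ≤ σ * N)
    (hc : ∀ b, b ≤ K → N * (1 - 3 * σ) ≤ cnv f (N - b))
    (h2 : ∀ k, K ≤ k → k ≤ N →
      |k * (1 / (K : ℝ) * ∑ b ∈ range K, f (k - b)) + cnv f k| ≤ σ * N) :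
    ∑ k ∈ range (N + 1), f k * cnv f k ≤ -(N : ℝ) ^ 2 / 2 + 42 * σ * N ^ 2 := by
  have hM : (0 : ℝ) ≤ N := by positivity
  have hK0' : (0 : ℝ) < K := by exact_mod_cast hK0
  have hKN : K ≤ N := by
    have : (K : ℝ) ≤ N := by nlinarith
    exact_mod_cast this
  have hc0 : N * (1 - 3 * σ) ≤ cnv f N := by simpa using hc 0 (Nat.zero_le _)
  rw [← Finset.sum_range_add_sum_Ico _ (by omega : K ≤ N + 1)]
  have a1 : ∑ k ∈ range K, f k * cnv f k ≤ 2 * σ * N ^ 2 := by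
    calc _ ≤ ∑ _k ∈ range K, 2 * (N : ℝ) := by
          apply Finset.sum_le_sum
          intro k hk
          rw [mem_range] at hk
          have hk' : (k : ℝ) + 1 ≤ N := by exact_mod_cast (by omega : k + 1 ≤ N)
          refine (le_abs_self _).trans ?_
          rw [abs_mul]
          calc _ ≤ (1 + σ) * ((k + 1) * (1 + σ) ^ 2) :=
                mul_le_mul (hf k) (abs_cnv_le hσ0 hf k) (abs_nonneg _) (by linarith)
            _ ≤ (1 + σ) * (N * (1 + σ) ^ 2) := by gcongr
            _ = (1 + σ) ^ 3 * N := by ring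
            _ ≤ 2 * N := by
                gcongr
                calc (1 + σ) ^ 3 ≤ (1 + 1 / 1000) ^ 3 := by gcongr
                  _ ≤ 2 := by norm_num
      _ = K * (2 * N) := by simp
      _ ≤ (σ * N) * (2 * N) := by gcongr
      _ = _ := by ring
  have a2 : ∑ k ∈ Ico K (N + 1), f k * cnv f k
      ≤ ∑ k ∈ Ico K (N + 1),
          (2 * (σ * N) - 1 / (K : ℝ) * ∑ b ∈ range K, k * (f k * f (k - b))) := by
    apply Finset.sum_le_sum
    intro k hk
    rw [mem_Ico] at hk
    have := h2 k hk.1 (by omega)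
    have e : 1 / (K : ℝ) * ∑ b ∈ range K, k * (f k * f (k - b))
        = f k * (k * (1 / (K : ℝ) * ∑ b ∈ range K, f (k - b))) := by
      rw [← mul_sum, ← mul_sum]; ring
    rw [e]
    have h3 : f k * (k * (1 / (K : ℝ) * ∑ b ∈ range K, f (k - b)) + cnv f k) ≤ 2 * (σ * N) := by
      refine (le_abs_self _).trans ?_
      rw [abs_mul]
      exact mul_le_mul ((hf k).trans (by linarith)) this (abs_nonneg _) (by norm_num)
    linarith
  have a3 : ∑ k ∈ Ico K (N + 1), (2 * (σ * N) - 1 / (K : ℝ) * ∑ b ∈ range K, k * (f k * f (k - b)))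
      = (N + 1 - K : ℕ) * (2 * (σ * N)) - 1 / (K : ℝ) * ∑ b ∈ range K,
        ∑ k ∈ Ico K (N + 1), k * (f k * f (k - b)) := by
    rw [Finset.sum_sub_distrib, Finset.sum_const, Nat.card_Ico, nsmul_eq_mul, ← mul_sum,
      Finset.sum_comm]
  have a4 : (N : ℝ) ^ 2 / 2 - 37 * σ * N ^ 2 ≤ 1 / (K : ℝ) * ∑ b ∈ range K,
        ∑ k ∈ Ico K (N + 1), k * (f k * f (k - b)) := by
    rw [one_div, ← div_eq_inv_mul, le_div_iff₀ hK0']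
    calc _ = ∑ _b ∈ range K, ((N : ℝ) ^ 2 / 2 - 37 * σ * N ^ 2) := by
          rw [Finset.sum_const, card_range, nsmul_eq_mul]; ring
      _ ≤ _ := by
          apply Finset.sum_le_sum
          intro b hb
          rw [mem_range] at hb
          exact sum_mul_shift_ge hσ0 hσ hN hf hb.le hK hc0 (hc b hb.le)
  have a5 : ((N + 1 - K : ℕ) : ℝ) * (2 * (σ * N)) ≤ N * (2 * (σ * N)) := by
    gcongr
    omega
  rw [a3] at a2
  nlinarith

end Rigidity

section Rigidity

variable {f : ℕ → ℝ} {σ : ℝ} {N K : ℕ}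

/-- The pairs of naturals with sum at most `N`. -/
def triangle (N : ℕ) : Finset (ℕ × ℕ) :=
  ((range (N + 1)) ×ˢ (range (N + 1))).filter (fun p => p.1 + p.2 ≤ N)

lemma mem_triangle {N : ℕ} {p : ℕ × ℕ} : p ∈ triangle N ↔ p.1 + p.2 ≤ N := by
  simp only [triangle, mem_filter, mem_product, mem_range]
  constructor
  · exact fun h => h.2
  · intro h; exact ⟨⟨by omega, by omega⟩, h⟩

lemma sum_triangle (N : ℕ) (F : ℕ × ℕ → ℝ) :
    ∑ p ∈ triangle N, F p = ∑ k ∈ range (N + 1), ∑ p ∈ antidiagonal k, F p := by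
  rw [← Finset.sum_fiberwise_of_maps_to (g := fun p : ℕ × ℕ => p.1 + p.2) (t := range (N + 1))]
  · apply Finset.sum_congr rfl
    intro k hk
    rw [mem_range] at hk
    apply Finset.sum_congr _ (fun _ _ => rfl)
    ext p
    rw [mem_filter, mem_triangle, HasAntidiagonal.mem_antidiagonal]
    constructor
    · exact fun h => h.2
    · intro h; exact ⟨by omega, h⟩
  · intro p hp
    rw [mem_triangle] at hp
    rw [mem_range]; omega

lemma card_triangle_le (hσ0 : 0 ≤ σ) (hN : 1 ≤ σ * N) :
    ((triangle N).card : ℝ) ≤ N ^ 2 / 2 * ((1 + σ) * (1 + 2 * σ)) := by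
  have h1 : ((triangle N).card : ℝ) = ∑ p ∈ triangle N, (1 : ℝ) := by simp
  rw [h1, sum_triangle]
  simp only [Finset.sum_const, Finset.Nat.card_antidiagonal, nsmul_eq_mul, mul_one]
  have h2 : ∑ k ∈ range (N + 1), ((k + 1 : ℕ) : ℝ) = (N + 1) * (N + 2) / 2 := by
    have := Finset.sum_range_succ' (fun i : ℕ => (i : ℝ)) (N + 1)
    have h3 := Finset.sum_range_id_mul_two (N + 2)
    have h : ((∑ k ∈ range (N + 2), k : ℕ) : ℝ) * 2 = (N + 2) * (N + 1) := by
      exact_mod_cast h3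
    push_cast at h this ⊢
    linarith
  rw [h2]
  calc ((N : ℝ) + 1) * (N + 2) / 2 ≤ (N * (1 + σ)) * (N * (1 + 2 * σ)) / 2 := by
        gcongr <;> linarith
    _ = _ := by ring

lemma sum_triangle_sq_le (hσ0 : 0 ≤ σ) (hσ : σ ≤ 1 / 1000) (hN : 1 ≤ σ * N)
    (hf : ∀ k, |f k| ≤ 1 + σ)
    (hT : ∑ k ∈ range (N + 1), f k * cnv f k ≤ -(N : ℝ) ^ 2 / 2 + 42 * σ * N ^ 2) :
    ∑ p ∈ triangle N, (f (p.1 + p.2) + f p.1 * f p.2) ^ 2 ≤ 100 * σ * N ^ 2 := by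
  have h1 : ∑ p ∈ triangle N, f (p.1 + p.2) * (f p.1 * f p.2)
      = ∑ k ∈ range (N + 1), f k * cnv f k := by
    rw [sum_triangle]
    apply Finset.sum_congr rfl
    intro k _
    rw [cnv, mul_sum]
    apply Finset.sum_congr rfl
    intro p hp
    rw [HasAntidiagonal.mem_antidiagonal] at hp
    rw [hp]
  have hb : ∀ k, f k ^ 2 ≤ (1 + σ) ^ 2 := by
    intro i
    rw [← sq_abs]; exact pow_le_pow_left₀ (abs_nonneg _) (hf i) 2
  have h2 : ∑ p ∈ triangle N, (f (p.1 + p.2) + f p.1 * f p.2) ^ 2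
      ≤ ∑ p ∈ triangle N, ((1 + σ) ^ 2 + (1 + σ) ^ 4 + 2 * (f (p.1 + p.2) * (f p.1 * f p.2))) := by
    apply Finset.sum_le_sum
    intro p _
    have e1 := hb (p.1 + p.2)
    have e2 := mul_le_mul (hb p.1) (hb p.2) (sq_nonneg _) (by positivity)
    nlinarith
  refine h2.trans ?_
  rw [Finset.sum_add_distrib, ← mul_sum, h1, Finset.sum_const, nsmul_eq_mul]
  have h3 := card_triangle_le hσ0 hN
  have h4 : (1 + σ) ^ 2 + (1 + σ) ^ 4 ≤ 2 + 7 * σ := by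
    nlinarith [pow_nonneg hσ0 3, pow_nonneg hσ0 4]
  have h5 : (1 + σ) * (1 + 2 * σ) ≤ 1 + 4 * σ := by nlinarith
  have h6 : ((triangle N).card : ℝ) * ((1 + σ) ^ 2 + (1 + σ) ^ 4)
      ≤ N ^ 2 / 2 * (1 + 4 * σ) * (2 + 7 * σ) := by
    refine mul_le_mul (h3.trans ?_) h4 (by positivity) (by positivity)
    gcongr
  have h7 : (1 + 4 * σ) * (2 + 7 * σ) ≤ 2 + 16 * σ := by nlinarith
  have h8 : (N : ℝ) ^ 2 / 2 * (1 + 4 * σ) * (2 + 7 * σ) ≤ N ^ 2 / 2 * (2 + 16 * σ) := by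
    rw [mul_assoc]; gcongr
  have h9 : 0 ≤ σ * (N : ℝ) ^ 2 := by positivity
  linarith

lemma sum_box_sq_le (hσ0 : 0 ≤ σ) (hσ : σ ≤ 1 / 1000) (hf : ∀ k, |f k| ≤ 1 + σ) {n : ℕ} {Q : ℝ}
    (hn : 3 * n ≤ N)
    (hQ : ∑ p ∈ triangle N, (f (p.1 + p.2) + f p.1 * f p.2) ^ 2 ≤ Q) :
    ∑ p ∈ range n ×ˢ range n, (f (2 * p.1 + p.2) - f p.1 ^ 2 * f p.2) ^ 2 ≤ 5 * Q := by
  have hb : ∀ k, f k ^ 2 ≤ 3 / 2 := by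
    intro i
    have : f i ^ 2 ≤ (1 + σ) ^ 2 := by
      rw [← sq_abs]; exact pow_le_pow_left₀ (abs_nonneg _) (hf i) 2
    nlinarith
  set F : ℕ × ℕ → ℝ := fun p => (f (p.1 + p.2) + f p.1 * f p.2) ^ 2 with hF
  have hF0 : ∀ p, 0 ≤ F p := fun p => sq_nonneg _
  have h1 : ∑ p ∈ range n ×ˢ range n, F p ≤ Q := by
    refine le_trans (Finset.sum_le_sum_of_subset_of_nonneg ?_ fun _ _ _ => hF0 _) hQ
    intro p hp
    rw [mem_product, mem_range, mem_range] at hp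
    rw [mem_triangle]; omega
  have h2 : ∑ p ∈ range n ×ˢ range n, F (p.1, p.1 + p.2) ≤ Q := by
    refine le_trans (le_of_eq_of_le (Finset.sum_image
      (s := range n ×ˢ range n) (g := fun p : ℕ × ℕ => (p.1, p.1 + p.2)) ?_).symm
      (Finset.sum_le_sum_of_subset_of_nonneg ?_ fun _ _ _ => hF0 _)) hQ
    · rintro ⟨a, b⟩ _ ⟨c, d⟩ _ h
      simp only [Prod.mk.injEq] at h
      ext <;> simp <;> omega
    · intro q hq
      rw [mem_image] at hq
      obtain ⟨p, hp, rfl⟩ := hq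
      rw [mem_product, mem_range, mem_range] at hp
      rw [mem_triangle]
      show p.1 + (p.1 + p.2) ≤ N
      omega
  calc _ ≤ ∑ p ∈ range n ×ˢ range n, (2 * F (p.1, p.1 + p.2) + 3 * F p) := by
        apply Finset.sum_le_sum
        intro p _
        simp only [hF]
        rw [show 2 * p.1 + p.2 = p.1 + (p.1 + p.2) by ring]
        set A := f (p.1 + (p.1 + p.2)) + f p.1 * f (p.1 + p.2)
        set B := f (p.1 + p.2) + f p.1 * f p.2
        have e : f (p.1 + (p.1 + p.2)) - f p.1 ^ 2 * f p.2 = A - f p.1 * B := by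
          simp only [A, B]; ring
        rw [e]
        have := mul_le_mul_of_nonneg_right (hb p.1) (sq_nonneg B)
        nlinarith [sq_nonneg (A + f p.1 * B)]
    _ ≤ _ := by
        rw [Finset.sum_add_distrib, ← mul_sum, ← mul_sum]
        linarith

lemma abs_sum_progression_le {n w : ℕ} {θ : ℝ} (hθ : 0 < θ) (hwn : w + 2 * n ≤ N)
    (h1 : ∀ k, k ≤ N + 1 → |∑ i ∈ range k, f i| ≤ σ * N)
    (hb : ∑ i ∈ Ico 1 (N + 1), (f i - f (i - 1)) ^ 2 ≤ 56 * σ * N) :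
    |∑ s ∈ range n, f (2 * s + w)| ≤ σ * N + n * θ / 4 + 14 * σ * N / θ := by
  have e1 : ∑ s ∈ range n, f (2 * s + w) = 1 / 2 * ∑ i ∈ Ico w (w + 2 * n), f i
      - 1 / 2 * ∑ s ∈ range n, (f (2 * s + w + 1) - f (2 * s + w)) := by
    have : ∀ m : ℕ, ∑ i ∈ Ico w (w + 2 * m), f i
        = ∑ s ∈ range m, (f (2 * s + w) + f (2 * s + w + 1)) := by
      intro m
      induction m with
      | zero => simp
      | succ m ih =>
        rw [show w + 2 * (m + 1) = w + 2 * m + 1 + 1 by ring, Finset.sum_Ico_succ_top (by omega),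
          Finset.sum_Ico_succ_top (by omega), ih, Finset.sum_range_succ,
          show w + 2 * m = 2 * m + w by ring]
        ring
    rw [this, mul_sum, mul_sum, ← Finset.sum_sub_distrib]
    apply Finset.sum_congr rfl
    intro s _; ring
  have e2 : |∑ i ∈ Ico w (w + 2 * n), f i| ≤ 2 * (σ * N) := by
    rw [Finset.sum_Ico_eq_sub _ (by omega)]
    have a := h1 (w + 2 * n) (by omega)
    have b := h1 w (by omega)
    rw [abs_le] at *
    constructor <;> linarith
  have e3 : ∑ s ∈ range n, (f (2 * s + w + 1) - f (2 * s + w)) ^ 2 ≤ 56 * σ * N := by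
    refine le_trans (le_of_eq_of_le ?_ (Finset.sum_le_sum_of_subset_of_nonneg
      (s := (range n).image (fun s => 2 * s + w + 1)) (t := Ico 1 (N + 1))
      (f := fun i => (f i - f (i - 1)) ^ 2) ?_ fun _ _ _ => sq_nonneg _)) hb
    · rw [Finset.sum_image]
      · apply Finset.sum_congr rfl
        intro s _
        simp
      · intro a _ b _ hab
        simp only at hab
        omega
    · intro i hi
      rw [mem_image] at hi
      obtain ⟨s, hs, rfl⟩ := hi
      rw [mem_range] at hs
      rw [mem_Ico]; omega
  have e4 : |∑ s ∈ range n, (f (2 * s + w + 1) - f (2 * s + w))|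
      ≤ n * (θ / 2) + 1 / (2 * θ) * (56 * σ * N) := by
    calc _ ≤ ∑ s ∈ range n, |f (2 * s + w + 1) - f (2 * s + w)| := Finset.abs_sum_le_sum_abs _ _
      _ ≤ ∑ s ∈ range n, (θ / 2 + 1 / (2 * θ) * (f (2 * s + w + 1) - f (2 * s + w)) ^ 2) := by
          apply Finset.sum_le_sum
          intro s _
          set x := f (2 * s + w + 1) - f (2 * s + w)
          have : θ / 2 + 1 / (2 * θ) * x ^ 2 - |x| = 1 / (2 * θ) * (θ - |x|) ^ 2 := by
            rw [sub_sq θ |x|, sq_abs]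
            field_simp
            ring
          have h : 0 ≤ 1 / (2 * θ) * (θ - |x|) ^ 2 := by positivity
          linarith
      _ ≤ _ := by
          rw [Finset.sum_add_distrib, ← mul_sum, Finset.sum_const, card_range, nsmul_eq_mul]
          gcongr
  have e5 : 1 / (2 * θ) * (56 * σ * N) = 2 * (14 * σ * N / θ) := by field_simp; ring
  rw [e5] at e4
  rw [e1]
  rw [abs_le] at *
  constructor <;> linarith

end Rigidity

section Contradiction

variable {f : ℕ → ℝ} {σ : ℝ} {N K : ℕ}

lemma sum_box_model_ge (hσ0 : 0 ≤ σ) (hσ : σ ≤ 1 / 100000) (hN : 1 ≤ σ * N)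
    (hf : ∀ k, |f k| ≤ 1 + σ) (hc0 : N * (1 - 3 * σ) ≤ cnv f N) {n : ℕ} (hn3 : 3 * n ≤ N)
    (hn : N / 3 - σ * N ≤ (n : ℝ)) :
    (N : ℝ) ^ 2 / 9 - 9 * σ * N ^ 2 ≤ ∑ p ∈ range n ×ˢ range n, (f p.1 ^ 2 * f p.2) ^ 2 := by
  have hM : (0 : ℝ) ≤ N := by positivity
  have hn3' : 3 * (n : ℝ) ≤ N := by exact_mod_cast hn3
  have h1 := sum_defect_le hσ0 (by linarith) hN hf hc0 (s := range n)
    (Finset.range_subset_range.2 (by omega))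
  rw [Finset.sum_sub_distrib, Finset.sum_const, card_range, nsmul_eq_mul] at h1
  have h2 : (n : ℝ) - 8 * σ * N ≤ ∑ i ∈ range n, f i ^ 2 := by
    have : 0 ≤ (n : ℝ) * (3 * σ) := by positivity
    linarith
  have h3 : (n : ℝ) - 16 * σ * N ≤ ∑ i ∈ range n, f i ^ 4 := by
    have : ∑ i ∈ range n, (2 * f i ^ 2 - 1) ≤ ∑ i ∈ range n, f i ^ 4 :=
      Finset.sum_le_sum fun i _ => by nlinarith [sq_nonneg (f i ^ 2 - 1)]
    rw [Finset.sum_sub_distrib, ← mul_sum, Finset.sum_const, card_range, nsmul_eq_mul] at this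
    linarith
  have h4 : ∑ p ∈ range n ×ˢ range n, (f p.1 ^ 2 * f p.2) ^ 2
      = (∑ i ∈ range n, f i ^ 4) * ∑ i ∈ range n, f i ^ 2 := by
    rw [Finset.sum_product, Finset.sum_mul_sum]
    refine Finset.sum_congr rfl fun i _ => Finset.sum_congr rfl fun j _ => ?_
    ring
  rw [h4]
  have hpos : 0 ≤ (n : ℝ) - 16 * σ * N := by nlinarith
  have h5 := mul_le_mul h3 h2 (by nlinarith) (hpos.trans h3)
  refine le_trans ?_ h5
  have h6 : 0 ≤ σ * (N : ℝ) * (N - 3 * n) := mul_nonneg (by positivity) (by linarith)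
  have h7 : (N / 3 - σ * N) ^ 2 ≤ (n : ℝ) ^ 2 :=
    pow_le_pow_left₀ (by nlinarith) hn 2
  nlinarith [sq_nonneg (σ * (N : ℝ))]

lemma sum_box_cross_le (hσ0 : 0 ≤ σ) (hσ : σ ≤ 1 / 100000) (hN : 1 ≤ σ * N)
    (hf : ∀ k, |f k| ≤ 1 + σ) (hc0 : N * (1 - 3 * σ) ≤ cnv f N) {n : ℕ} (hn3 : 3 * n ≤ N) {R : ℝ}
    (hR : ∀ w, w < n → |∑ s ∈ range n, f (2 * s + w)| ≤ R) :
    ∑ p ∈ range n ×ˢ range n, f (2 * p.1 + p.2) * (f p.1 ^ 2 * f p.2)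
      ≤ 3 * σ * N ^ 2 + 2 * n * R := by
  have hM : (0 : ℝ) ≤ N := by positivity
  have hn3' : 3 * (n : ℝ) ≤ N := by exact_mod_cast hn3
  have hb : ∀ k, f k ^ 2 ≤ (1 + σ) ^ 2 := by
    intro i
    rw [← sq_abs]; exact pow_le_pow_left₀ (abs_nonneg _) (hf i) 2
  have he : ∀ i, 0 ≤ 1 + 3 * σ - f i ^ 2 := fun i => by nlinarith [hb i]
  have hff : ∀ i j, |f i * f j| ≤ 101 / 100 := by
    intro i j
    rw [abs_mul]
    have := mul_le_mul (hf i) (hf j) (abs_nonneg _) (by linarith)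
    nlinarith
  have h1 := sum_defect_le hσ0 (by linarith) hN hf hc0 (s := range n)
    (Finset.range_subset_range.2 (by omega))
  have e : ∑ p ∈ range n ×ˢ range n, f (2 * p.1 + p.2) * (f p.1 ^ 2 * f p.2)
      = (1 + 3 * σ) * ∑ w ∈ range n, f w * ∑ s ∈ range n, f (2 * s + w)
        + ∑ s ∈ range n, (1 + 3 * σ - f s ^ 2) * ∑ w ∈ range n, -(f w * f (2 * s + w)) := by
    have : ∑ w ∈ range n, f w * ∑ s ∈ range n, f (2 * s + w)
        = ∑ s ∈ range n, ∑ w ∈ range n, f w * f (2 * s + w) := by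
      rw [Finset.sum_comm]
      exact Finset.sum_congr rfl fun w _ => by rw [mul_sum]
    rw [this, Finset.sum_product, mul_sum, ← Finset.sum_add_distrib]
    refine Finset.sum_congr rfl fun s _ => ?_
    rw [mul_sum, mul_sum, ← Finset.sum_add_distrib]
    refine Finset.sum_congr rfl fun w _ => ?_
    ring
  rw [e]
  have t1 : ∑ s ∈ range n, (1 + 3 * σ - f s ^ 2) * ∑ w ∈ range n, -(f w * f (2 * s + w))
      ≤ ∑ s ∈ range n, (1 + 3 * σ - f s ^ 2) * (n * (101 / 100)) := by
    refine Finset.sum_le_sum fun s _ => mul_le_mul_of_nonneg_left ?_ (he s)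
    calc _ ≤ ∑ _w ∈ range n, (101 / 100 : ℝ) := Finset.sum_le_sum fun w _ =>
          (neg_le_abs _).trans (hff w _)
      _ = _ := by simp
  rw [← Finset.sum_mul] at t1
  have t2 : (∑ s ∈ range n, (1 + 3 * σ - f s ^ 2)) * (n * (101 / 100)) ≤ 3 * σ * N ^ 2 := by
    calc _ ≤ 8 * σ * N * (N / 3 * (101 / 100)) := by gcongr; linarith
      _ ≤ _ := by nlinarith [mul_nonneg hσ0 (sq_nonneg (N : ℝ))]
  have t3 : ∑ w ∈ range n, f w * ∑ s ∈ range n, f (2 * s + w) ≤ n * ((1 + σ) * R) := by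
    calc _ ≤ ∑ _w ∈ range n, (1 + σ) * R := by
          refine Finset.sum_le_sum fun w hw => ?_
          refine (le_abs_self _).trans ?_
          rw [abs_mul]
          exact mul_le_mul (hf w) (hR w (mem_range.1 hw)) (abs_nonneg _) (by linarith)
      _ = _ := by simp
  have t4 : (1 + 3 * σ) * ∑ w ∈ range n, f w * ∑ s ∈ range n, f (2 * s + w) ≤ 2 * n * R := by
    by_cases hn : n = 0
    · subst hn; simp
    have hR0 : 0 ≤ R := (abs_nonneg _).trans (hR 0 (by omega))
    calc _ ≤ (1 + 3 * σ) * (n * ((1 + σ) * R)) := by gcongr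
      _ = ((1 + 3 * σ) * (1 + σ)) * (n * R) := by ring
      _ ≤ 2 * (n * R) := by gcongr; nlinarith
      _ = _ := by ring
  linarith

/-- A nearly bounded sequence with small partial sums which satisfies the centred short-interval
form of Selberg's formula cannot stay close to `-1` on a terminal segment. -/
theorem not_terminal_deficit (hσ0 : 0 ≤ σ) (hσ : σ ≤ 1 / 100000) (hN : 1 ≤ σ * N)
    (hK0 : 1 ≤ K) (hK : K ≤ σ * N) (hf : ∀ k, |f k| ≤ 1 + σ)
    (h1 : ∀ k, k ≤ N + 1 → |∑ i ∈ range k, f i| ≤ σ * N)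
    (h2 : ∀ k, K ≤ k → k ≤ N →
      |k * (1 / (K : ℝ) * ∑ b ∈ range K, f (k - b)) + cnv f k| ≤ σ * N)
    (h3 : ∀ k, N ≤ k + 2 * K → k ≤ N → f k ≤ -1 + σ) : False := by
  have hM : (0 : ℝ) ≤ N := by positivity
  have hNpos : (0 : ℝ) < N := by
    rcases hM.eq_or_lt with h | h
    · rw [← h] at hN; norm_num at hN
    · exact h
  have hK0' : (0 : ℝ) < K := by exact_mod_cast hK0
  have hKN : 2 * K ≤ N := by
    have : 2 * (K : ℝ) ≤ N := by nlinarith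
    exact_mod_cast this
  have hc : ∀ b, b ≤ K → N * (1 - 3 * σ) ≤ cnv f (N - b) := by
    intro b hb
    have hk := h2 (N - b) (by omega) (by omega)
    have hmean : 1 / (K : ℝ) * ∑ c ∈ range K, f (N - b - c) ≤ -1 + σ := by
      rw [one_div, inv_mul_le_iff₀ hK0']
      calc _ ≤ ∑ _c ∈ range K, (-1 + σ) := by
            refine Finset.sum_le_sum fun c hc => h3 _ ?_ ?_
            · rw [mem_range] at hc; omega
            · omega
        _ = _ := by rw [Finset.sum_const, card_range, nsmul_eq_mul]
    have hcast : ((N - b : ℕ) : ℝ) = N - b := by push_cast [show b ≤ N by omega]; ring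
    have hbK : (b : ℝ) ≤ σ * N := le_trans (by exact_mod_cast hb) hK
    have hnb : (0 : ℝ) ≤ ((N - b : ℕ) : ℝ) := by positivity
    have h4 := mul_le_mul_of_nonneg_left hmean hnb
    have h5 := (abs_le.1 hk).1
    rw [hcast] at h4 h5
    have h6 : 0 ≤ (σ * N - b) * (1 - σ) := mul_nonneg (by linarith) (by linarith)
    nlinarith [mul_nonneg (mul_nonneg hσ0 hσ0) hM]
  have hc0 : N * (1 - 3 * σ) ≤ cnv f N := by simpa using hc 0 (by omega)
  have hσ' : σ ≤ 1 / 1000 := by linarith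
  have hT := sum_mul_cnv_le hσ0 hσ' hN hf hK0 hK hc h2
  have hQ := sum_triangle_sq_le hσ0 hσ' hN hf hT
  have hN1 : 1 ≤ N := by omega
  have hb := sum_shift_le hσ0 hσ' hN hf hN1 hc0 (hc 1 hK0)
  obtain ⟨n, hn3, hn4⟩ : ∃ n, 3 * n ≤ N ∧ N < 3 * n + 3 := ⟨N / 3, by omega, by omega⟩
  have hn3' : 3 * (n : ℝ) ≤ N := by exact_mod_cast hn3
  have hn : N / 3 - σ * N ≤ (n : ℝ) := by
    have : (N : ℝ) < 3 * n + 3 := by exact_mod_cast hn4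
    linarith
  have hbox := sum_box_sq_le hσ0 hσ' hf hn3 hQ
  have hmodel := sum_box_model_ge hσ0 hσ hN hf hc0 hn3 hn
  have hcross := sum_box_cross_le hσ0 hσ hN hf hc0 hn3
    (R := σ * N + n * (1 / 10) / 4 + 14 * σ * N / (1 / 10))
    (fun w hw => abs_sum_progression_le (by norm_num) (by omega) h1 hb)
  have hexp : ∑ p ∈ range n ×ˢ range n, (f p.1 ^ 2 * f p.2) ^ 2
      - 2 * ∑ p ∈ range n ×ˢ range n, f (2 * p.1 + p.2) * (f p.1 ^ 2 * f p.2)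
      ≤ ∑ p ∈ range n ×ˢ range n, (f (2 * p.1 + p.2) - f p.1 ^ 2 * f p.2) ^ 2 := by
    rw [mul_sum, ← Finset.sum_sub_distrib]
    exact Finset.sum_le_sum fun p _ => by nlinarith [sq_nonneg (f (2 * p.1 + p.2))]
  have hR : 2 * (n : ℝ) * (σ * N + n * (1 / 10) / 4 + 14 * σ * N / (1 / 10))
      ≤ 2 * (N / 3) * (σ * N + (N / 3) * (1 / 10) / 4 + 14 * σ * N / (1 / 10)) := by
    gcongr <;> linarith
  have hsq : 0 < (N : ℝ) ^ 2 := by positivity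
  have hs : σ * (N : ℝ) ^ 2 ≤ 1 / 100000 * (N : ℝ) ^ 2 := by gcongr
  nlinarith

end Contradiction

section Density

variable {g : ℕ → ℝ} {σ : ℝ} {N K : ℕ}

lemma cnv_sub_one (h : ℕ → ℝ) (k : ℕ) :
    cnv (fun i => h i - 1) k = cnv h k - 2 * ∑ i ∈ range (k + 1), h i + (k + 1) := by
  rw [cnv_eq_range, cnv_eq_range]
  have h1 : ∑ i ∈ range (k + 1), h (k - i) = ∑ i ∈ range (k + 1), h i := by
    have := Finset.sum_range_reflect h (k + 1)
    simpa using this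
  have h2 : ∑ i ∈ range (k + 1), (h i - 1) * (h (k - i) - 1)
      = ∑ i ∈ range (k + 1), h i * h (k - i) - ∑ i ∈ range (k + 1), h i
        - ∑ i ∈ range (k + 1), h (k - i) + ∑ _i ∈ range (k + 1), (1 : ℝ) := by
    rw [← Finset.sum_sub_distrib, ← Finset.sum_sub_distrib, ← Finset.sum_add_distrib]
    exact Finset.sum_congr rfl fun i _ => by ring
  rw [h2, h1]
  simp only [Finset.sum_const, card_range, nsmul_eq_mul, mul_one]
  push_cast
  ring

/-- A nonnegative sequence of mean one which satisfies the short-interval form of Selberg's formula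
cannot be close to `0` on a terminal segment. -/
theorem not_terminal_vanishing (hσ0 : 0 ≤ σ) (hσ : σ ≤ 1 / 10000000) (hN : 1 ≤ σ * N)
    (hK0 : 1 ≤ K) (hK : K ≤ σ * N) (hg0 : ∀ k, 0 ≤ g k)
    (h1 : ∀ k, k ≤ N + 1 → |∑ i ∈ range k, g i - k| ≤ σ * N)
    (h2 : ∀ k : ℕ, σ * N ≤ k → k ≤ N → g k ≤ 2 + σ)
    (h3 : ∀ k : ℕ, 3 * σ * N ≤ k → k ≤ N →
      |k * (1 / (K : ℝ) * ∑ b ∈ range K, g (k - b)) + cnv g k - 2 * k| ≤ σ * N)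
    (h4 : ∀ k, N ≤ k + 2 * K → k ≤ N → g k ≤ σ) : False := by
  have hM : (0 : ℝ) ≤ N := by positivity
  have hK0' : (0 : ℝ) < K := by exact_mod_cast hK0
  set h : ℕ → ℝ := fun k => if σ * N ≤ k ∧ k ≤ N then g k else 0 with hh
  have hh0 : ∀ k, 0 ≤ h k := by
    intro k; simp only [hh]; split_ifs; exacts [hg0 k, le_rfl]
  have hhg : ∀ k, h k ≤ g k := by
    intro k; simp only [hh]; split_ifs; exacts [le_rfl, hg0 k]
  have hh2 : ∀ k, h k ≤ 2 + σ := by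
    intro k; simp only [hh]; split_ifs with hk
    exacts [h2 k hk.1 hk.2, by linarith]
  have hhe : ∀ k : ℕ, σ * N ≤ k → k ≤ N → h k = g k := by
    intro k a b; simp only [hh]; rw [if_pos ⟨a, b⟩]
  have hhz : ∀ k : ℕ, (k : ℝ) < σ * N → h k = 0 := by
    intro k a; simp only [hh]; rw [if_neg]; intro c; linarith [c.1]
  have hf : ∀ k, |h k - 1| ≤ 1 + σ := by
    intro k; rw [abs_le]; constructor <;> linarith [hh0 k, hh2 k]
  have hsmall : ∀ k, k ≤ N + 1 → ∑ i ∈ range k, (g i - h i) ≤ 3 * σ * N := by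
    intro k hk
    set m := ⌈σ * (N : ℝ)⌉₊ with hm
    have hm1 : (m : ℝ) < σ * N + 1 := Nat.ceil_lt_add_one (by positivity)
    have hmN : m ≤ N + 1 := by
      have : (m : ℝ) ≤ ((N + 1 : ℕ) : ℝ) := by push_cast; nlinarith
      exact_mod_cast this
    have a : ∑ i ∈ range k, (g i - h i) ≤ ∑ i ∈ range m, g i := by
      rw [← Finset.sum_filter_add_sum_filter_not (range k) (fun i => i < m)]
      have b1 : ∑ i ∈ (range k).filter (fun i => ¬ i < m), (g i - h i) = 0 := by
        refine Finset.sum_eq_zero fun i hi => ?_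
        rw [mem_filter, mem_range] at hi
        rw [hhe i ((Nat.le_ceil _).trans (by exact_mod_cast not_lt.1 hi.2)) (by omega), sub_self]
      rw [b1, add_zero]
      calc _ ≤ ∑ i ∈ (range k).filter (fun i => i < m), g i :=
            Finset.sum_le_sum fun i _ => by linarith [hh0 i]
        _ ≤ _ := by
            refine Finset.sum_le_sum_of_subset_of_nonneg ?_ fun i _ _ => hg0 i
            intro i hi
            rw [mem_filter] at hi
            exact mem_range.2 hi.2
    have b := (abs_le.1 (h1 m hmN)).2
    linarith
  have hsum : ∀ k, k ≤ N + 1 → |∑ i ∈ range k, h i - k| ≤ 4 * σ * N := by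
    intro k hk
    have a := hsmall k hk
    have a' : 0 ≤ ∑ i ∈ range k, (g i - h i) :=
      Finset.sum_nonneg fun i _ => sub_nonneg.2 (hhg i)
    have b := h1 k hk
    rw [Finset.sum_sub_distrib] at a a'
    rw [abs_le] at *
    constructor <;> nlinarith
  have hmain : ∀ k, K ≤ k → k ≤ N →
      |k * (1 / (K : ℝ) * ∑ b ∈ range K, (h (k - b) - 1)) + cnv (fun i => h i - 1) k|
        ≤ 30 * σ * N := by
    intro k hKk hkN
    by_cases hk : (k : ℝ) < 3 * σ * N
    · have a1 := abs_cnv_le hσ0 hf k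
      have a2 : |1 / (K : ℝ) * ∑ b ∈ range K, (h (k - b) - 1)| ≤ 1 + σ := by
        rw [abs_mul, abs_of_pos (by positivity), one_div, inv_mul_le_iff₀ hK0']
        calc _ ≤ ∑ b ∈ range K, |h (k - b) - 1| := Finset.abs_sum_le_sum_abs _ _
          _ ≤ ∑ _b ∈ range K, (1 + σ) := Finset.sum_le_sum fun b _ => hf _
          _ = _ := by rw [Finset.sum_const, card_range, nsmul_eq_mul]
      have a3 : |(k : ℝ) * (1 / (K : ℝ) * ∑ b ∈ range K, (h (k - b) - 1))|
          ≤ 3 * σ * N * (1 + σ) := by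
        rw [abs_mul, abs_of_nonneg (by positivity : (0 : ℝ) ≤ k)]
        exact mul_le_mul hk.le a2 (abs_nonneg _) (by positivity)
      have a4 : ((k : ℝ) + 1) * (1 + σ) ^ 2 ≤ 4 * σ * N * (1 + σ) ^ 2 := by
        gcongr; linarith
      have a5 : (1 + σ) ^ 2 ≤ 2 := by nlinarith
      have a6 : 0 ≤ σ * (N : ℝ) := by positivity
      refine (abs_add_le _ _).trans ?_
      nlinarith
    · push Not at hk
      have b1 := h3 k hk hkN
      have b2 := hsum (k + 1) (by omega)
      have b3 := hsmall (k + 1) (by omega)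
      have hmean : ∑ b ∈ range K, (h (k - b) - 1) = ∑ b ∈ range K, g (k - b) - K := by
        rw [Finset.sum_sub_distrib, Finset.sum_const, card_range, nsmul_eq_mul, mul_one]
        congr 1
        refine Finset.sum_congr rfl fun b hb => ?_
        rw [mem_range] at hb
        refine hhe _ ?_ (by omega)
        have : (b : ℝ) ≤ K := by exact_mod_cast hb.le
        push_cast [show b ≤ k by omega]
        have := mul_nonneg hσ0 hM
        linarith
      have c1 : cnv h k ≤ cnv g k := by
        unfold cnv
        exact Finset.sum_le_sum fun p _ => mul_le_mul (hhg _) (hhg _) (hh0 _) (hg0 _)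
      have c2 : cnv g k - cnv h k ≤ 2 * ((2 + σ) * (3 * σ * N)) := by
        have e : ∀ p ∈ antidiagonal k, g p.1 * g p.2 - h p.1 * h p.2
            ≤ (2 + σ) * ((g p.1 - h p.1) + (g p.2 - h p.2)) := by
          intro p hp
          rw [HasAntidiagonal.mem_antidiagonal] at hp
          have hsm := mul_nonneg hσ0 hM
          have hpk : (p.1 : ℝ) + p.2 = k := by exact_mod_cast hp
          by_cases u : (p.1 : ℝ) < σ * N
          · have v : σ * N ≤ (p.2 : ℝ) := by linarith
            rw [hhz _ u, hhe _ v (by omega)]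
            nlinarith [h2 _ v (by omega), hg0 p.1]
          · push Not at u
            rw [hhe _ u (by omega)]
            by_cases v : (p.2 : ℝ) < σ * N
            · rw [hhz _ v]
              nlinarith [h2 _ u (by omega), hg0 p.2]
            · push Not at v
              rw [hhe _ v (by omega)]
              simp
        have e2 : ∑ p ∈ antidiagonal k, (2 + σ) * ((g p.1 - h p.1) + (g p.2 - h p.2))
            = 2 * ((2 + σ) * ∑ i ∈ range (k + 1), (g i - h i)) := by
          rw [← mul_sum, Finset.sum_add_distrib,
            Finset.Nat.sum_antidiagonal_eq_sum_range_succ (fun i _ => g i - h i) k,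
            Finset.Nat.sum_antidiagonal_eq_sum_range_succ (fun _ j => g j - h j) k]
          have := Finset.sum_range_reflect (fun i => g i - h i) (k + 1)
          simp only [Nat.add_sub_cancel] at this
          rw [this]
          ring
        have e3 : cnv g k - cnv h k ≤ 2 * ((2 + σ) * ∑ i ∈ range (k + 1), (g i - h i)) := by
          rw [← e2]
          unfold cnv
          rw [← Finset.sum_sub_distrib]
          exact Finset.sum_le_sum e
        refine e3.trans ?_
        gcongr
      rw [hmean, cnv_sub_one]
      have d : (k : ℝ) * (1 / (K : ℝ) * (∑ b ∈ range K, g (k - b) - K))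
          = k * (1 / (K : ℝ) * ∑ b ∈ range K, g (k - b)) - k := by
        field_simp
      rw [d]
      set m := (k : ℝ) * (1 / (K : ℝ) * ∑ b ∈ range K, g (k - b))
      have a6 : 0 ≤ σ * (N : ℝ) := by positivity
      have c3 : 2 * ((2 + σ) * (3 * σ * N)) ≤ 13 * σ * N := by nlinarith
      push_cast at b2
      rw [abs_le] at *
      constructor <;> linarith [b1.1, b1.2, b2.1, b2.2]
  refine not_terminal_deficit (f := fun k => h k - 1) (σ := 30 * σ) (N := N) (K := K)
    (by positivity) (by linarith) (by linarith) hK0 (by nlinarith)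
    (fun k => (hf k).trans (by linarith)) ?_ hmain ?_
  · intro k hk
    rw [Finset.sum_sub_distrib, Finset.sum_const, card_range, nsmul_eq_mul, mul_one]
    have := hsum k hk
    have a6 : 0 ≤ σ * (N : ℝ) := by positivity
    linarith
  · intro k hk hkN
    have := hhg k
    have := h4 k hk hkN
    linarith

end Density

/-- The sum of `f` over the `K` indices ending at `l`. -/
def boxSum (K : ℕ) (f : ℕ → ℝ) (l : ℕ) : ℝ := ∑ b ∈ range K, if b ≤ l then f (l - b) else 0

lemma boxSum_nonneg {K : ℕ} {f : ℕ → ℝ} (hf : ∀ k, 0 ≤ f k) (l : ℕ) : 0 ≤ boxSum K f l :=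
  Finset.sum_nonneg fun b _ => by split_ifs; exacts [hf _, le_rfl]

lemma mk_boxSum (K : ℕ) (f : ℕ → ℝ) :
    PowerSeries.mk (boxSum K f) = (∑ b ∈ range K, PowerSeries.X ^ b) * PowerSeries.mk f := by
  ext k
  rw [PowerSeries.coeff_mk, boxSum, Finset.sum_mul, map_sum]
  refine Finset.sum_congr rfl fun b _ => ?_
  rw [PowerSeries.coeff_X_pow_mul', PowerSeries.coeff_mk]

lemma mk_cnv (f : ℕ → ℝ) :
    PowerSeries.mk (cnv f) = PowerSeries.mk f * PowerSeries.mk f := by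
  ext k
  rw [PowerSeries.coeff_mk, cnv, PowerSeries.coeff_mul]
  simp only [PowerSeries.coeff_mk]

lemma cnv_boxSum (K : ℕ) (f : ℕ → ℝ) : cnv (boxSum K f) = boxSum K (boxSum K (cnv f)) := by
  have : PowerSeries.mk (cnv (boxSum K f)) = PowerSeries.mk (boxSum K (boxSum K (cnv f))) := by
    rw [mk_cnv, mk_boxSum, mk_boxSum, mk_boxSum, mk_cnv]
    ring
  funext k
  have h := congrArg (PowerSeries.coeff k) this
  rwa [PowerSeries.coeff_mk, PowerSeries.coeff_mk] at h

lemma boxSum_eq_of_le {K l : ℕ} (f : ℕ → ℝ) (h : K ≤ l + 1) :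
    boxSum K f l = ∑ b ∈ range K, f (l - b) :=
  Finset.sum_congr rfl fun b hb => by rw [mem_range] at hb; rw [if_pos (by omega)]

lemma boxSum_eq_sum_Ico {K l : ℕ} (f : ℕ → ℝ) (h : K ≤ l + 1) :
    boxSum K f l = ∑ j ∈ Ico (l + 1 - K) (l + 1), f j := by
  induction K with
  | zero => simp [boxSum]
  | succ K ih =>
    have h1 := ih (by omega)
    rw [boxSum_eq_of_le _ h, Finset.sum_range_succ, ← boxSum_eq_of_le _ (by omega), h1,
      show l + 1 - (K + 1) = l - K by omega,
      Finset.sum_eq_sum_Ico_succ_bot (by omega : l - K < l + 1),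
      show l - K + 1 = l + 1 - K by omega, add_comm]

lemma sum_range_boxSum (K : ℕ) (f : ℕ → ℝ) (k : ℕ) :
    ∑ i ∈ range k, boxSum K f i = ∑ b ∈ range K, ∑ i ∈ range (k - b), f i := by
  unfold boxSum
  rw [Finset.sum_comm]
  refine Finset.sum_congr rfl fun b _ => ?_
  rw [← Finset.sum_filter]
  refine Finset.sum_bij (fun i _ => i - b) ?_ ?_ ?_ ?_
  · intro i hi
    rw [mem_filter, mem_range] at hi
    rw [mem_range]; omega
  · intro i hi j hj hij
    rw [mem_filter, mem_range] at hi hj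
    omega
  · intro j hj
    rw [mem_range] at hj
    exact ⟨j + b, by rw [mem_filter, mem_range]; omega, by omega⟩
  · intro i _; rfl

/-- The mass `primeSum y` of the `k`-th cell of width `κ`. -/
noncomputable def cellSum (y : ℕ) (κ : ℝ) (k : ℕ) : ℝ := primeSum y (k * κ) ((k + 1) * κ)

lemma primeSum_add (y : ℕ) {r s t : ℝ} (h1 : r ≤ s) (h2 : s ≤ t) :
    primeSum y r t = primeSum y r s + primeSum y s t := win_union h1 h2 _

lemma cellSum_nonneg (y : ℕ) (κ : ℝ) (k : ℕ) : 0 ≤ cellSum y κ k := primeSum_nonneg _ _ _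

lemma primeSum_self (y : ℕ) (s : ℝ) : primeSum y s s = 0 := by simp [primeSum, win]

lemma sum_Ico_cellSum (y : ℕ) {κ : ℝ} (hκ : 0 ≤ κ) {a b : ℕ} (h : a ≤ b) :
    ∑ k ∈ Ico a b, cellSum y κ k = primeSum y (a * κ) (b * κ) := by
  induction b, h using Nat.le_induction with
  | base => simp [primeSum_self]
  | succ b hab ih =>
    rw [Finset.sum_Ico_succ_top hab, ih, cellSum, ← primeSum_add]
    · push_cast; rfl
    · gcongr
    · gcongr; linarith

lemma sum_range_cellSum (y : ℕ) {κ : ℝ} (hκ : 0 ≤ κ) (b : ℕ) :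
    ∑ k ∈ range b, cellSum y κ k = primeSum y 0 (b * κ) := by
  have := sum_Ico_cellSum y hκ (Nat.zero_le b)
  rw [Finset.range_eq_Ico, this]
  simp

lemma boxSum_cellSum (y : ℕ) {κ : ℝ} (hκ : 0 ≤ κ) {K l : ℕ} (h : K ≤ l + 1) :
    boxSum K (cellSum y κ) l = primeSum y ((l + 1 - K) * κ) ((l + 1) * κ) := by
  rw [boxSum_eq_sum_Ico _ h, sum_Ico_cellSum y hκ (by omega)]
  push_cast [h]
  rfl

/-- The index of the cell of width `κ` containing `log n`. -/
noncomputable def cellIdx (κ : ℝ) (n : ℕ) : ℕ := ⌊Real.log n / κ⌋₊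

lemma cellIdx_eq {κ : ℝ} (hκ : 0 < κ) (n k : ℕ) :
    cellIdx κ n = k ↔ k * κ ≤ Real.log n ∧ Real.log n < (k + 1) * κ := by
  rw [cellIdx, Nat.floor_eq_iff (div_nonneg (Real.log_natCast_nonneg n) hκ.le), le_div_iff₀ hκ,
    div_lt_iff₀ hκ]

lemma cellSum_eq (y : ℕ) {κ T : ℝ} (hκ : 0 < κ) {k : ℕ} (hk : (k + 1) * κ ≤ T) :
    cellSum y κ k = ∑ n ∈ (win 0 T).filter (fun n => cellIdx κ n = k), cw y n := by
  unfold cellSum primeSum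
  refine Finset.sum_congr ?_ fun _ _ => rfl
  ext n
  rw [mem_filter, mem_win, mem_win, cellIdx_eq hκ]
  constructor
  · rintro ⟨h1, h2, h3⟩
    exact ⟨⟨h1, Real.log_natCast_nonneg n, h3.trans_le hk⟩, h2, h3⟩
  · rintro ⟨⟨h1, _, _⟩, h2, h3⟩
    exact ⟨h1, h2, h3⟩

lemma boxSum_cnv_cellSum (y : ℕ) {κ T : ℝ} (hκ : 0 < κ) {K l : ℕ} (h : K ≤ l + 1)
    (hT : (l + 1) * κ ≤ T) :
    boxSum K (cnv (cellSum y κ)) l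
      = ∑ q ∈ (win 0 T ×ˢ win 0 T).filter (fun q => l + 1 - K ≤ cellIdx κ q.1 + cellIdx κ q.2 ∧
          cellIdx κ q.1 + cellIdx κ q.2 < l + 1), cw y q.1 * cw y q.2 := by
  rw [boxSum_eq_sum_Ico _ h, ← Finset.sum_fiberwise_of_maps_to
    (g := fun q : ℕ × ℕ => cellIdx κ q.1 + cellIdx κ q.2) (t := Ico (l + 1 - K) (l + 1))]
  · refine Finset.sum_congr rfl fun j hj => ?_
    rw [mem_Ico] at hj
    refine Eq.trans ?_ (Finset.sum_fiberwise_of_maps_to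
      (g := fun q : ℕ × ℕ => (cellIdx κ q.1, cellIdx κ q.2)) (t := antidiagonal j) ?_ _)
    · rw [cnv]
      refine Finset.sum_congr rfl fun p hp => ?_
      rw [HasAntidiagonal.mem_antidiagonal] at hp
      have hb : ∀ i : ℕ, i ≤ j → ((i : ℝ) + 1) * κ ≤ T := by
        intro i hi
        refine le_trans ?_ hT
        have : (i : ℝ) ≤ l := by exact_mod_cast (show i ≤ l by omega)
        gcongr
      rw [cellSum_eq y hκ (hb p.1 (by omega)), cellSum_eq y hκ (hb p.2 (by omega)),
        Finset.sum_mul_sum, ← Finset.sum_product']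
      refine Finset.sum_congr ?_ fun _ _ => rfl
      ext q
      simp only [mem_filter, mem_product, Prod.ext_iff]
      constructor
      · rintro ⟨⟨a1, a2⟩, b1, b2⟩
        refine ⟨⟨⟨⟨a1, b1⟩, ?_⟩, ?_⟩, a2, b2⟩ <;> omega
      · rintro ⟨⟨⟨⟨a1, b1⟩, _⟩, _⟩, a2, b2⟩
        exact ⟨⟨a1, a2⟩, b1, b2⟩
    · intro q hq
      simp only [mem_filter] at hq
      rw [HasAntidiagonal.mem_antidiagonal]
      exact hq.2
  · intro q hq
    rw [mem_filter] at hq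
    rw [mem_Ico]
    exact hq.2

lemma cellIdx_bounds {κ : ℝ} (hκ : 0 < κ) (n : ℕ) :
    cellIdx κ n * κ ≤ Real.log n ∧ Real.log n < (cellIdx κ n + 1) * κ :=
  (cellIdx_eq hκ n _).1 rfl

lemma boxSum_cnv_cellSum_le (y : ℕ) {κ : ℝ} (hκ : 0 < κ) {K l : ℕ} (h : K ≤ l + 1) :
    boxSum K (cnv (cellSum y κ)) l ≤ pairSum y ((l + 1 - K) * κ) ((l + 2) * κ) := by
  rw [boxSum_cnv_cellSum y hκ h (T := (l + 2) * κ) (by gcongr; norm_num), pairSum]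
  refine Finset.sum_le_sum_of_subset_of_nonneg ?_
    fun q _ _ => mul_nonneg (cw_nonneg _ _) (cw_nonneg _ _)
  intro q hq
  rw [mem_filter] at hq ⊢
  obtain ⟨hq1, hq2, hq3⟩ := hq
  have b1 := cellIdx_bounds hκ q.1
  have b2 := cellIdx_bounds hκ q.2
  have c1 : ((l : ℝ) + 1 - K) ≤ cellIdx κ q.1 + cellIdx κ q.2 := by
    have : ((l + 1 - K : ℕ) : ℝ) ≤ ((cellIdx κ q.1 + cellIdx κ q.2 : ℕ) : ℝ) := by
      exact_mod_cast hq2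
    push_cast [h] at this
    exact this
  have c2 : (cellIdx κ q.1 : ℝ) + cellIdx κ q.2 ≤ l := by
    exact_mod_cast Nat.lt_succ_iff.1 hq3
  refine ⟨hq1, ?_, ?_⟩ <;> nlinarith

lemma le_boxSum_cnv_cellSum (y : ℕ) {κ : ℝ} (hκ : 0 < κ) {K l : ℕ} (h : K ≤ l + 1) :
    pairSum y ((l + 2 - K) * κ) ((l + 1) * κ) ≤ boxSum K (cnv (cellSum y κ)) l := by
  rw [boxSum_cnv_cellSum y hκ h le_rfl, pairSum]
  refine Finset.sum_le_sum_of_subset_of_nonneg ?_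
    fun q _ _ => mul_nonneg (cw_nonneg _ _) (cw_nonneg _ _)
  intro q hq
  rw [mem_filter] at hq ⊢
  obtain ⟨hq1, hq2, hq3⟩ := hq
  have b1 := cellIdx_bounds hκ q.1
  have b2 := cellIdx_bounds hκ q.2
  have c2 : ((cellIdx κ q.1 : ℝ) + cellIdx κ q.2) < l + 1 := by
    by_contra hc
    push Not at hc
    nlinarith
  have c1 : ((l : ℝ) - K) < cellIdx κ q.1 + cellIdx κ q.2 := by
    by_contra hc
    push Not at hc
    nlinarith
  refine ⟨hq1, ?_, by exact_mod_cast c2⟩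
  have : (l : ℝ) < ((cellIdx κ q.1 + cellIdx κ q.2 + K : ℕ) : ℝ) := by push_cast; linarith
  have : l < cellIdx κ q.1 + cellIdx κ q.2 + K := by exact_mod_cast this
  omega

lemma sum_cw_log_mem (y : ℕ) (s t : ℝ) :
    s * primeSum y s t ≤ ∑ n ∈ win s t, cw y n * Real.log n ∧
      ∑ n ∈ win s t, cw y n * Real.log n ≤ t * primeSum y s t := by
  unfold primeSum
  rw [mul_sum, mul_sum]
  constructor
  · refine Finset.sum_le_sum fun n hn => ?_
    rw [mem_win] at hn
    exact (mul_le_mul_of_nonneg_right hn.2.1 (cw_nonneg y n)).trans (mul_comm _ _).le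
  · refine Finset.sum_le_sum fun n hn => ?_
    rw [mem_win] at hn
    exact (mul_comm _ _).trans_le (mul_le_mul_of_nonneg_right hn.2.2.le (cw_nonneg y n))

lemma win_subset {r s t u : ℝ} (h1 : r ≤ s) (h2 : t ≤ u) : win s t ⊆ win r u := by
  intro n hn
  rw [mem_win] at hn ⊢
  exact ⟨hn.1, h1.trans hn.2.1, hn.2.2.trans_le h2⟩

lemma pairSum_nonneg (y : ℕ) (s t : ℝ) : 0 ≤ pairSum y s t :=
  Finset.sum_nonneg fun _ _ => mul_nonneg (cw_nonneg _ _) (cw_nonneg _ _)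

section Cells

variable {y N K : ℕ} {s σ κ U : ℝ}

lemma cnv_const_mul (c : ℝ) (f : ℕ → ℝ) (k : ℕ) : cnv (fun i => c * f i) k = c ^ 2 * cnv f k := by
  unfold cnv
  rw [mul_sum]
  exact Finset.sum_congr rfl fun p _ => by ring

lemma boxSum_cell_upper (hκ : 0 < κ) (hU : U = (N + 2) * κ)
    (hB : ∀ u ρ, s / 2 * U ≤ u → u ≤ U → (K - 1) * κ ≤ ρ → ρ ≤ (K + 1) * κ →
      |selSum y (u - ρ) u - 2 * u * ρ| ≤ σ * U * ρ)
    {l : ℕ} (hl : s / 2 * (N + 2) ≤ l) (hlN : l ≤ N) (hKl : K ≤ l + 1) :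
    ((l : ℝ) + 1 - K) * (boxSum K (cellSum y κ) l / κ) ≤ 2 * (l + 1) * K + σ * (N + 2) * K := by
  have hlN' : (l : ℝ) ≤ N := by exact_mod_cast hlN
  have h1 := (abs_le.1 (hB ((l + 1) * κ) (K * κ) (by rw [hU]; nlinarith)
    (by rw [hU]; gcongr; linarith)
    (by nlinarith) (by nlinarith))).2
  rw [boxSum_cellSum y hκ.le hKl]
  have h2 := (sum_cw_log_mem y ((l + 1 - K) * κ) ((l + 1) * κ)).1
  rw [show ((l : ℝ) + 1) * κ - K * κ = (l + 1 - K) * κ by ring, selSum_eq] at h1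
  have h3 := pairSum_nonneg y ((l + 1 - K) * κ) ((l + 1) * κ)
  set B := primeSum y ((l + 1 - K) * κ) ((l + 1) * κ)
  have h4 : ((l : ℝ) + 1 - K) * κ * B ≤ (2 * (l + 1) * K + σ * (N + 2) * K) * κ * κ := by
    rw [hU] at h1; nlinarith
  rw [← mul_div_assoc, div_le_iff₀ hκ]
  have h5 : ((l : ℝ) + 1 - K) * B * κ ≤ (2 * (l + 1) * K + σ * (N + 2) * K) * κ * κ := by linarith
  exact le_of_mul_le_mul_right h5 hκ

lemma boxSum_cnv_upper (hκ : 0 < κ) (hU : U = (N + 2) * κ)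
    (hB : ∀ u ρ, s / 2 * U ≤ u → u ≤ U → (K - 1) * κ ≤ ρ → ρ ≤ (K + 1) * κ →
      |selSum y (u - ρ) u - 2 * u * ρ| ≤ σ * U * ρ)
    {l : ℕ} (hl : s / 2 * (N + 2) ≤ l) (hlN : l ≤ N) (hKl : K ≤ l + 1) :
    boxSum K (cnv (cellSum y κ)) l / κ ^ 2 + (l + 1 - K) * (boxSum K (cellSum y κ) l / κ)
      ≤ 2 * (l + 2) * (K + 1) + σ * (N + 2) * (K + 1) := by
  have hlN' : (l : ℝ) ≤ N := by exact_mod_cast hlN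
  have h1 := (abs_le.1 (hB ((l + 2) * κ) ((K + 1) * κ) (by rw [hU]; nlinarith)
    (by rw [hU]; gcongr) (by nlinarith) le_rfl)).2
  have h2 := boxSum_cnv_cellSum_le y hκ hKl
  rw [boxSum_cellSum y hκ.le hKl]
  have h3 := (sum_cw_log_mem y ((l + 1 - K) * κ) ((l + 1) * κ)).1
  have h4 : ∑ n ∈ win ((l + 1 - K) * κ) ((l + 1) * κ), cw y n * Real.log n
      ≤ ∑ n ∈ win ((l + 1 - K) * κ) ((l + 2) * κ), cw y n * Real.log n :=
    Finset.sum_le_sum_of_subset_of_nonneg (win_subset le_rfl (by gcongr; norm_num))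
      fun n _ _ => mul_nonneg (cw_nonneg y n) (Real.log_natCast_nonneg n)
  rw [show ((l : ℝ) + 2) * κ - (K + 1) * κ = (l + 1 - K) * κ by ring, selSum_eq] at h1
  set B := primeSum y ((l + 1 - K) * κ) ((l + 1) * κ)
  set S := boxSum K (cnv (cellSum y κ)) l
  have e : S / κ ^ 2 + ((l : ℝ) + 1 - K) * (B / κ) = (S + (l + 1 - K) * κ * B) / κ ^ 2 := by
    field_simp
  rw [e, div_le_iff₀ (by positivity)]
  rw [hU] at h1
  nlinarith

lemma boxSum_cnv_lower (hκ : 0 < κ) (hU : U = (N + 2) * κ)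
    (hB : ∀ u ρ, s / 2 * U ≤ u → u ≤ U → (K - 1) * κ ≤ ρ → ρ ≤ (K + 1) * κ →
      |selSum y (u - ρ) u - 2 * u * ρ| ≤ σ * U * ρ)
    {l : ℕ} (hl : s / 2 * (N + 2) ≤ l) (hlN : l ≤ N) (hKl : K ≤ l + 1) :
    2 * (l + 1) * (K - 1) - σ * (N + 2) * (K - 1)
      ≤ boxSum K (cnv (cellSum y κ)) l / κ ^ 2 + (l + 1) * (boxSum K (cellSum y κ) l / κ) := by
  have hlN' : (l : ℝ) ≤ N := by exact_mod_cast hlN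
  have h1 := (abs_le.1 (hB ((l + 1) * κ) ((K - 1) * κ) (by rw [hU]; nlinarith)
    (by rw [hU]; gcongr; linarith) le_rfl (by nlinarith))).1
  have h2 := le_boxSum_cnv_cellSum y hκ hKl
  rw [boxSum_cellSum y hκ.le hKl]
  have h3 := (sum_cw_log_mem y ((l + 1 - K) * κ) ((l + 1) * κ)).2
  have h4 : ∑ n ∈ win ((l + 2 - K) * κ) ((l + 1) * κ), cw y n * Real.log n
      ≤ ∑ n ∈ win ((l + 1 - K) * κ) ((l + 1) * κ), cw y n * Real.log n :=
    Finset.sum_le_sum_of_subset_of_nonneg (win_subset (by gcongr; norm_num) le_rfl)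
      fun n _ _ => mul_nonneg (cw_nonneg y n) (Real.log_natCast_nonneg n)
  rw [show ((l : ℝ) + 1) * κ - (K - 1) * κ = (l + 2 - K) * κ by ring, selSum_eq] at h1
  set B := primeSum y ((l + 1 - K) * κ) ((l + 1) * κ)
  set S := boxSum K (cnv (cellSum y κ)) l
  have e : S / κ ^ 2 + ((l : ℝ) + 1) * (B / κ) = (S + (l + 1) * κ * B) / κ ^ 2 := by
    field_simp
  rw [e, le_div_iff₀ (by positivity)]
  rw [hU] at h1
  nlinarith

lemma abs_sum_boxSum_cell_le (hκ : 0 < κ) (hU : U = (N + 2) * κ) (hK0 : 1 ≤ K)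
    (hA : ∀ v, 0 ≤ v → |primeSum y 0 v - v| ≤ σ * U) (k : ℕ) :
    |∑ i ∈ range k, 1 / (K * κ) * boxSum K (cellSum y κ) i - k| ≤ σ * (N + 2) + K := by
  have hK0' : (0 : ℝ) < K := by exact_mod_cast hK0
  rw [← mul_sum, sum_range_boxSum]
  have e : 1 / ((K : ℝ) * κ) * ∑ b ∈ range K, ∑ i ∈ range (k - b), cellSum y κ i - k
      = 1 / (K * κ) * ∑ b ∈ range K, (primeSum y 0 ((k - b : ℕ) * κ) - k * κ) := by
    rw [Finset.sum_sub_distrib, Finset.sum_const, card_range, nsmul_eq_mul]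
    simp only [sum_range_cellSum y hκ.le]
    field_simp
  rw [e, abs_mul, abs_of_pos (by positivity), one_div, inv_mul_le_iff₀ (by positivity)]
  calc _ ≤ ∑ b ∈ range K, |primeSum y 0 ((k - b : ℕ) * κ) - k * κ| := Finset.abs_sum_le_sum_abs _ _
    _ ≤ ∑ _b ∈ range K, (σ * (N + 2) + K) * κ := by
        refine Finset.sum_le_sum fun b hb => ?_
        rw [mem_range] at hb
        have h := hA ((k - b : ℕ) * κ) (by positivity)
        have h1 : ((k - b : ℕ) : ℝ) ≤ k := by exact_mod_cast Nat.sub_le k b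
        have h2 : (k : ℝ) - K ≤ ((k - b : ℕ) : ℝ) := by
          have : k ≤ (k - b) + K := by omega
          have : (k : ℝ) ≤ ((k - b : ℕ) : ℝ) + K := by exact_mod_cast this
          linarith
        rw [hU] at h
        rw [abs_le] at *
        constructor <;> nlinarith
    _ = _ := by rw [Finset.sum_const, card_range, nsmul_eq_mul]; ring

/-- Some terminal window of `K` cells carries a positive proportion of its expected mass. -/
theorem exists_boxSum_cell_gt (hs0 : 0 < s) (hs : s ≤ 1 / 10000000) (hσ0 : 0 < σ)
    (hσ : σ ≤ s ^ 2 / 20) (hκ : 0 < κ) (hU : U = (N + 2) * κ)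
    (hK : 100 ≤ s * K) (hN : 100 * K ≤ s ^ 2 * N)
    (hA : ∀ v, 0 ≤ v → |primeSum y 0 v - v| ≤ σ * U)
    (hB : ∀ u ρ, s / 2 * U ≤ u → u ≤ U → (K - 1) * κ ≤ ρ → ρ ≤ (K + 1) * κ →
      |selSum y (u - ρ) u - 2 * u * ρ| ≤ σ * U * ρ) :
    ∃ k, N ≤ k + 2 * K ∧ k ≤ N ∧ s * (K * κ) < boxSum K (cellSum y κ) k := by
  by_contra! hcon
  have hM : (0 : ℝ) ≤ N := by positivity
  have hK1 : (1000 : ℝ) ≤ K := by nlinarith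
  have hK2 : 1000 ≤ K := by exact_mod_cast hK1
  have hKpos : (0 : ℝ) < K := by linarith
  have hs2 : s ^ 2 * N ≤ s * N / 10000000 := by nlinarith [mul_nonneg hs0.le hM]
  have hsN : 100000 ≤ s * N := by linarith
  have hN2 : (2 : ℝ) ≤ N := by nlinarith
  have hσN : σ * (N + 2) ≤ s ^ 2 * N / 10 := by nlinarith
  set g : ℕ → ℝ := fun k => 1 / (K * κ) * boxSum K (cellSum y κ) k with hg
  have hgB : ∀ k, boxSum K (cellSum y κ) k / κ = K * g k := by
    intro k; simp only [hg]; field_simp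
  have hg0 : ∀ k, 0 ≤ g k := fun k =>
    mul_nonneg (by positivity) (boxSum_nonneg (cellSum_nonneg y κ) k)
  have hKl : ∀ l : ℕ, s * N ≤ l → K ≤ l + 1 := by
    intro l hl
    have : (K : ℝ) ≤ l := by linarith
    have : K ≤ l := by exact_mod_cast this
    omega
  have hl2 : ∀ l : ℕ, s * N ≤ l → s / 2 * (N + 2) ≤ l := fun l hl => by nlinarith
  have hg2 : ∀ l : ℕ, s * N ≤ l → l ≤ N → g l ≤ 2 + s := by
    intro l hl hlN
    have h1 := boxSum_cell_upper hκ hU hB (hl2 l hl) hlN (hKl l hl)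
    rw [hgB] at h1
    have h2 : ((l : ℝ) + 1 - K) * g l ≤ 2 * (l + 1) + σ * (N + 2) := by
      have : K * (((l : ℝ) + 1 - K) * g l) ≤ K * (2 * (l + 1) + σ * (N + 2)) := by linarith
      exact le_of_mul_le_mul_left this hKpos
    have h3 : 2 * ((l : ℝ) + 1) + σ * (N + 2) ≤ (l + 1 - K) * (2 + s) := by nlinarith
    exact le_of_mul_le_mul_left (h2.trans h3) (by linarith)
  set T : ℕ → ℝ := fun l => 1 / (K * κ ^ 2) * boxSum K (cnv (cellSum y κ)) l with hT
  have hTB : ∀ k, boxSum K (cnv (cellSum y κ)) k / κ ^ 2 = K * T k := by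
    intro k; simp only [hT]; field_simp
  have hST : ∀ l : ℕ, 2 * s * N ≤ l → l ≤ N → |l * g l + T l - 2 * l| ≤ s * N / 4 := by
    intro l hl hlN
    have hl' : s * N ≤ l := by linarith
    have hlN' : (l : ℝ) ≤ N := by exact_mod_cast hlN
    have h1 := boxSum_cnv_upper hκ hU hB (hl2 l hl') hlN (hKl l hl')
    have h2 := boxSum_cnv_lower hκ hU hB (hl2 l hl') hlN (hKl l hl')
    rw [hgB, hTB] at h1 h2
    have h3 := hg2 l hl' hlN
    have h4 := hg0 l
    have b1 : 100 * (N : ℝ) ≤ s * K * N := mul_le_mul_of_nonneg_right hK hM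
    have b2 : 0 ≤ σ * ((N : ℝ) + 2) := by positivity
    have b3 : σ * ((N : ℝ) + 2) ≤ σ * (N + 2) * K := le_mul_of_one_le_right b2 (by linarith)
    have b4 : K * g l ≤ K * 3 := mul_le_mul_of_nonneg_left (by linarith) hKpos.le
    have a1 : T l + l * g l ≤ 2 * l + s * N / 4 := by
      have : K * (T l + (l + 1 - K) * g l) ≤ K * (2 * l + s * N / 25 + 4 + 2 * (σ * (N + 2))) := by
        linarith
      have := le_of_mul_le_mul_left this hKpos
      linarith
    have a2 : 2 * l - s * N / 4 ≤ T l + l * g l := by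
      have : K * (2 * l - s * N / 25 - σ * (N + 2)) ≤ K * (T l + (l + 1) * g l) := by
        linarith
      have := le_of_mul_le_mul_left this hKpos
      linarith
    rw [abs_le]
    constructor <;> linarith
  refine not_terminal_vanishing (g := g) (σ := s) (N := N) (K := K) hs0.le hs (by linarith)
    (by omega) (by linarith) hg0 ?_ hg2 ?_ ?_
  · intro k _
    refine (abs_sum_boxSum_cell_le hκ hU (by omega) hA k).trans ?_
    linarith
  · intro k hk hkN
    have hkN' : (k : ℝ) ≤ N := by exact_mod_cast hkN
    have hKk : K ≤ k + 1 := hKl k (by linarith)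
    have e : k * (1 / (K : ℝ) * ∑ b ∈ range K, g (k - b)) + cnv g k - 2 * k
        = 1 / K * ∑ b ∈ range K, (k * g (k - b) + T (k - b) - 2 * k) := by
      have e1 : cnv g k = 1 / K * ∑ b ∈ range K, T (k - b) := by
        have : cnv g k = (1 / (K * κ)) ^ 2 * cnv (boxSum K (cellSum y κ)) k :=
          cnv_const_mul _ _ _
        rw [this, cnv_boxSum, boxSum_eq_of_le _ hKk, hT, ← mul_sum]
        field_simp
      have e2 : ∑ b ∈ range K, (k : ℝ) * g (k - b) = k * ∑ b ∈ range K, g (k - b) :=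
        (mul_sum _ _ _).symm
      rw [e1, Finset.sum_sub_distrib, Finset.sum_add_distrib, e2, Finset.sum_const,
        card_range, nsmul_eq_mul]
      generalize ∑ b ∈ range K, g (k - b) = G
      field_simp
    rw [e, abs_mul, abs_of_pos (by positivity), one_div, inv_mul_le_iff₀ hKpos]
    calc _ ≤ ∑ b ∈ range K, |k * g (k - b) + T (k - b) - 2 * k| := Finset.abs_sum_le_sum_abs _ _
      _ ≤ ∑ _b ∈ range K, s * N := by
          refine Finset.sum_le_sum fun b hb => ?_
          rw [mem_range] at hb
          have hbK : (b : ℝ) ≤ K := by exact_mod_cast hb.le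
          have hc : ((k - b : ℕ) : ℝ) = k - b := by push_cast [show b ≤ k by omega]; ring
          have hl : 2 * s * N ≤ ((k - b : ℕ) : ℝ) := by rw [hc]; linarith
          have h := hST (k - b) hl (by omega)
          have h2 := hg2 (k - b) (by linarith) (by omega)
          have h3 := hg0 (k - b)
          rw [hc] at h
          have hb0 : (0 : ℝ) ≤ b := by positivity
          have h4 : b * g (k - b) ≤ K * 3 := mul_le_mul hbK (by linarith) h3 hKpos.le
          have h5 := mul_nonneg hb0 h3
          rw [abs_le] at *
          constructor <;> linarith
      _ = _ := by rw [Finset.sum_const, card_range, nsmul_eq_mul]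
  · intro k hk hkN
    simp only [hg]
    rw [one_div, inv_mul_le_iff₀ (by positivity)]
    linarith [hcon k hk hkN]

end Cells

/-- Short logarithmic windows carry a positive proportion of their expected von Mangoldt mass. -/
theorem exists_sum_window_ge : ∃ δ c U₀ : ℝ, 0 < δ ∧ δ ≤ 1 / 4 ∧ 0 < c ∧ ∀ U, U₀ ≤ U → ∀ r,
    Real.exp (-(δ * U)) ≤ r → r ≤ 1 → c * r ≤ ∑ n ∈ win (U - r) U, 1 / (n : ℝ) * Λ n := by
  obtain ⟨s, hs0, hs⟩ : ∃ s : ℝ, 0 < s ∧ s ≤ 1 / 10000000 := ⟨1 / 10000000, by norm_num, le_rfl⟩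
  obtain ⟨δ, τ, U₀, hδ0, hδ, -, hmain⟩ := selberg_short (σ := s ^ 2 / 20) (ε := s / 2)
    (by positivity) (by positivity)
  obtain ⟨K, hK⟩ := exists_nat_ge (100 / s)
  rw [div_le_iff₀ hs0] at hK
  have hK1 : (1000 : ℝ) ≤ K := by nlinarith
  have hKpos : (0 : ℝ) < K := by linarith
  refine ⟨δ / 2, s / 5, max U₀ (max (25 / s ^ 2) (20 / δ)), by positivity, by nlinarith,
    by positivity, fun U hU r hr hr1 => ?_⟩
  have hU0 : U₀ ≤ U := (le_max_left _ _).trans hU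
  have hU1 : 25 / s ^ 2 ≤ U := (le_max_left _ _).trans ((le_max_right _ _).trans hU)
  have hU2 : 20 / δ ≤ U := (le_max_right _ _).trans ((le_max_right _ _).trans hU)
  rw [div_le_iff₀ (by positivity)] at hU1 hU2
  have hUpos : 0 < U := by
    by_contra h
    push Not at h
    nlinarith [sq_nonneg s]
  have hU3 : 1 ≤ U := by nlinarith
  have hr0 : 0 < r := (Real.exp_pos _).trans_le hr
  set N := ⌈4 * K * U / r⌉₊ with hN
  have hN1 : 4 * K * U / r ≤ N := Nat.le_ceil _
  have hN2 : (N : ℝ) < 4 * K * U / r + 1 := Nat.ceil_lt_add_one (by positivity)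
  rw [div_le_iff₀ hr0] at hN1
  have hN2' : (N : ℝ) * r < 4 * K * U + r := by
    have := mul_lt_mul_of_pos_right hN2 hr0
    rw [add_mul, div_mul_cancel₀ _ hr0.ne'] at this
    linarith
  set κ := U / ((N : ℝ) + 2) with hκ
  have hNpos : (0 : ℝ) < (N : ℝ) + 2 := by positivity
  have hκ0 : 0 < κ := by positivity
  have hUκ : U = (N + 2) * κ := by rw [hκ]; field_simp
  have hκ1 : 4 * K * κ ≤ r := by
    rw [hκ, ← mul_div_assoc, div_le_iff₀ hNpos]
    nlinarith
  have hκ2 : r ≤ 5 * K * κ := by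
    rw [hκ, ← mul_div_assoc, le_div_iff₀ hNpos]
    nlinarith [mul_pos hKpos hUpos]
  obtain ⟨y, -, -, hA, hB⟩ := hmain U hU0
  have hexp : Real.exp (-(δ * U)) ≤ r / 10 := by
    have h1 : Real.exp (-(δ * U)) = Real.exp (-(δ / 2 * U)) * Real.exp (-(δ / 2 * U)) := by
      rw [← Real.exp_add]; ring_nf
    have h2 : Real.exp (-(δ / 2 * U)) ≤ 1 / 10 := by
      rw [Real.exp_neg, one_div]
      apply inv_anti₀ (by norm_num)
      have := Real.add_one_le_exp (δ / 2 * U)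
      linarith
    rw [h1]
    calc _ ≤ r * (1 / 10) := mul_le_mul hr h2 (Real.exp_pos _).le hr0.le
      _ = _ := by ring
  have hKκ : 1000 * κ ≤ K * κ := by gcongr
  obtain ⟨k, hk1, hk2, hk3⟩ := exists_boxSum_cell_gt (y := y) (N := N) (K := K) (s := s)
    (σ := s ^ 2 / 20) (κ := κ) (U := U) hs0 hs (by positivity) le_rfl hκ0 hUκ (by linarith)
    (by
      have : 4 * K * U ≤ N := by
        refine hN1.trans (mul_le_of_le_one_right (by positivity) hr1)
      have h2 : s ^ 2 * (4 * K * U) ≤ s ^ 2 * N := by gcongr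
      nlinarith) hA
    (fun u ρ h1 h2 h3 h4 => hB u ρ h1 h2 (by linarith) (by linarith))
  have hKk : K ≤ k + 1 := by
    have : (3 * K : ℝ) ≤ N := by nlinarith
    have : 3 * K ≤ N := by exact_mod_cast this
    omega
  rw [boxSum_cellSum y hκ0.le hKk] at hk3
  have hk1' : (N : ℝ) ≤ k + 2 * K := by exact_mod_cast hk1
  have hk2' : (k : ℝ) ≤ N := by exact_mod_cast hk2
  calc s / 5 * r ≤ s * (K * κ) := by nlinarith
    _ ≤ _ := hk3.le
    _ ≤ ∑ n ∈ win (U - r) U, 1 / (n : ℝ) * lamr y n := by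
        refine Finset.sum_le_sum_of_subset_of_nonneg (win_subset ?_ ?_)
          fun n _ _ => cw_nonneg y n
        · nlinarith
        · rw [hUκ]; gcongr; linarith
    _ ≤ _ := Finset.sum_le_sum fun n _ => mul_le_mul_of_nonneg_left (lamr_le y n) (by positivity)

lemma sum_vonMangoldt_not_prime_le {x : ℕ} (hx : 1 ≤ x) {s : Finset ℕ} (hs : s ⊆ Icc 1 x) :
    ∑ n ∈ s with ¬ n.Prime, Λ n ≤ 2 * √x * Real.log x := by
  refine le_trans ?_ (Chebyshev.psi_sub_theta_le (x := (x : ℝ)) (by exact_mod_cast hx))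
  rw [Chebyshev.psi_sub_theta_eq_sum_not_prime, Nat.floor_natCast]
  refine Finset.sum_le_sum_of_subset_of_nonneg ?_ fun _ _ _ => ArithmeticFunction.vonMangoldt_nonneg
  intro n hn
  rw [mem_filter] at hn ⊢
  have := mem_Icc.1 (hs hn.1)
  exact ⟨by rw [mem_Ioc]; omega, hn.2⟩

lemma isLittleO_sqrt_mul_log {ε : ℝ} (hε : 0 < ε) :
    ∀ᶠ x : ℝ in Filter.atTop, √x * Real.log x ≤ ε * x ^ (3 / 4 : ℝ) := by
  have h := (isLittleO_log_rpow_atTop (show (0 : ℝ) < 1 / 4 by norm_num)).def hε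
  filter_upwards [h, Filter.eventually_ge_atTop 1] with x hx hx1
  rw [Real.norm_of_nonneg (Real.log_nonneg hx1), Real.norm_of_nonneg (by positivity)] at hx
  calc √x * Real.log x ≤ √x * (ε * x ^ (1 / 4 : ℝ)) := by gcongr
    _ = ε * (x ^ (1 / 2 : ℝ) * x ^ (1 / 4 : ℝ)) := by rw [Real.sqrt_eq_rpow]; ring
    _ = _ := by rw [← Real.rpow_add (by linarith)]; norm_num

/-- The primes in `[x - h, x)`. -/
def primesIco (x h : ℕ) : Finset ℕ := (Ico (x - h) x).filter Nat.Prime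

/-- A lower bound of the expected order of magnitude for the number of primes in short intervals. -/
theorem card_primesIco_ge : ∃ δ c : ℝ, ∃ x₀ : ℕ, 0 < δ ∧ δ ≤ 1 / 4 ∧ 0 < c ∧ ∀ x h : ℕ, x₀ ≤ x →
    (x : ℝ) ^ (1 - δ) ≤ h → 2 * h ≤ x → c * h / Real.log x ≤ (primesIco x h).card := by
  obtain ⟨δ, c, U₀, hδ0, hδ, hc, hmain⟩ := exists_sum_window_ge
  obtain ⟨X, hX⟩ := Filter.eventually_atTop.1
    (isLittleO_sqrt_mul_log (show 0 < c / 8 by positivity))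
  refine ⟨δ, c / 4, ⌈max X (max (Real.exp U₀) 2)⌉₊, hδ0, hδ, by positivity, ?_⟩
  intro x h hx hh hhx
  have hx' := Nat.ceil_le.1 hx
  have hx1 : X ≤ x := (le_max_left _ _).trans hx'
  have hx2 : Real.exp U₀ ≤ x := (le_max_left _ _).trans ((le_max_right _ _).trans hx')
  have hx3 : (2 : ℝ) ≤ x := (le_max_right _ _).trans ((le_max_right _ _).trans hx')
  have hx0 : (0 : ℝ) < x := by linarith
  have hlog : 0 < Real.log x := Real.log_pos (by linarith)
  have hhx' : 2 * (h : ℝ) ≤ x := by exact_mod_cast hhx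
  have h1 := hmain (Real.log x) ((Real.le_log_iff_exp_le hx0).2 hx2) (h / x)
    (by
      rw [le_div_iff₀ hx0]
      refine le_trans (le_of_eq ?_) hh
      rw [Real.rpow_sub hx0, Real.rpow_one, Real.rpow_def_of_pos hx0, Real.exp_neg, mul_comm δ]
      ring)
    (by rw [div_le_one hx0]; linarith)
  have hsub : win (Real.log x - h / x) (Real.log x) ⊆ Ico (x - h) x := by
    intro n hn
    rw [mem_win] at hn
    obtain ⟨hn1, hn2, hn3⟩ := hn
    have hn0 : (0 : ℝ) < n := by exact_mod_cast hn1
    rw [mem_Ico]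
    constructor
    · have e1 : (x : ℝ) - h ≤ n := by
        calc (x : ℝ) - h = x * (-(h / x) + 1) := by field_simp; ring
          _ ≤ x * Real.exp (-(h / x)) := by gcongr; exact Real.add_one_le_exp _
          _ = Real.exp (Real.log x - h / x) := by
              rw [sub_eq_add_neg, Real.exp_add, Real.exp_log hx0]
          _ ≤ n := (Real.le_log_iff_exp_le hn0).1 hn2
      have : (x : ℝ) ≤ ((n + h : ℕ) : ℝ) := by push_cast; linarith
      have : x ≤ n + h := by exact_mod_cast this
      omega
    · exact_mod_cast (Real.log_lt_log_iff hn0 hx0).1 hn3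
  have h2 : ∑ n ∈ win (Real.log x - h / x) (Real.log x), 1 / (n : ℝ) * Λ n
      ≤ 2 / x * ∑ n ∈ Ico (x - h) x, Λ n := by
    refine (Finset.sum_le_sum_of_subset_of_nonneg hsub fun n _ _ =>
      mul_nonneg (by positivity) ArithmeticFunction.vonMangoldt_nonneg).trans ?_
    rw [mul_sum]
    refine Finset.sum_le_sum fun n hn => mul_le_mul_of_nonneg_right ?_
      ArithmeticFunction.vonMangoldt_nonneg
    rw [mem_Ico] at hn
    have e : x ≤ 2 * n := by omega
    have e' : (x : ℝ) ≤ 2 * n := by exact_mod_cast e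
    rw [div_le_div_iff₀ (by linarith) hx0]
    linarith
  have h3 : c * h / 2 ≤ ∑ n ∈ Ico (x - h) x, Λ n := by
    have := h1.trans h2
    rw [← mul_div_assoc, div_mul_eq_mul_div, div_le_div_iff_of_pos_right hx0] at this
    linarith
  have h4 : ∑ n ∈ Ico (x - h) x with ¬ n.Prime, Λ n ≤ c / 4 * h := by
    have hs : Ico (x - h) x ⊆ Icc 1 x := by
      intro n hn
      rw [mem_Ico] at hn
      rw [mem_Icc]
      have : 2 ≤ x := by exact_mod_cast hx3
      omega
    have hxone : 1 ≤ x := by exact_mod_cast (by linarith : (1 : ℝ) ≤ x)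
    refine (sum_vonMangoldt_not_prime_le hxone hs).trans ?_
    have e1 := hX x hx1
    have e2 : (x : ℝ) ^ (3 / 4 : ℝ) ≤ h :=
      (Real.rpow_le_rpow_of_exponent_le (by linarith) (by linarith)).trans hh
    have e3 : c / 8 * (x : ℝ) ^ (3 / 4 : ℝ) ≤ c / 8 * h := by gcongr
    linarith
  have h5 : ∑ n ∈ primesIco x h, Λ n ≤ (primesIco x h).card * Real.log x := by
    rw [← nsmul_eq_mul]
    refine Finset.sum_le_card_nsmul _ _ _ fun n hn => ?_
    rw [primesIco, mem_filter, mem_Ico] at hn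
    refine ArithmeticFunction.vonMangoldt_le_log.trans ?_
    exact Real.log_le_log (by exact_mod_cast hn.2.pos) (by exact_mod_cast hn.1.2.le)
  have h6 := Finset.sum_filter_add_sum_filter_not (Ico (x - h) x) Nat.Prime (fun n => Λ n)
  rw [div_le_iff₀ hlog]
  have h7 : ∑ n ∈ primesIco x h, Λ n = ∑ n ∈ Ico (x - h) x with n.Prime, Λ n := rfl
  linarith

lemma sieveData_indicator_Ico {y x : ℕ} (hyx : y ≤ x) :
    SieveData (fun n => if n ∈ Ico y x then 1 else 0) x (x - y) 1 where
  nonneg n := by split_ifs <;> norm_num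
  vanish n hn := by rw [if_neg]; rw [mem_Ico]; omega
  X_nonneg := by
    have : (y : ℝ) ≤ x := by exact_mod_cast hyx
    linarith
  r_nonneg := zero_le_one
  bound e he := by
    have he0 : (0 : ℝ) < e := by exact_mod_cast he
    rw [sum_filter_dvd_eq he fun n hn => by rw [if_neg]; rw [mem_Ico]; omega]
    have h1 : ∀ m : ℕ, e * m ∈ Ico y x ↔ m ∈ Ico ⌈(y : ℝ) / e⌉₊ ⌈(x : ℝ) / e⌉₊ := by
      intro m
      rw [mem_Ico, mem_Ico, Nat.lt_ceil, Nat.ceil_le, div_le_iff₀ he0, lt_div_iff₀ he0]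
      norm_cast
      rw [mul_comm e]
    simp only [h1]
    rw [← Finset.sum_filter, Finset.sum_const, nsmul_eq_mul, mul_one]
    have h2 : (range x).filter (· ∈ Ico ⌈(y : ℝ) / e⌉₊ ⌈(x : ℝ) / e⌉₊)
        = Ico ⌈(y : ℝ) / e⌉₊ ⌈(x : ℝ) / e⌉₊ := by
      ext m
      simp only [mem_filter, mem_range, and_iff_right_iff_imp]
      intro hm
      rw [← h1, mem_Ico] at hm
      exact (Nat.le_mul_of_pos_left m he).trans_lt hm.2
    have h3 : (y : ℝ) / e ≤ x / e := by gcongr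
    rw [h2, Nat.card_Ico, Nat.cast_sub (Nat.ceil_mono h3)]
    have h4 := Nat.le_ceil ((y : ℝ) / e)
    have h5 := Nat.le_ceil ((x : ℝ) / e)
    have h6 := Nat.ceil_lt_add_one (show 0 ≤ (y : ℝ) / e by positivity)
    have h7 := Nat.ceil_lt_add_one (show 0 ≤ (x : ℝ) / e by positivity)
    rw [sub_div, abs_le]
    constructor <;> linarith

/-- An upper bound of the expected order of magnitude for the number of primes in short
intervals. -/
theorem card_primesIco_le : ∃ C : ℝ, ∃ x₀ : ℕ, 0 < C ∧ ∀ x h : ℕ, x₀ ≤ x →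
    (x : ℝ) ^ (3 / 4 : ℝ) ≤ h → h ≤ x → (primesIco x h).card ≤ C * h / Real.log x := by
  obtain ⟨m, hm⟩ := fundamental_lemma
  obtain ⟨s, hs1, hs⟩ := hm m le_rfl
  have hs0 : 0 < s := by linarith
  obtain ⟨X, hX⟩ := Filter.eventually_atTop.1 (isLittleO_sqrt_mul_log zero_lt_one)
  refine ⟨32 * s + 2, ⌈max X (Real.exp (16 * s))⌉₊, by positivity, ?_⟩
  intro x h hx hh hhx
  have hx' := Nat.ceil_le.1 hx
  have hx1 : X ≤ x := (le_max_left _ _).trans hx'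
  have hx2 : Real.exp (16 * s) ≤ x := (le_max_right _ _).trans hx'
  have hx0 : (0 : ℝ) < x := (Real.exp_pos _).trans_le hx2
  have hx3 : (1 : ℝ) ≤ x := by
    have := Real.add_one_le_exp (16 * s)
    linarith
  have hlog : 16 * s ≤ Real.log x := (Real.le_log_iff_exp_le hx0).2 hx2
  have hlog0 : 0 < Real.log x := by linarith
  set b := Real.log x / (8 * s) with hb
  have hb2 : 2 ≤ b := by rw [hb, le_div_iff₀ (by positivity)]; linarith
  have hbs : s * b = Real.log x / 8 := by rw [hb]; field_simp
  set w := ⌊Real.exp b⌋₊ with hw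
  have hexp : b + 1 ≤ Real.exp b := Real.add_one_le_exp b
  have hw2 : 2 ≤ w := Nat.le_floor (by push_cast; linarith)
  have hwle : (w : ℝ) ≤ Real.exp b := Nat.floor_le (Real.exp_pos _).le
  have hwlt : Real.exp b < w + 1 := Nat.lt_floor_add_one _
  have hw0 : (0 : ℝ) < w := by positivity
  have hlw1 : Real.log w ≤ b := by
    rw [← Real.log_exp b]; exact Real.log_le_log hw0 hwle
  have hlw2 : b / 2 ≤ Real.log w := by
    rw [Real.le_log_iff_exp_le hw0]
    have e1 : Real.exp b = Real.exp (b / 2) * Real.exp (b / 2) := by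
      rw [← Real.exp_add]; ring_nf
    have e2 := Real.add_one_le_exp (b / 2)
    nlinarith
  have hlD : Real.log (x ^ (1 / 8 : ℝ)) = Real.log x / 8 := by rw [Real.log_rpow hx0]; ring
  have key := hs w hw2 _ x _ 1 (x ^ (1 / 8 : ℝ)) (sieveData_indicator_Ico (Nat.sub_le x h))
    (Real.one_lt_rpow (by linarith [Real.add_one_le_exp (16 * s)]) (by norm_num))
  rw [hlD, Nat.cast_sub hhx, sub_sub_cancel, one_mul] at key
  have hfac : (s * Real.log w / (Real.log x / 8)) ^ (C0 + m) ≤ 1 := by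
    have : 0 ≤ Real.log w := by linarith
    refine pow_le_one₀ (by positivity) ?_
    rw [div_le_one (by positivity), ← hbs]
    gcongr
  have hV := V_mul_log_le hw2
  have hVp := V_pos w
  have hhp : (0 : ℝ) ≤ h := by positivity
  have hsq : (x : ℝ) ^ (3 / 4 : ℝ) ≤ h := hh
  have hX' := (hX x hx1).trans ((one_mul _).le.trans hsq)
  have hD2 : ((x : ℝ) ^ (1 / 8 : ℝ)) ^ 2 ≤ √x := by
    rw [← Real.rpow_natCast, ← Real.rpow_mul hx0.le, Real.sqrt_eq_rpow]
    exact Real.rpow_le_rpow_of_exponent_le hx3 (by norm_num)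
  have hwx : (w : ℝ) ≤ √x := by
    refine hwle.trans ?_
    rw [Real.sqrt_eq_rpow, Real.rpow_def_of_pos hx0]
    gcongr
    nlinarith
  have hcard : ((primesIco x h).card : ℝ)
      ≤ w + sift (fun n => if n ∈ Ico (x - h) x then 1 else 0) x w := by
    have hsub : primesIco x h ⊆ range w ∪ ((range x).filter (rough w)).filter
        (· ∈ Ico (x - h) x) := by
      intro p hp
      rw [primesIco, mem_filter] at hp
      rw [mem_union, mem_range, mem_filter, mem_filter, mem_range, rough_prime hp.2]
      have := mem_Ico.1 hp.1
      rcases lt_or_ge p w with h | h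
      · exact Or.inl h
      · exact Or.inr ⟨⟨this.2, h⟩, hp.1⟩
    have h1 := (card_le_card hsub).trans (card_union_le _ _)
    rw [card_range] at h1
    rw [sift, ← Finset.sum_filter, Finset.sum_const, nsmul_eq_mul, mul_one]
    exact_mod_cast h1
  have hsift : sift (fun n => if n ∈ Ico (x - h) x then 1 else 0) x w ≤ 2 * h * V w + √x := by
    have h1 := (abs_le.1 key).2
    have h2 : h * V w * (s * Real.log w / (Real.log x / 8)) ^ (C0 + m) ≤ h * V w * 1 := by
      gcongr
    linarith
  have hVx : V w * Real.log x ≤ 16 * s := by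
    have : Real.log x ≤ 16 * s * Real.log w := by
      have : Real.log x = 8 * (s * b) := by rw [hbs]; ring
      nlinarith
    calc V w * Real.log x ≤ V w * (16 * s * Real.log w) := by gcongr
      _ = 16 * s * (V w * Real.log w) := by ring
      _ ≤ 16 * s * 1 := by gcongr
      _ = _ := mul_one _
  rw [le_div_iff₀ hlog0]
  calc ((primesIco x h).card : ℝ) * Real.log x ≤ (√x + (2 * h * V w + √x)) * Real.log x := by
        gcongr
        linarith
    _ = 2 * h * (V w * Real.log x) + 2 * (√x * Real.log x) := by ring
    _ ≤ 2 * h * (16 * s) + 2 * h := by gcongr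
    _ = _ := by ring

/-- Greedy covering: if every `n ∈ B` is hit by at least half of `W`, then `W` contains a hitting
set for `B` of logarithmic size. -/
lemma exists_hitting_set {W B : Finset ℕ} (Q : ℕ → ℕ → Prop) [∀ n, DecidablePred (Q n)] {k : ℕ}
    (hk : B.card < 2 ^ k) (hQ : ∀ n ∈ B, W.card ≤ 2 * (W.filter (Q n)).card) (hW : W.Nonempty) :
    ∃ T ⊆ W, T.card ≤ k ∧ ∀ n ∈ B, ∃ t ∈ T, Q n t := by
  induction k generalizing B with
  | zero =>
    refine ⟨∅, empty_subset _, by simp, fun n hn => ?_⟩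
    rw [pow_zero, Nat.lt_one_iff, card_eq_zero] at hk
    simp [hk] at hn
  | succ k ih =>
    obtain ⟨t, htW, ht⟩ : ∃ t ∈ W, B.card ≤ 2 * (B.filter (Q · t)).card := by
      apply Finset.exists_le_of_sum_le hW
      rw [sum_const, smul_eq_mul, ← mul_sum]
      calc W.card * B.card = ∑ n ∈ B, W.card := by rw [sum_const, smul_eq_mul, mul_comm]
        _ ≤ ∑ n ∈ B, 2 * (W.filter (Q n)).card := sum_le_sum hQ
        _ = 2 * ∑ n ∈ B, (bipartiteAbove Q W n).card := by rw [mul_sum]; rfl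
        _ = 2 * ∑ t ∈ W, (bipartiteBelow Q B t).card := by
            rw [sum_card_bipartiteAbove_eq_sum_card_bipartiteBelow]
        _ = _ := rfl
    have hsplit := card_filter_add_card_filter_not (s := B) (Q · t)
    obtain ⟨T, hTW, hTk, hT⟩ := ih (B := B.filter (¬ Q · t)) (by rw [pow_succ] at hk; omega)
      fun n hn => hQ n (mem_filter.1 hn).1
    refine ⟨insert t T, insert_subset htW hTW, (card_insert_le _ _).trans (by omega), ?_⟩
    intro n hn
    by_cases h : Q n t
    · exact ⟨t, mem_insert_self _ _, h⟩
    · obtain ⟨u, hu, hu'⟩ := hT n (mem_filter.2 ⟨hn, h⟩)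
      exact ⟨u, mem_insert_of_mem hu, hu'⟩

section PartialCover

variable (W : Finset ℕ) (R : ℕ → ℕ → ℕ → Prop)

open Classical in
/-- The elements `t` of `W` for which some `s ∈ S` satisfies `R n t s`. -/
noncomputable def covered (S : Finset ℕ) (n : ℕ) : Finset ℕ := W.filter fun t => ∃ s ∈ S, R n t s

open Classical in
/-- The elements `t` of `W` which are covered by `s` but not by `S`. -/
noncomputable def newlyCovered (S : Finset ℕ) (n s : ℕ) : Finset ℕ :=
  (W.filter fun t => R n t s) \ covered W R S n

open Classical in
/-- The potential of `S`, where each `n ∈ B` with at most half of `W` covered contributes with an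
exponentially decaying weight. -/
noncomputable def coverPotential (B : Finset ℕ) (L : ℝ) (S : Finset ℕ) : ℝ :=
  ∑ n ∈ B with 2 * (covered W R S n).card < W.card,
    Real.exp (-(L * (covered W R S n).card / W.card))

variable {W R}

lemma card_covered_insert (S : Finset ℕ) (n s : ℕ) :
    (covered W R (insert s S) n).card
      = (covered W R S n).card + (newlyCovered W R S n s).card := by
  classical
  have : covered W R (insert s S) n = covered W R S n ∪ newlyCovered W R S n s := by
    ext t
    simp only [covered, newlyCovered, mem_filter, mem_union, mem_sdiff, mem_insert,
      exists_eq_or_imp]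
    by_cases h : ∃ a ∈ S, R n t a <;> simp only [h] <;> tauto
  rw [this, card_union_of_disjoint]
  exact disjoint_sdiff

open Classical in
lemma sum_card_newlyCovered_ge {S : Finset ℕ} {n : ℕ} {a : ℝ} (ha : 0 ≤ a)
    (hlow : ∀ t ∈ W, a ≤ (W.filter (R n t)).card)
    (hbad : 2 * (covered W R S n).card < W.card) :
    W.card / 2 * a ≤ ∑ s ∈ W, ((newlyCovered W R S n s).card : ℝ) := by
  have h1 : ∑ s ∈ W, (newlyCovered W R S n s).card
      = ∑ t ∈ W \ covered W R S n, (W.filter (R n t)).card := by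
    have h2 := sum_card_bipartiteAbove_eq_sum_card_bipartiteBelow (s := W \ covered W R S n)
      (t := W) (R n)
    refine Eq.trans (sum_congr rfl fun s _ => ?_) h2.symm
    congr 1
    ext t
    simp only [newlyCovered, bipartiteBelow, mem_filter, mem_sdiff]
    tauto
  have h3 : (W \ covered W R S n).card + (covered W R S n).card = W.card :=
    card_sdiff_add_card_eq_card (filter_subset _ _)
  have h4 : (W.card : ℝ) / 2 ≤ (W \ covered W R S n).card := by
    have : W.card ≤ 2 * (W \ covered W R S n).card := by omega
    have : (W.card : ℝ) ≤ 2 * (W \ covered W R S n).card := by exact_mod_cast this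
    linarith
  have h5 : ∑ s ∈ W, ((newlyCovered W R S n s).card : ℝ)
      = ∑ t ∈ W \ covered W R S n, ((W.filter (R n t)).card : ℝ) := by exact_mod_cast h1
  rw [h5]
  calc W.card / 2 * a ≤ (W \ covered W R S n).card * a := by gcongr
    _ ≤ _ := by
        rw [← nsmul_eq_mul]
        exact card_nsmul_le_sum _ _ _ fun t ht => hlow t (mem_sdiff.1 ht).1

lemma exp_neg_le_one_sub_div {x C : ℝ} (hx : 0 ≤ x) (hxC : x ≤ C) :
    Real.exp (-x) ≤ 1 - x / (1 + C) := by
  have h1 := Real.add_one_le_exp x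
  calc Real.exp (-x) = (Real.exp x)⁻¹ := Real.exp_neg x
    _ ≤ (1 + x)⁻¹ := by
        apply inv_anti₀ <;> linarith
    _ = 1 - x / (1 + x) := by field_simp; ring
    _ ≤ _ := by gcongr

open Classical in
lemma exists_insert_coverPotential_le {B S : Finset ℕ} {L c C : ℝ} (hW : W.Nonempty) (hL : 0 < L)
    (hc : 0 ≤ c) (hC : 0 ≤ C)
    (hlow : ∀ n ∈ B, ∀ t ∈ W, c * W.card / L ≤ (W.filter (R n t)).card)
    (hup : ∀ n ∈ B, ∀ s ∈ W, ((W.filter fun t => R n t s).card : ℝ) ≤ C * W.card / L) :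
    ∃ s ∈ W, coverPotential W R B L (insert s S)
      ≤ (1 - c / (2 * (1 + C))) * coverPotential W R B L S := by
  have hW0 : (0 : ℝ) < W.card := by exact_mod_cast hW.card_pos
  apply Finset.exists_le_of_sum_le hW
  set bad := B.filter (fun n => 2 * (covered W R S n).card < W.card) with hbad
  set g : ℕ → ℝ := fun n => Real.exp (-(L * (covered W R S n).card / W.card)) with hg
  set ν : ℕ → ℕ → ℝ := fun n s => L * (newlyCovered W R S n s).card / W.card with hν
  have hν0 : ∀ n s, 0 ≤ ν n s := fun n s => by positivity
  have hνC : ∀ n ∈ B, ∀ s ∈ W, ν n s ≤ C := by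
    intro n hn s hs
    have h1 : ((newlyCovered W R S n s).card : ℝ) ≤ C * W.card / L :=
      le_trans (by exact_mod_cast card_le_card sdiff_subset) (hup n hn s hs)
    rw [hν, div_le_iff₀ hW0]
    rw [le_div_iff₀ hL] at h1
    linarith
  have hstep : ∀ s ∈ W, coverPotential W R B L (insert s S)
      ≤ ∑ n ∈ bad, g n * (1 - ν n s / (1 + C)) := by
    intro s hs
    calc coverPotential W R B L (insert s S)
        ≤ ∑ n ∈ bad, Real.exp (-(L * (covered W R (insert s S) n).card / W.card)) := by
          refine sum_le_sum_of_subset_of_nonneg ?_ fun _ _ _ => (Real.exp_pos _).le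
          intro n hn
          rw [mem_filter, card_covered_insert] at hn
          exact mem_filter.2 ⟨hn.1, by omega⟩
      _ ≤ _ := by
          refine sum_le_sum fun n hn => ?_
          have hnB := (mem_filter.1 hn).1
          have : -(L * ((covered W R (insert s S) n).card : ℝ) / W.card)
              = -(L * (covered W R S n).card / W.card) + -ν n s := by
            rw [card_covered_insert, hν]; push_cast; ring
          rw [this, Real.exp_add]
          exact mul_le_mul_of_nonneg_left (exp_neg_le_one_sub_div (hν0 n s) (hνC n hnB s hs))
            (Real.exp_pos _).le
  refine (sum_le_sum hstep).trans ?_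
  rw [sum_comm, sum_const, nsmul_eq_mul, coverPotential, mul_sum, mul_sum]
  refine sum_le_sum fun n hn => ?_
  obtain ⟨hnB, hnb⟩ := mem_filter.1 hn
  rw [← mul_sum, sum_sub_distrib, sum_const, nsmul_eq_mul, mul_one, ← sum_div]
  have h1 := sum_card_newlyCovered_ge (S := S) (by positivity) (hlow n hnB) hnb
  have h2 : c * W.card / 2 ≤ ∑ s ∈ W, ν n s := by
    have : ∑ s ∈ W, ν n s = L / W.card * ∑ s ∈ W, ((newlyCovered W R S n s).card : ℝ) := by
      rw [mul_sum]
      exact sum_congr rfl fun s _ => by rw [hν]; ring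
    rw [this]
    calc c * W.card / 2 = L / W.card * (W.card / 2 * (c * W.card / L)) := by field_simp
      _ ≤ _ := by gcongr
  calc g n * (W.card - (∑ s ∈ W, ν n s) / (1 + C))
      ≤ g n * (W.card - (c * W.card / 2) / (1 + C)) := by
        have : 0 ≤ g n := (Real.exp_pos _).le
        gcongr
    _ = W.card * ((1 - c / (2 * (1 + C))) * g n) := by field_simp

open Classical in
/-- If each `n ∈ B` has about `|W| / L` solutions `s ∈ W` of `R n t s` for every `t ∈ W`, and
symmetrically in `s`, then `O(L)` elements `s` suffice to cover half of `W` for every `n ∈ B`. -/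
lemma exists_half_cover {B : Finset ℕ} {L c C : ℝ} (hW : W.Nonempty) (hL : 0 < L)
    (hc : 0 < c) (hC : 0 ≤ C) (hcC : c ≤ C) (hB : (B.card : ℝ) ≤ Real.exp (2 * L))
    (hlow : ∀ n ∈ B, ∀ t ∈ W, c * W.card / L ≤ (W.filter (R n t)).card)
    (hup : ∀ n ∈ B, ∀ s ∈ W, ((W.filter fun t => R n t s).card : ℝ) ≤ C * W.card / L) :
    ∃ S ⊆ W, (S.card : ℝ) ≤ 6 * (1 + C) / c * L + 1 ∧
      ∀ n ∈ B, W.card ≤ 2 * (covered W R S n).card := by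
  have hW0 : (0 : ℝ) < W.card := by exact_mod_cast hW.card_pos
  set κ := c / (2 * (1 + C)) with hκ
  have hκ0 : 0 < κ := by positivity
  have hκ1 : κ ≤ 1 := by rw [hκ, div_le_one (by positivity)]; linarith
  have hiter : ∀ k : ℕ, ∃ S ⊆ W, S.card ≤ k ∧
      coverPotential W R B L S ≤ (1 - κ) ^ k * B.card := by
    intro k
    induction k with
    | zero =>
      refine ⟨∅, empty_subset _, by simp, ?_⟩
      rw [pow_zero, one_mul, coverPotential]
      calc _ ≤ ∑ n ∈ B with 2 * (covered W R ∅ n).card < W.card, (1 : ℝ) := by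
            refine sum_le_sum fun n _ => ?_
            rw [Real.exp_le_one_iff, neg_nonpos]
            positivity
        _ ≤ _ := by
            rw [sum_const, nsmul_eq_mul, mul_one]
            exact_mod_cast card_filter_le _ _
    | succ k ih =>
      obtain ⟨S, hSW, hSk, hS⟩ := ih
      obtain ⟨s, hsW, hs⟩ := exists_insert_coverPotential_le (S := S) hW hL hc.le hC hlow hup
      refine ⟨insert s S, insert_subset hsW hSW, (card_insert_le _ _).trans (by omega),
        hs.trans ?_⟩
      rw [pow_succ']
      calc (1 - κ) * coverPotential W R B L S ≤ (1 - κ) * ((1 - κ) ^ k * B.card) := by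
            have : 0 ≤ 1 - κ := by linarith
            gcongr
        _ = _ := by ring
  obtain ⟨S, hSW, hSk, hS⟩ := hiter ⌈3 * L / κ⌉₊
  refine ⟨S, hSW, ?_, fun n hn => ?_⟩
  · have h1 : (S.card : ℝ) ≤ ⌈3 * L / κ⌉₊ := by exact_mod_cast hSk
    have h2 := Nat.ceil_lt_add_one (show 0 ≤ 3 * L / κ by positivity)
    have h3 : 3 * L / κ = 6 * (1 + C) / c * L := by rw [hκ]; field_simp; ring
    linarith
  · by_contra! hbad
    have h1 : Real.exp (-(L / 2)) ≤ coverPotential W R B L S := by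
      refine le_trans ?_ (single_le_sum (f := fun n =>
        Real.exp (-(L * (covered W R S n).card / W.card))) (fun _ _ => (Real.exp_pos _).le)
        (mem_filter.2 ⟨hn, hbad⟩))
      refine Real.exp_le_exp.2 (neg_le_neg ?_)
      have : (2 * (covered W R S n).card : ℝ) < W.card := by exact_mod_cast hbad
      rw [div_le_iff₀ hW0]
      nlinarith
    have h2 : (1 - κ) ^ ⌈3 * L / κ⌉₊ * B.card ≤ Real.exp (-L) := by
      calc (1 - κ) ^ ⌈3 * L / κ⌉₊ * B.card ≤ (Real.exp (-κ)) ^ ⌈3 * L / κ⌉₊ * Real.exp (2 * L) := by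
            have : 0 ≤ 1 - κ := by linarith
            gcongr
            exact Real.one_sub_le_exp_neg κ
        _ = Real.exp (-(⌈3 * L / κ⌉₊ * κ) + 2 * L) := by
            rw [← Real.exp_nat_mul, ← Real.exp_add]; ring_nf
        _ ≤ _ := by
            have := (div_le_iff₀ hκ0).1 (Nat.le_ceil (3 * L / κ))
            exact Real.exp_le_exp.2 (by linarith)
    have h3 := Real.exp_le_exp.1 (h1.trans (hS.trans h2))
    linarith

end PartialCover

lemma card_filter_prime_sub {m M : ℕ} (h : 2 * M ≤ m) :
    ((Ioc M (2 * M)).filter fun s => (m - s).Prime).card = (primesIco (m - M) M).card := by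
  refine card_nbij' (fun s => m - s) (fun p => m - p) ?_ ?_ ?_ ?_
  · intro s hs
    rw [mem_coe, mem_filter, mem_Ioc] at hs
    rw [mem_coe, primesIco, mem_filter, mem_Ico]
    exact ⟨by dsimp only; omega, hs.2⟩
  · intro p hp
    rw [mem_coe, primesIco, mem_filter, mem_Ico] at hp
    rw [mem_coe, mem_filter, mem_Ioc, show m - (m - p) = p by omega]
    exact ⟨by dsimp only; omega, hp.2⟩
  · intro s hs
    rw [mem_coe, mem_filter, mem_Ioc] at hs
    change m - (m - s) = s
    omega
  · intro p hp
    rw [mem_coe, primesIco, mem_filter, mem_Ico] at hp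
    change m - (m - p) = p
    omega

/-- Uniformly for `log n ∈ [L, (1 + δ / 4) L)` and `t ∈ (M, 2 * M]` with `M` about
`exp ((1 - δ / 2) L)`, the number of `s ∈ (M, 2 * M]` with `n - t - s` prime is of order
`M / L`. -/
lemma exists_card_prime_sub_bounds : ∃ δ c C L₀ : ℝ,
    0 < δ ∧ δ ≤ 1 / 4 ∧ 0 < c ∧ c ≤ C ∧ 18 ≤ δ * L₀ ∧
    ∀ L, L₀ ≤ L → ∀ M : ℕ, M = ⌊Real.exp ((1 - δ / 2) * L)⌋₊ → ∀ n : ℕ, Real.exp L ≤ n →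
    (n : ℝ) < Real.exp ((1 + δ / 4) * L) → ∀ t ∈ Ioc M (2 * M),
    c * M / L ≤ ((Ioc M (2 * M)).filter fun s => (n - t - s).Prime).card ∧
    (((Ioc M (2 * M)).filter fun s => (n - t - s).Prime).card : ℝ) ≤ C * M / L := by
  obtain ⟨δ, c, x₁, hδ0, hδ, hc, hge⟩ := card_primesIco_ge
  obtain ⟨C, x₂, hC, hle⟩ := card_primesIco_le
  refine ⟨δ, c / 2, 2 * C + c, max (18 / δ) (2 * max (x₁ : ℝ) x₂), hδ0, hδ, by positivity,
    by linarith, ?_, ?_⟩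
  · rw [← div_le_iff₀' hδ0]
    exact le_max_left _ _
  intro L hL M hM n hn1 hn2 t ht
  have hL1 : 18 ≤ δ * L := by
    rw [← div_le_iff₀' hδ0]
    exact (le_max_left _ _).trans hL
  have hL2 : 2 * max (x₁ : ℝ) x₂ ≤ L := (le_max_right _ _).trans hL
  have hLx₁ := le_max_left (x₁ : ℝ) x₂
  have hLx₂ := le_max_right (x₁ : ℝ) x₂
  have hL3 : 72 ≤ L := by nlinarith
  set E := Real.exp ((1 - δ / 2) * L) with hE
  have hE2 : 2 ≤ E := by
    have := Real.add_one_le_exp ((1 - δ / 2) * L)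
    nlinarith
  have hME : (M : ℝ) ≤ E := by rw [hM]; exact Nat.floor_le (by linarith)
  have hEM : E / 2 ≤ M := by
    have := Nat.lt_floor_add_one E
    rw [← hM] at this
    linarith
  have hnE : 10 * E ≤ n := by
    refine le_trans ?_ hn1
    have h1 : Real.exp L = Real.exp (δ / 2 * L) * E := by rw [hE, ← Real.exp_add]; ring_nf
    have := Real.add_one_le_exp (δ / 2 * L)
    rw [h1]
    gcongr
    linarith
  rw [mem_Ioc] at ht
  have htM : (t : ℝ) ≤ 2 * M := by exact_mod_cast ht.2
  have hn10 : 10 * M ≤ n := by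
    have : (10 * M : ℝ) ≤ n := by linarith
    exact_mod_cast this
  rw [card_filter_prime_sub (by omega : 2 * M ≤ n - t)]
  set x := n - t - M with hx
  have hxn : (x : ℝ) = n - t - M := by
    rw [hx, Nat.cast_sub (by omega), Nat.cast_sub (by omega)]
  have hxle : (x : ℝ) ≤ n := by rw [hxn]; linarith [Nat.cast_nonneg (α := ℝ) t]
  have hxge : (n : ℝ) / 2 ≤ x := by rw [hxn]; linarith
  have hexpL := Real.add_one_le_exp L
  have hn0 : (0 : ℝ) < n := (Real.exp_pos _).trans_le hn1
  have hx0 : (0 : ℝ) < x := by linarith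
  have hx1 : (1 : ℝ) ≤ x := by linarith
  have hlog1 : Real.log x ≤ (1 + δ / 4) * L := by
    rw [← Real.log_exp ((1 + δ / 4) * L)]
    exact Real.log_le_log hx0 (by linarith)
  have hlog2 : L / 2 ≤ Real.log x := by
    rw [Real.le_log_iff_exp_le hx0]
    have e1 : Real.exp L = Real.exp (L / 2) * Real.exp (L / 2) := by
      rw [← Real.exp_add]; ring_nf
    have e2 : 2 ≤ Real.exp (L / 2) := by linarith [Real.add_one_le_exp (L / 2)]
    have e3 := mul_le_mul_of_nonneg_right e2 (Real.exp_pos (L / 2)).le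
    linarith
  have hpow : (x : ℝ) ^ (1 - δ) ≤ M := by
    refine le_trans ?_ hEM
    rw [Real.rpow_def_of_pos hx0, le_div_iff₀ two_pos]
    have h1 : E = Real.exp ((1 - 3 / 4 * δ) * L) * Real.exp (δ / 4 * L) := by
      rw [hE, ← Real.exp_add]; ring_nf
    have := Real.add_one_le_exp (δ / 4 * L)
    have h2 : Real.log x * (1 - δ) ≤ (1 - 3 / 4 * δ) * L := by
      have h3 : 0 ≤ 1 - δ := by linarith
      have h4 : 0 ≤ δ ^ 2 * L := by positivity
      have h5 := mul_le_mul_of_nonneg_right hlog1 h3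
      linarith
    rw [h1]
    exact mul_le_mul (Real.exp_le_exp.2 h2) (by linarith) two_pos.le (Real.exp_pos _).le
  have hpow' : (x : ℝ) ^ (3 / 4 : ℝ) ≤ M :=
    (Real.rpow_le_rpow_of_exponent_le hx1 (by linarith)).trans hpow
  constructor
  · refine le_trans ?_ (hge x M ?_ hpow (by omega))
    · rw [div_le_div_iff₀ (by linarith) (by linarith)]
      have : Real.log x ≤ 2 * L := by nlinarith
      have h0 : 0 ≤ c / 2 * M := by positivity
      calc c / 2 * M * Real.log x ≤ c / 2 * M * (2 * L) := by gcongr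
        _ = _ := by ring
    · exact_mod_cast (by linarith : (x₁ : ℝ) ≤ x)
  · refine (hle x M ?_ hpow' (by omega)).trans ?_
    · exact_mod_cast (by linarith : (x₂ : ℝ) ≤ x)
    · rw [div_le_div_iff₀ (by linarith) (by linarith)]
      calc C * M * L ≤ C * M * (2 * Real.log x) := by gcongr; linarith
        _ = 2 * C * M * Real.log x := by ring
        _ ≤ _ := by
            have : 0 ≤ Real.log x := by linarith
            gcongr
            linarith

/-- A sparse set of `O(L)` elements representing all `n` with `log n ∈ [L, (1 + η) L)`. -/
lemma exists_block : ∃ η K L₀ : ℝ, 0 < η ∧ 0 < K ∧ 0 < L₀ ∧ ∀ L, L₀ ≤ L → ∃ F : Finset ℕ,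
    (∀ a ∈ F, Real.exp (L / 2) < a) ∧ (F.card : ℝ) ≤ K * L ∧
    ∀ n : ℕ, Real.exp L ≤ n → (n : ℝ) < Real.exp ((1 + η) * L) →
      ∃ a₁ ∈ F, ∃ a₂ ∈ F, ∃ p : ℕ, p.Prime ∧ n = a₁ + a₂ + p := by
  classical
  obtain ⟨δ, c, C, L₀, hδ0, hδ, hc, hcC, hL₀, hmain⟩ := exists_card_prime_sub_bounds
  have hC : 0 < C := by linarith
  have hL₀' : 72 ≤ L₀ := by nlinarith
  refine ⟨δ / 4, 6 * (1 + C) / c + 6, L₀, by positivity, by positivity, by linarith, ?_⟩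
  intro L hL
  have hL1 : 72 ≤ L := hL₀'.trans hL
  set M := ⌊Real.exp ((1 - δ / 2) * L)⌋₊ with hM
  have hmain' := hmain L hL M hM
  set W := Ioc M (2 * M) with hW
  have hWcard : W.card = M := by rw [hW, Nat.card_Ioc]; omega
  have hM1 : 1 ≤ M := by
    refine Nat.le_floor ?_
    push_cast
    exact Real.one_le_exp (by nlinarith)
  have hWne : W.Nonempty := by rw [← card_pos]; omega
  set B := (range ⌈Real.exp ((1 + δ / 4) * L)⌉₊).filter fun n : ℕ => Real.exp L ≤ n with hB
  have hmemB : ∀ n : ℕ, n ∈ B ↔ (n : ℝ) < Real.exp ((1 + δ / 4) * L) ∧ Real.exp L ≤ n := by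
    intro n
    rw [hB, mem_filter, mem_range, Nat.lt_ceil]
  have hBcard : (B.card : ℝ) ≤ Real.exp (2 * L) := by
    have h1 : (B.card : ℝ) ≤ ⌈Real.exp ((1 + δ / 4) * L)⌉₊ := by
      exact_mod_cast (card_filter_le _ _).trans (card_range _).le
    have h2 := Nat.ceil_lt_add_one (Real.exp_pos ((1 + δ / 4) * L)).le
    have h3 : Real.exp (2 * L) = Real.exp ((1 + δ / 4) * L) * Real.exp ((1 - δ / 4) * L) := by
      rw [← Real.exp_add]; ring_nf
    have h4 := Real.add_one_le_exp ((1 - δ / 4) * L)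
    have h5 : 1 ≤ Real.exp ((1 + δ / 4) * L) := Real.one_le_exp (by positivity)
    have h6 : 2 ≤ Real.exp ((1 - δ / 4) * L) := by nlinarith
    have h7 := mul_le_mul_of_nonneg_left h6 (Real.exp_pos ((1 + δ / 4) * L)).le
    linarith
  obtain ⟨S, hSW, hScard, hS⟩ := exists_half_cover (W := W) (R := fun n t s => (n - t - s).Prime)
    (B := B) (L := L) (c := c) (C := C) hWne (by linarith) hc hC.le hcC hBcard
    (fun n hn t ht => by
      rw [hmemB] at hn
      rw [hWcard]
      convert (hmain' n hn.2 hn.1 t ht).1)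
    (fun n hn s hs => by
      rw [hmemB] at hn
      rw [hWcard]
      simp only [Nat.sub_right_comm n _ s]
      convert (hmain' n hn.2 hn.1 s hs).2)
  obtain ⟨T, hTW, hTcard, hT⟩ := exists_hitting_set (W := W) (B := B) (k := ⌈4 * L⌉₊)
    (fun n t => ∃ s ∈ S, (n - t - s).Prime)
    (by
      have h1 : Real.exp (2 * L) < (2 : ℝ) ^ ⌈4 * L⌉₊ := by
        rw [← Real.rpow_natCast, Real.rpow_def_of_pos two_pos]
        refine Real.exp_lt_exp.2 ?_
        have h1 := Nat.le_ceil (4 * L)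
        have h2 := Real.log_two_gt_d9
        nlinarith
      exact_mod_cast hBcard.trans_lt h1)
    (fun n hn => by
      refine (hS n hn).trans (le_of_eq ?_)
      simp only [covered])
    hWne
  refine ⟨S ∪ T, ?_, ?_, ?_⟩
  · intro a ha
    have haW := union_subset hSW hTW ha
    rw [hW, mem_Ioc, hM, Nat.floor_lt (Real.exp_pos _).le] at haW
    refine lt_of_le_of_lt (Real.exp_le_exp.2 ?_) haW.1
    nlinarith
  · have h1 : ((S ∪ T).card : ℝ) ≤ S.card + T.card := by exact_mod_cast card_union_le _ _
    have h2 : (T.card : ℝ) ≤ ⌈4 * L⌉₊ := by exact_mod_cast hTcard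
    have h3 := Nat.ceil_lt_add_one (show 0 ≤ 4 * L by linarith)
    rw [add_mul]
    linarith
  · intro n hn1 hn2
    obtain ⟨t, ht, s, hs, hp⟩ := hT n ((hmemB n).2 ⟨hn2, hn1⟩)
    refine ⟨s, mem_union_left _ hs, t, mem_union_right _ ht, n - t - s, hp, ?_⟩
    have := hp.pos
    omega

lemma sum_range_pow_le {q Y : ℝ} (hq : 1 < q) (hY : 0 ≤ Y) (n : ℕ) (h : ∀ i < n, q ^ i ≤ Y) :
    ∑ i ∈ range n, q ^ i ≤ q / (q - 1) * Y := by
  have hq1 : 0 < q - 1 := by linarith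
  rcases n with _ | n
  · simp only [range_zero, sum_empty]
    positivity
  · rw [geom_sum_eq hq.ne', div_mul_eq_mul_div]
    have h1 := h n (Nat.lt_succ_self n)
    gcongr
    rw [pow_succ']
    nlinarith

end AddCompl

/-- There exist a set `A ⊆ ℕ`, a constant `C > 0`, and a threshold `N₀` such that
`A(x) ≤ C · log x` for all `x ≥ 2`, and every integer `n ≥ N₀` is `a₁ + a₂ + p` with
`a₁, a₂ ∈ A` and `p` prime. -/
theorem additive_complement_order_two_all_integers :
    ∃ (A : Set ℕ) (C : ℝ) (N₀ : ℕ), 0 < C ∧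
      (∀ x : ℝ, 2 ≤ x → (countFn A x : ℝ) ≤ C * Real.log x) ∧
      (∀ n : ℕ, N₀ ≤ n →
        ∃ a₁ a₂ p : ℕ, a₁ ∈ A ∧ a₂ ∈ A ∧ Nat.Prime p ∧ n = a₁ + a₂ + p) := by
  obtain ⟨η, K, L₀, hη, hK, hL₀, hblock⟩ := AddCompl.exists_block
  set q := 1 + η with hq
  have hq1 : 1 < q := by linarith
  obtain ⟨i₀, hi₀⟩ := pow_unbounded_of_one_lt L₀ hq1
  have hpow : ∀ i, i₀ ≤ i → L₀ ≤ q ^ i := fun i hi =>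
    hi₀.le.trans (pow_le_pow_right₀ hq1.le hi)
  choose! F hF using fun i (hi : i₀ ≤ i) => hblock (q ^ i) (hpow i hi)
  have hq0 : 0 < q - 1 := by linarith
  refine ⟨{a | ∃ i, i₀ ≤ i ∧ a ∈ F i}, K * (q / (q - 1) * 2), ⌈Real.exp (q ^ i₀)⌉₊,
    by positivity, ?_, ?_⟩
  · intro x hx
    rw [countFn]
    have hlog : 0 ≤ Real.log x := Real.log_nonneg (by linarith)
    have hex : ∃ n : ℕ, 2 * Real.log x < q ^ n := pow_unbounded_of_one_lt _ hq1
    set m := Nat.find hex with hm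
    have hlt : ∀ i, i < m → q ^ i ≤ 2 * Real.log x := fun i hi => not_lt.1 (Nat.find_min hex hi)
    have hsub : {a : ℕ | a ∈ {a | ∃ i, i₀ ≤ i ∧ a ∈ F i} ∧ 1 ≤ a ∧ (a : ℝ) ≤ x} ⊆
        (((Finset.range m).filter (i₀ ≤ ·)).biUnion F : Finset ℕ) := by
      rintro a ⟨⟨i, hi, ha⟩, ha1, hax⟩
      rw [Finset.mem_coe, Finset.mem_biUnion]
      refine ⟨i, Finset.mem_filter.2 ⟨Finset.mem_range.2 ?_, hi⟩, ha⟩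
      by_contra! hmi
      have h1 : Real.exp (q ^ i / 2) < x := ((hF i hi).1 a ha).trans_le hax
      have h2 := (Real.lt_log_iff_exp_lt (by linarith)).2 h1
      have h3 : 2 * Real.log x < q ^ m := Nat.find_spec hex
      have h4 : q ^ m ≤ q ^ i := pow_le_pow_right₀ hq1.le hmi
      linarith
    have h1 := (Set.ncard_le_ncard hsub (Finset.finite_toSet _)).trans_eq (Set.ncard_coe_finset _)
    have h2 := h1.trans Finset.card_biUnion_le
    calc (Set.ncard _ : ℝ) ≤ ∑ i ∈ (Finset.range m).filter (i₀ ≤ ·), ((F i).card : ℝ) := by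
          exact_mod_cast h2
      _ ≤ ∑ i ∈ (Finset.range m).filter (i₀ ≤ ·), K * q ^ i :=
          Finset.sum_le_sum fun i hi => (hF i (Finset.mem_filter.1 hi).2).2.1
      _ ≤ ∑ i ∈ Finset.range m, K * q ^ i :=
          Finset.sum_le_sum_of_subset_of_nonneg (Finset.filter_subset _ _) fun i _ _ => by
            positivity
      _ = K * ∑ i ∈ Finset.range m, q ^ i := by rw [Finset.mul_sum]
      _ ≤ K * (q / (q - 1) * (2 * Real.log x)) := by
          gcongr
          exact AddCompl.sum_range_pow_le hq1 (by positivity) m hlt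
      _ = _ := by ring
  · intro n hn
    have hn1 : Real.exp (q ^ i₀) ≤ n := Nat.ceil_le.1 hn
    have hn0 : (0 : ℝ) < n := (Real.exp_pos _).trans_le hn1
    have hlog : q ^ i₀ ≤ Real.log n := (Real.le_log_iff_exp_le hn0).2 hn1
    obtain ⟨i, hi1, hi2⟩ := exists_nat_pow_near ((one_le_pow₀ hq1.le).trans hlog) hq1
    have hi : i₀ ≤ i := by
      have := (pow_lt_pow_iff_right₀ hq1).1 (hlog.trans_lt hi2)
      omega
    obtain ⟨a₁, h₁, a₂, h₂, p, hp, hnp⟩ := (hF i hi).2.2 n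
      ((Real.le_log_iff_exp_le hn0).1 hi1)
      (by
        rw [← pow_succ']
        exact (Real.log_lt_iff_lt_exp hn0).1 hi2)
    exact ⟨a₁, a₂, p, ⟨i, hi, h₁⟩, ⟨i, hi, h₂⟩, hp, hnp⟩
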